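/- arXiv:2402.01447 — 4 statements merged into one kernel-verified Lean document; each statement's English description precedes it below -/
import Mathlib

section
/- There exist ε > 0, C > 1 and a natural number N such that for every odd n ≥ N the following holds. Let p ≥ C·log(n)/n and 1 ≤ β ≤ ε·np/log(n). Then every (p,β)-jumbled simple graph G on n vertices with minimum degree δ(G) ≥ (1−ε)np satisfies C_n(G) = C(G). -/
open SimpleGraph

/-- The cycle space of a simple graph: the `ZMod 2`-span of the indicator functions of
edge sets of cycles. -/
noncomputable def cycleSpace {V : Type} [Fintype V] [DecidableEq V] (G : SimpleGraph V) :
    Submodule (ZMod 2) (Sym2 V → ZMod 2) :=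
  Submodule.span (ZMod 2)
    {f | ∃ (x : V) (c : G.Walk x x), c.IsCycle ∧
      f = fun e => if e ∈ c.edges then 1 else 0}

/-- The span of indicator functions of edge sets of Hamilton cycles. -/
noncomputable def hamiltonSpace {V : Type} [Fintype V] [DecidableEq V] (G : SimpleGraph V) :
    Submodule (ZMod 2) (Sym2 V → ZMod 2) :=
  Submodule.span (ZMod 2)
    {f | ∃ (x : V) (c : G.Walk x x), c.IsHamiltonianCycle ∧
      f = fun e => if e ∈ c.edges then 1 else 0}

/-- The number of edges of `G` with both endpoints inside `U`. -/
noncomputable def interiorEdgeCount {V : Type} (G : SimpleGraph V) (U : Set V) : ℕ :=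
  {e ∈ G.edgeSet | ∀ v ∈ e, v ∈ U}.ncard

/-- `G` is `(p, β)`-jumbled: `0 < p < 1 ≤ β` and for every vertex subset `U`,
`|e_G(U) - p * binom(|U|, 2)| ≤ β * |U|`. -/
def IsJumbled {V : Type} (G : SimpleGraph V) (p β : ℝ) : Prop :=
  0 < p ∧ p < 1 ∧ 1 ≤ β ∧
    ∀ U : Set V,
      |(interiorEdgeCount G U : ℝ) - p * (Nat.choose U.ncard 2 : ℕ)| ≤ β * U.ncard

namespace JumbledHamilton

section Steps

variable {V : Type*}

/-- The unordered pairs of consecutive entries of a list. -/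
def steps : List V → List (Sym2 V)
  | x :: y :: t => s(x, y) :: steps (y :: t)
  | _ => []

@[simp] lemma steps_nil : steps ([] : List V) = [] := rfl

@[simp] lemma steps_singleton (x : V) : steps [x] = [] := rfl

@[simp] lemma steps_cons_cons (x y : V) (t : List V) :
    steps (x :: y :: t) = s(x, y) :: steps (y :: t) := rfl

lemma steps_append_cons (p : List V) (x : V) (q : List V) :
    steps (p ++ x :: q) = steps (p ++ [x]) ++ steps (x :: q) := by
  induction p with
  | nil => simp
  | cons a p ih =>
    cases p with
    | nil => simp
    | cons b p => simpa using ih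

lemma steps_append_cons_cons (p : List V) (x y : V) (q : List V) :
    steps (p ++ x :: y :: q) = steps (p ++ [x]) ++ s(x, y) :: steps (y :: q) := by
  rw [steps_append_cons, steps_cons_cons]

lemma steps_reverse (l : List V) : steps l.reverse = (steps l).reverse := by
  induction l with
  | nil => simp
  | cons a l ih =>
    cases l with
    | nil => simp
    | cons b l =>
      have h : (a :: b :: l).reverse = l.reverse ++ b :: a :: [] := by simp
      rw [h, steps_append_cons_cons]
      have h2 : l.reverse ++ [b] = (b :: l).reverse := by simp
      rw [h2, ih]
      simp [Sym2.eq_swap]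

lemma mem_steps_reverse {l : List V} {e : Sym2 V} : e ∈ steps l.reverse ↔ e ∈ steps l := by
  rw [steps_reverse, List.mem_reverse]

lemma mem_of_mem_steps {l : List V} {e : Sym2 V} (he : e ∈ steps l) {v : V} (hv : v ∈ e) :
    v ∈ l := by
  induction l with
  | nil => simp at he
  | cons a l ih =>
    cases l with
    | nil => simp at he
    | cons b l =>
      rw [steps_cons_cons, List.mem_cons] at he
      rcases he with rfl | he
      · rcases Sym2.mem_iff.1 hv with rfl | rfl <;> simp
      · exact List.mem_cons_of_mem _ (ih he)

lemma steps_subset_of_isInfix {p l : List V} (h : p <:+: l) : steps p ⊆ steps l := by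
  obtain ⟨u, w, rfl⟩ := h
  intro e he
  cases p with
  | nil => simp at he
  | cons a p =>
    have h1 : e ∈ steps ((a :: p) ++ w) := by
      rcases List.eq_nil_or_concat (a :: p) with h | ⟨r, b, h⟩
      · simp at h
      · rw [h] at he ⊢
        have : r.concat b ++ w = r ++ b :: w := by simp
        rw [this, steps_append_cons]
        simp only [List.concat_eq_append] at he
        exact List.mem_append_left _ he
    rw [List.append_assoc, List.cons_append, steps_append_cons]
    exact List.mem_append_right _ h1

/-- In a list without repetition, an entry is consecutive only to its predecessor and
its successor. -/
lemma getLast?_or_head?_of_mem_steps {p q : List V} {w c : V} (hn : (p ++ w :: q).Nodup)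
    (h : s(w, c) ∈ steps (p ++ w :: q)) : p.getLast? = some c ∨ q.head? = some c := by
  rw [steps_append_cons, List.mem_append] at h
  rcases h with h | h
  · left
    rcases List.eq_nil_or_concat p with rfl | ⟨r, b, rfl⟩
    · simp at h
    · simp only [List.concat_eq_append, List.append_assoc, List.cons_append,
        List.nil_append] at h hn
      rw [steps_append_cons_cons] at h
      simp only [steps_singleton, List.mem_append, List.mem_cons, List.not_mem_nil,
        or_false] at h
      rcases h with h | h
      · exfalso
        have := mem_of_mem_steps h (Sym2.mem_mk_left w c)
        simp only [List.mem_append, List.mem_singleton] at this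
        grind
      · rw [Sym2.eq_swap, Sym2.eq_iff] at h
        simp only [List.concat_eq_append, List.getLast?_append, List.getLast?_singleton,
          Option.some_or]
        grind
  · right
    cases q with
    | nil => simp at h
    | cons b q =>
      rw [steps_cons_cons, List.mem_cons] at h
      rcases h with h | h
      · rw [Sym2.eq_iff] at h
        simp only [List.head?_cons]
        grind
      · exfalso
        have := mem_of_mem_steps h (Sym2.mem_mk_left w c)
        grind

/-- The entries consecutive to `w` in the list `l`. -/
noncomputable def listNbrs [Fintype V] (l : List V) (w : V) : Finset V := by
  classical exact Finset.univ.filter fun c => s(w, c) ∈ steps l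

@[simp] lemma mem_listNbrs [Fintype V] {l : List V} {w c : V} :
    c ∈ listNbrs l w ↔ s(w, c) ∈ steps l := by
  classical simp [listNbrs]

lemma listNbrs_reverse [Fintype V] (l : List V) (w : V) :
    listNbrs l.reverse w = listNbrs l w := by
  ext c; simp [mem_steps_reverse]

lemma card_listNbrs_le_two [Fintype V] {l : List V} (hn : l.Nodup) (w : V) :
    (listNbrs l w).card ≤ 2 := by
  classical
  by_cases hw : w ∈ l
  · obtain ⟨p, q, rfl⟩ := List.append_of_mem hw
    have : listNbrs (p ++ w :: q) w ⊆ p.getLast?.toFinset ∪ q.head?.toFinset := by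
      intro c hc
      rcases getLast?_or_head?_of_mem_steps hn (mem_listNbrs.1 hc) with h | h <;> simp [h]
    refine (Finset.card_le_card this).trans ((Finset.card_union_le _ _).trans ?_)
    have h1 : ∀ o : Option V, o.toFinset.card ≤ 1 := by
      intro o; cases o <;> simp
    exact add_le_add (h1 _) (h1 _)
  · have : listNbrs l w = ∅ := by
      ext c
      simp only [mem_listNbrs, Finset.notMem_empty, iff_false]
      exact fun h => hw (mem_of_mem_steps h (Sym2.mem_mk_left w c))
    simp [this]

lemma card_biUnion_listNbrs_le [Fintype V] [DecidableEq V] {l : List V} (hn : l.Nodup)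
    (Z : Finset V) : (Z.biUnion (listNbrs l)).card ≤ 2 * Z.card := by
  rw [mul_comm]
  exact Finset.card_biUnion_le_card_mul _ _ _ fun w _ => card_listNbrs_le_two hn w

lemma infix_or_infix_of_notMem {I p q : List V} {x : V} (hx : x ∉ I)
    (h : I <:+: p ++ x :: q) : I <:+: p ∨ I <:+: q := by
  obtain ⟨u, w, h⟩ := h
  rw [List.append_assoc] at h
  rcases List.append_eq_append_iff.1 h with ⟨a, h1, h2⟩ | ⟨a, h1, h2⟩
  · rcases List.append_eq_append_iff.1 h2 with ⟨b, h3, h4⟩ | ⟨b, h3, h4⟩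
    · left; exact ⟨u, b, by rw [h1, h3, List.append_assoc]⟩
    · cases b with
      | nil => left; exact ⟨u, [], by rw [h1, h3]; simp⟩
      | cons y b =>
        have : x = y := by simp at h4; exact h4.1
        subst this
        exact absurd (by rw [h3]; simp) hx
  · cases a with
    | nil =>
      simp only [List.nil_append] at h2
      cases I with
      | nil => left; exact ⟨[], _, rfl⟩
      | cons y I => simp at h2; grind
    | cons y a =>
      right
      simp only [List.cons_append, List.cons.injEq] at h2
      exact ⟨a, w, by rw [h2.2, List.append_assoc]⟩

lemma infix_of_disjoint_append {I J q : List V} (hI : I ≠ []) (hJ : ∀ x ∈ J, x ∉ I)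
    (h : I <:+: J ++ q) : I <:+: q := by
  induction J with
  | nil => simpa using h
  | cons x J ih =>
    have h' : I <:+: [] ++ x :: (J ++ q) := by simpa using h
    rcases infix_or_infix_of_notMem (hJ x (by simp)) h' with h1 | h1
    · exact absurd (List.infix_nil.1 h1) hI
    · exact ih (fun y hy => hJ y (List.mem_cons_of_mem _ hy)) h1

lemma infix_or_infix_of_disjoint {I J p q : List V} (hI : I ≠ []) (hJ : J ≠ [])
    (hd : ∀ x ∈ J, x ∉ I) (h : I <:+: p ++ (J ++ q)) : I <:+: p ∨ I <:+: q := by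
  cases J with
  | nil => exact absurd rfl hJ
  | cons x J =>
    rcases infix_or_infix_of_notMem (hd x (by simp)) h with h | h
    · exact Or.inl h
    · exact Or.inr (infix_of_disjoint_append hI (fun y hy => hd y (by simp [hy])) h)

end Steps

end JumbledHamilton

namespace JumbledHamilton

section Rotation

variable {V : Type*} [Fintype V] [DecidableEq V]

omit [Fintype V] [DecidableEq V] in
lemma getLast?_append_cons_reverse_cons (p q : List V) (w b : V) :
    (p ++ w :: (b :: q).reverse).getLast? = some b := by
  rw [List.reverse_cons, ← List.cons_append, ← List.append_assoc, List.getLast?_append]; simp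

/-- The vertices having a neighbour in `X`. -/
noncomputable def nbhd (H : SimpleGraph V) (X : Finset V) : Finset V := by
  classical exact Finset.univ.filter fun v => ∃ x ∈ X, H.Adj x v

omit [DecidableEq V] in
@[simp] lemma mem_nbhd {H : SimpleGraph V} {X : Finset V} {v : V} :
    v ∈ nbhd H X ↔ ∃ x ∈ X, H.Adj x v := by
  classical simp [nbhd]

/-- `Rotates H Q l₀ k l` says that `l` arises from `l₀` by `k` Pósa rotations of the last
vertex with pivots in `Q`. -/
inductive Rotates (H : SimpleGraph V) (Q : Finset V) (l₀ : List V) : ℕ → List V → Prop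
  | refl : Rotates H Q l₀ 0 l₀
  | step {k : ℕ} {p q : List V} {w y : V} : Rotates H Q l₀ k (p ++ w :: q) → w ∈ Q →
      q.getLast? = some y → H.Adj w y → Rotates H Q l₀ (k + 1) (p ++ w :: q.reverse)

/-- The last vertices of the lists obtained from `l₀` by at most `k` rotations. -/
noncomputable def rotationEnds (H : SimpleGraph V) (Q : Finset V) (l₀ : List V) (k : ℕ) :
    Finset V := by
  classical
  exact Finset.univ.filter fun z => ∃ j ≤ k, ∃ l, Rotates H Q l₀ j l ∧ l.getLast? = some z

variable {H : SimpleGraph V} {Q : Finset V} {l₀ l : List V} {k : ℕ}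

omit [DecidableEq V] in
@[simp] lemma mem_rotationEnds {z : V} :
    z ∈ rotationEnds H Q l₀ k ↔ ∃ j ≤ k, ∃ l, Rotates H Q l₀ j l ∧ l.getLast? = some z := by
  classical simp [rotationEnds]

omit [DecidableEq V] in
lemma rotationEnds_mono {j k : ℕ} (h : j ≤ k) :
    rotationEnds H Q l₀ j ⊆ rotationEnds H Q l₀ k := by
  intro z hz
  rw [mem_rotationEnds] at hz ⊢
  obtain ⟨i, hi, r⟩ := hz
  exact ⟨i, hi.trans h, r⟩

omit [Fintype V] [DecidableEq V] in
lemma Rotates.perm (h : Rotates H Q l₀ k l) : l.Perm l₀ := by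
  induction h with
  | refl => exact List.Perm.refl _
  | @step k p q w y _ _ _ _ ih =>
    exact (((List.reverse_perm q).cons w).append_left p).trans ih

omit [Fintype V] [DecidableEq V] in
lemma Rotates.exists_append {u q₀ : List V} (h : Rotates H Q (u ++ q₀) k l)
    (hQ : ∀ w ∈ Q, w ∉ u) : ∃ q, l = u ++ q := by
  induction h with
  | refl => exact ⟨q₀, rfl⟩
  | @step k p q w y _ hw _ _ ih =>
    obtain ⟨q', hq'⟩ := ih
    rcases List.append_eq_append_iff.1 hq' with ⟨a, h1, h2⟩ | ⟨a, h1, h2⟩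
    · cases a with
      | nil => exact ⟨w :: q.reverse, by rw [h1]; simp⟩
      | cons b a =>
        simp only [List.cons_append, List.cons.injEq] at h2
        exact absurd (by rw [h1, h2.1]; simp) (hQ w hw)
    · exact ⟨a ++ w :: q.reverse, by rw [h1]; simp⟩

omit [Fintype V] in
lemma Rotates.exists_pivots (h : Rotates H Q l₀ k l) :
    ∃ P : Finset V, P.card ≤ k ∧ ∀ I : List V, (∀ x ∈ I, x ∉ P) →
      (I <:+: l₀ ∨ I.reverse <:+: l₀) → (I <:+: l ∨ I.reverse <:+: l) := by
  induction h with
  | refl => exact ⟨∅, by simp, fun I _ h => h⟩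
  | @step k p q w y _ _ _ _ ih =>
    obtain ⟨P, hP, hI⟩ := ih
    refine ⟨insert w P, (Finset.card_insert_le _ _).trans (by omega), fun I hd h => ?_⟩
    have hw : w ∉ I := fun hw => hd w hw (Finset.mem_insert_self _ _)
    have key : ∀ J : List V, w ∉ J → J <:+: p ++ w :: q →
        J <:+: p ++ w :: q.reverse ∨ J.reverse <:+: p ++ w :: q.reverse := by
      intro J hJ h
      rcases infix_or_infix_of_notMem hJ h with h | h
      · exact Or.inl (h.trans (List.prefix_append _ _).isInfix)
      · right
        exact (List.IsInfix.reverse h).trans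
          (((List.suffix_cons w _).trans (List.suffix_append _ _)).isInfix)
    rcases hI I (fun x hx hxP => hd x hx (Finset.mem_insert_of_mem hxP)) h with h | h
    · exact key I hw h
    · rcases key I.reverse (by simpa using hw) h with h | h
      · exact Or.inr h
      · exact Or.inl (by simpa using h)

/-- A list of distinct vertices, consecutive ones being adjacent or forming the pair `f`,
and passing through `f`. -/
def Admissible (H : SimpleGraph V) (f : Sym2 V) (l : List V) : Prop :=
  l.Nodup ∧ (∀ e ∈ steps l, e ∈ H.edgeSet ∨ e = f) ∧ f ∈ steps l

omit [Fintype V] [DecidableEq V] in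
lemma Admissible.reverse {f : Sym2 V} (h : Admissible H f l) : Admissible H f l.reverse :=
  ⟨List.nodup_reverse.2 h.1, fun e he => h.2.1 e (mem_steps_reverse.1 he),
    mem_steps_reverse.2 h.2.2⟩

omit [Fintype V] [DecidableEq V] in
lemma mem_steps_rotate {p q : List V} {w y : V} (hy : q.getLast? = some y) (e : Sym2 V) :
    e ∈ steps (p ++ w :: q.reverse) ↔ e ∈ steps (p ++ [w]) ∨ e = s(w, y) ∨ e ∈ steps q := by
  rcases List.eq_nil_or_concat q with rfl | ⟨r, b, rfl⟩
  · simp at hy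
  · have : b = y := by simpa using hy
    subst this
    simp only [List.concat_eq_append, List.reverse_append, List.reverse_cons, List.reverse_nil,
      List.nil_append, List.singleton_append]
    rw [steps_append_cons_cons, List.mem_append, List.mem_cons]
    rw [show b :: r.reverse = (r ++ [b]).reverse by simp, mem_steps_reverse]

omit [Fintype V] [DecidableEq V] in
lemma Rotates.admissible {f : Sym2 V} (h : Rotates H Q l₀ k l) (h₀ : Admissible H f l₀)
    (hQ : ∀ w ∈ Q, w ∉ f) : Admissible H f l := by
  induction h with
  | refl => exact h₀
  | @step k p q w y h hw hy hwy ih =>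
    refine ⟨(Rotates.step h hw hy hwy).perm.nodup_iff.2 h₀.1, fun e he => ?_, ?_⟩
    · rw [mem_steps_rotate hy] at he
      rcases he with he | rfl | he
      · exact ih.2.1 e (by rw [steps_append_cons]; exact List.mem_append_left _ he)
      · exact Or.inl hwy
      · refine ih.2.1 e (steps_subset_of_isInfix ?_ he)
        exact ((List.suffix_cons w _).trans (List.suffix_append _ _)).isInfix
    · rw [mem_steps_rotate hy]
      have hf := ih.2.2
      rw [steps_append_cons, List.mem_append] at hf
      rcases hf with hf | hf
      · exact Or.inl hf
      · cases q with
        | nil => simp at hy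
        | cons b q =>
          rw [steps_cons_cons, List.mem_cons] at hf
          rcases hf with hf | hf
          · exact absurd (by rw [hf]; exact Sym2.mem_mk_left w b) (hQ w hw)
          · exact Or.inr (Or.inr hf)

omit [DecidableEq V] in
lemma Rotates.mem_steps_or (h : Rotates H Q l₀ k l) {e : Sym2 V} (he : e ∈ steps l₀) :
    e ∈ steps l ∨ ∃ z ∈ e, z ∈ rotationEnds H Q l₀ k := by
  induction h with
  | refl => exact Or.inl he
  | @step k p q w y h hw hy hwy ih =>
    rcases ih with ih | ⟨z, hz, hzE⟩
    · rw [mem_steps_rotate hy]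
      rw [steps_append_cons, List.mem_append] at ih
      rcases ih with hf | hf
      · exact Or.inl (Or.inl hf)
      · cases q with
        | nil => simp at hy
        | cons b q =>
          rw [steps_cons_cons, List.mem_cons] at hf
          rcases hf with hf | hf
          · right
            refine ⟨b, by rw [hf]; exact Sym2.mem_mk_right w b, ?_⟩
            rw [mem_rotationEnds]
            exact ⟨k + 1, le_rfl, _, Rotates.step h hw hy hwy,
              getLast?_append_cons_reverse_cons _ _ _ _⟩
          · exact Or.inl (Or.inr (Or.inr hf))
    · exact Or.inr ⟨z, hz, rotationEnds_mono (Nat.le_succ k) hzE⟩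

omit [DecidableEq V] in
/-- If `K` contains the pivots, their neighbours on the list, and the last vertex, then it
contains all last vertices obtained by rotations. -/
lemma Rotates.getLast_mem {K : Finset V} (h : Rotates H Q l₀ k l)
    (h₀ : ∀ z, l₀.getLast? = some z → z ∈ K) (hQ : Q ⊆ K)
    (hN : ∀ w ∈ Q, listNbrs l₀ w ⊆ K) :
    (∀ z, l.getLast? = some z → z ∈ K) ∧
      ∀ e ∈ steps l, e ∈ steps l₀ ∨ ∀ v ∈ e, v ∈ K := by
  induction h with
  | refl => exact ⟨h₀, fun e he => Or.inl he⟩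
  | @step k p q w y h hw hy hwy ih =>
    obtain ⟨ih1, ih2⟩ := ih
    have hyK : y ∈ K := by
      apply ih1
      cases q with
      | nil => simp at hy
      | cons b q => rw [List.getLast?_append, List.getLast?_cons_cons, hy]; simp
    constructor
    · intro z hz
      cases q with
      | nil => simp at hy
      | cons b q =>
        have hz' : b = z := by
          rw [getLast?_append_cons_reverse_cons] at hz; exact Option.some.inj hz
        subst hz'
        have hb : s(w, b) ∈ steps (p ++ w :: b :: q) := by
          rw [steps_append_cons_cons]; simp
        rcases ih2 _ hb with hb | hb
        · exact hN w hw (mem_listNbrs.2 hb)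
        · exact hb b (Sym2.mem_mk_right w b)
    · intro e he
      rw [mem_steps_rotate hy] at he
      rcases he with he | rfl | he
      · exact ih2 e (by rw [steps_append_cons]; exact List.mem_append_left _ he)
      · right
        intro v hv
        rcases Sym2.mem_iff.1 hv with rfl | rfl
        · exact hQ hw
        · exact hyK
      · refine ih2 e (steps_subset_of_isInfix ?_ he)
        exact ((List.suffix_cons w _).trans (List.suffix_append _ _)).isInfix

/-- Pósa's observation. -/
lemma Rotates.posa (h : Rotates H Q l₀ k l) (hn : l₀.Nodup) {y w c d : V}
    (hy : l.getLast? = some y) (hw : w ∈ Q) (hwl : w ∈ l) (hwy : H.Adj w y) (hcd : c ≠ d)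
    (hc : s(w, c) ∈ steps l₀) (hd : s(w, d) ∈ steps l₀) :
    w ∈ rotationEnds H Q l₀ k ∨ c ∈ rotationEnds H Q l₀ (k + 1) ∨
      d ∈ rotationEnds H Q l₀ (k + 1) := by
  by_contra! hcon
  obtain ⟨h1, h2, h3⟩ := hcon
  have keep : ∀ x, x ∉ rotationEnds H Q l₀ (k + 1) → s(w, x) ∈ steps l₀ →
      s(w, x) ∈ steps l := by
    intro x hx hs
    rcases h.mem_steps_or hs with h' | ⟨z, hz, hzE⟩
    · exact h'
    · rcases Sym2.mem_iff.1 hz with rfl | rfl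
      · exact absurd hzE h1
      · exact absurd (rotationEnds_mono (Nat.le_succ k) hzE) hx
  have hcl := keep c h2 hc
  have hdl := keep d h3 hd
  have hnl : l.Nodup := h.perm.nodup_iff.2 hn
  obtain ⟨p, q, rfl⟩ := List.append_of_mem hwl
  have hq : q.getLast? = some y := by
    cases q with
    | nil =>
      have : w = y := by simpa [List.getLast?_append] using hy
      exact absurd (this ▸ hwy) (H.irrefl)
    | cons b q => simpa [List.getLast?_append, List.getLast?_cons_cons] using hy
  have hend : ∀ x, q.head? = some x → x ∈ rotationEnds H Q l₀ (k + 1) := by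
    intro x hx
    rw [mem_rotationEnds]
    refine ⟨k + 1, le_rfl, _, Rotates.step h hw hq hwy, ?_⟩
    cases q with
    | nil => simp at hx
    | cons b q => rw [getLast?_append_cons_reverse_cons]; exact hx
  rcases getLast?_or_head?_of_mem_steps hnl hcl with h4 | h4
  · rcases getLast?_or_head?_of_mem_steps hnl hdl with h5 | h5
    · exact hcd (by rw [h4] at h5; exact Option.some.inj h5)
    · exact h3 (hend d h5)
  · exact h2 (hend c h4)

lemma card_nbhd_rotationEnds_inter_le (hn : l₀.Nodup)
    (hmem : ∀ y ∈ rotationEnds H Q l₀ k, ∀ w ∈ Q, H.Adj w y → w ∈ l₀)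
    (hQ : ∀ w ∈ Q, w ∈ l₀ → w ∈ rotationEnds H Q l₀ k ∨ (listNbrs l₀ w).card = 2) :
    (nbhd H (rotationEnds H Q l₀ k) ∩ Q).card ≤ 3 * (rotationEnds H Q l₀ (k + 1)).card := by
  set E := rotationEnds H Q l₀ (k + 1) with hE
  have hsub : nbhd H (rotationEnds H Q l₀ k) ∩ Q ⊆ E ∪ E.biUnion (listNbrs l₀) := by
    intro w hw
    rw [Finset.mem_inter, mem_nbhd] at hw
    obtain ⟨⟨y, hyE, hyw⟩, hwQ⟩ := hw
    have hwl := hmem y hyE w hwQ hyw.symm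
    rw [Finset.mem_union, Finset.mem_biUnion]
    rcases hQ w hwQ hwl with h | h
    · exact Or.inl (rotationEnds_mono (Nat.le_succ k) h)
    · obtain ⟨c, d, hcd, hw2⟩ := Finset.card_eq_two.1 h
      have hc : s(w, c) ∈ steps l₀ := mem_listNbrs.1 (by rw [hw2]; simp)
      have hd : s(w, d) ∈ steps l₀ := mem_listNbrs.1 (by rw [hw2]; simp)
      obtain ⟨j, hj, l, hl, hy⟩ := mem_rotationEnds.1 hyE
      rcases hl.posa hn hy hwQ (hl.perm.mem_iff.2 hwl) hyw.symm hcd hc hd with h | h | h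
      · exact Or.inl (rotationEnds_mono (by omega) h)
      · exact Or.inr ⟨c, rotationEnds_mono (by omega) h, by
          rw [mem_listNbrs, Sym2.eq_swap]; exact hc⟩
      · exact Or.inr ⟨d, rotationEnds_mono (by omega) h, by
          rw [mem_listNbrs, Sym2.eq_swap]; exact hd⟩
  calc _ ≤ _ := Finset.card_le_card hsub
    _ ≤ E.card + (E.biUnion (listNbrs l₀)).card := Finset.card_union_le _ _
    _ ≤ E.card + 2 * E.card := by gcongr; exact card_biUnion_listNbrs_le hn E
    _ = 3 * E.card := by ring

end Rotation

end JumbledHamilton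

namespace JumbledHamilton

section Posa

variable {V : Type*}

lemma mem_steps_append_iff {l₁ l₂ : List V} {e : Sym2 V} : e ∈ steps (l₁ ++ l₂) ↔
    e ∈ steps l₁ ∨ e ∈ steps l₂ ∨
      ∃ x y, l₁.getLast? = some x ∧ l₂.head? = some y ∧ e = s(x, y) := by
  rcases List.eq_nil_or_concat l₁ with rfl | ⟨r, b, rfl⟩
  · simp
  · cases l₂ with
    | nil => simp
    | cons c t =>
      rw [List.concat_eq_append, List.append_assoc, List.singleton_append,
        steps_append_cons_cons]
      simp only [List.mem_append, List.mem_cons, List.getLast?_append, List.getLast?_singleton,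
        Option.some_or, Option.some.injEq, List.head?_cons]
      constructor
      · rintro (h | h | h)
        · exact Or.inl h
        · exact Or.inr (Or.inr ⟨b, c, rfl, rfl, h⟩)
        · exact Or.inr (Or.inl h)
      · rintro (h | h | ⟨x, y, rfl, rfl, h⟩)
        · exact Or.inl h
        · exact Or.inr (Or.inr h)
        · exact Or.inr (Or.inl h)

lemma exists_eq_append_of_mem_steps {l : List V} {e : Sym2 V} (he : e ∈ steps l) :
    ∃ p c d q, l = p ++ c :: d :: q ∧ e = s(c, d) := by
  induction l with
  | nil => simp at he
  | cons a l ih =>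
    cases l with
    | nil => simp at he
    | cons b l =>
      rw [steps_cons_cons, List.mem_cons] at he
      rcases he with rfl | he
      · exact ⟨[], a, b, l, rfl, rfl⟩
      · obtain ⟨p, c, d, q, h, h'⟩ := ih he
        exact ⟨a :: p, c, d, q, by rw [h]; rfl, h'⟩

lemma card_listNbrs_eq_two [Fintype V] {l : List V} (hn : l.Nodup) {w : V} (hw : w ∈ l)
    (hh : l.head? ≠ some w) (hl : l.getLast? ≠ some w) : (listNbrs l w).card = 2 := by
  classical
  obtain ⟨p, q, rfl⟩ := List.append_of_mem hw
  rcases List.eq_nil_or_concat p with rfl | ⟨r, b, rfl⟩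
  · simp at hh
  cases q with
  | nil => simp at hl
  | cons c q =>
    refine le_antisymm (card_listNbrs_le_two hn w) ?_
    rw [List.concat_eq_append, List.append_assoc, List.singleton_append] at hn ⊢
    have hbc : b ≠ c := by
      rintro rfl
      simp [List.nodup_append] at hn
    rw [← Finset.card_pair hbc]
    apply Finset.card_le_card
    intro x hx
    rw [mem_listNbrs, steps_append_cons_cons]
    simp only [Finset.mem_insert, Finset.mem_singleton] at hx
    rcases hx with rfl | rfl
    · simp [Sym2.eq_swap]
    · simp

/-- `l` is admissible and has maximum length among admissible lists. -/
def MaxAdmissible (H : SimpleGraph V) (f : Sym2 V) (l : List V) : Prop :=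
  Admissible H f l ∧ ∀ l', Admissible H f l' → l'.length ≤ l.length

variable {H : SimpleGraph V} {f : Sym2 V} {l : List V} {a b : V}

lemma exists_maxAdmissible [Fintype V] (hab : a ≠ b) : ∃ l, MaxAdmissible H s(a, b) l := by
  classical
  have h0 : Admissible H s(a, b) [a, b] := ⟨by simpa using hab, by simp, by simp⟩
  have hb : ∀ n, (∃ l, Admissible H s(a, b) l ∧ l.length = n) → n ≤ Fintype.card V := by
    rintro n ⟨l, hl, rfl⟩
    exact hl.1.length_le_card
  have hex : ∃ n, ∃ l, Admissible H s(a, b) l ∧ l.length = n := ⟨_, _, h0, rfl⟩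
  obtain ⟨n, hn⟩ := hex
  obtain ⟨l, hl, hlen⟩ := Nat.findGreatest_spec
    (P := fun n => ∃ l, Admissible H s(a, b) l ∧ l.length = n) (hb n hn) hn
  refine ⟨l, hl, fun l' hl' => ?_⟩
  rw [hlen]
  exact Nat.le_findGreatest (hb _ ⟨l', hl', rfl⟩) ⟨l', hl', rfl⟩

lemma MaxAdmissible.of_perm (h : MaxAdmissible H f l) {l' : List V} (hp : l'.Perm l)
    (h' : Admissible H f l') : MaxAdmissible H f l' :=
  ⟨h', fun m hm => by rw [hp.length_eq]; exact h.2 m hm⟩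

lemma MaxAdmissible.reverse (h : MaxAdmissible H f l) : MaxAdmissible H f l.reverse :=
  h.of_perm (List.reverse_perm l) h.1.reverse

lemma MaxAdmissible.mem_of_adj (h : MaxAdmissible H f l) {y w : V}
    (hy : l.getLast? = some y) (hw : H.Adj w y) : w ∈ l := by
  by_contra hwl
  have : Admissible H f (l ++ [w]) := by
    refine ⟨?_, fun e he => ?_, ?_⟩
    · rw [List.nodup_append]
      exact ⟨h.1.1, by simp, fun x hx z hz => by
        rw [List.mem_singleton] at hz; subst hz; rintro rfl; exact hwl hx⟩
    · rw [mem_steps_append_iff] at he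
      rcases he with he | he | ⟨x, z, hx, hz, rfl⟩
      · exact h.1.2.1 e he
      · simp at he
      · left
        rw [hy] at hx
        simp only [Option.some.injEq, List.head?_cons] at hx hz
        subst hx hz
        exact hw.symm
    · exact mem_steps_append_iff.2 (Or.inl h.1.2.2)
  have := h.2 _ this
  simp at this

lemma steps_ne_nil_head {l : List V} (h : f ∈ steps l) : ∃ x, l.head? = some x := by
  cases l with
  | nil => simp at h
  | cons x l => exact ⟨x, rfl⟩

/-- The expansion properties used in the rotation-extension argument. -/
structure Expanding [Fintype V] [DecidableEq V] (H : SimpleGraph V) (s ℓ : ℕ) : Prop where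
  expand : ∀ X : Finset V, X.card ≤ 4 * s → 10 * X.card ≤ (nbhd H X \ X).card
  joined : ∀ A B : Finset V, Disjoint A B → s ≤ A.card → s ≤ B.card →
    ∃ x ∈ A, ∃ y ∈ B, H.Adj x y
  pos : 1 ≤ s
  card_lt : Fintype.card V < 2 ^ ℓ
  le_card : (4 * ℓ + 4) * (30 * s) + s ≤ Fintype.card V

variable [Fintype V] [DecidableEq V] {s ℓ : ℕ}

omit [Fintype V] [DecidableEq V] in
lemma Rotates.maxAdmissible {Q : Finset V} {k : ℕ} {l₀ : List V} (h : Rotates H Q l₀ k l)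
    (h₀ : MaxAdmissible H f l₀) (hQ : ∀ w ∈ Q, w ∉ f) : MaxAdmissible H f l :=
  h₀.of_perm h.perm (h.admissible h₀.1 hQ)

lemma Expanding.four_mul_lt_card_rotationEnds (hH : Expanding H s ℓ)
    (hl : MaxAdmissible H s(a, b) l) {z : V} (hz : l.head? = some z) :
    4 * s < (rotationEnds H (Finset.univ \ {a, b, z}) l ℓ).card := by
  set Q : Finset V := Finset.univ \ {a, b, z} with hQdef
  have hQf : ∀ w ∈ Q, w ∉ s(a, b) := by
    intro w hw; simp [hQdef] at hw; simp; tauto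
  have step : ∀ k, (rotationEnds H Q l k).card ≤ 4 * s → 1 ≤ (rotationEnds H Q l k).card →
      2 * (rotationEnds H Q l k).card ≤ (rotationEnds H Q l (k + 1)).card := by
    intro k hk hk1
    have h1 := hH.expand _ hk
    have h2 : (nbhd H (rotationEnds H Q l k) ∩ Q).card ≤
        3 * (rotationEnds H Q l (k + 1)).card := by
      apply card_nbhd_rotationEnds_inter_le hl.1.1
      · intro y hy w _ hwy
        obtain ⟨j, _, l', hl', hy'⟩ := mem_rotationEnds.1 hy
        exact hl'.perm.mem_iff.1 ((hl'.maxAdmissible hl hQf).mem_of_adj hy' hwy)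
      · intro w hw hwl
        by_cases hlast : l.getLast? = some w
        · exact Or.inl (mem_rotationEnds.2 ⟨0, Nat.zero_le _, l, Rotates.refl, hlast⟩)
        · right
          refine card_listNbrs_eq_two hl.1.1 hwl ?_ hlast
          rw [hz]
          simp [hQdef] at hw
          intro h
          exact hw.2.2 (Option.some.inj h).symm
    have h3 : (nbhd H (rotationEnds H Q l k) \ rotationEnds H Q l k).card ≤
        (nbhd H (rotationEnds H Q l k) ∩ Q).card + 3 := by
      calc _ ≤ ((nbhd H (rotationEnds H Q l k) ∩ Q) ∪ {a, b, z}).card := by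
            apply Finset.card_le_card
            intro v hv
            by_cases hvQ : v ∈ ({a, b, z} : Finset V)
            · exact Finset.mem_union_right _ hvQ
            · apply Finset.mem_union_left
              rw [Finset.mem_inter]
              exact ⟨(Finset.mem_sdiff.1 hv).1, by simp [hQdef] at hvQ ⊢; tauto⟩
        _ ≤ _ := (Finset.card_union_le _ _).trans (by gcongr; exact Finset.card_le_three)
    omega
  by_contra! hcon
  have hle : ∀ k ≤ ℓ, (rotationEnds H Q l k).card ≤ 4 * s := fun k hk =>
    (Finset.card_le_card (rotationEnds_mono hk)).trans hcon
  have grow : ∀ k ≤ ℓ, 2 ^ k ≤ (rotationEnds H Q l k).card := by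
    intro k
    induction k with
    | zero =>
      intro _
      obtain ⟨y, hy⟩ : ∃ y, l.getLast? = some y := by
        obtain ⟨y, hy⟩ := steps_ne_nil_head hl.reverse.1.2.2
        exact ⟨y, by simpa using hy⟩
      exact Finset.card_pos.2 ⟨y, mem_rotationEnds.2 ⟨0, le_rfl, l, Rotates.refl, hy⟩⟩
    | succ k ih =>
      intro hk
      have h1 := ih (by omega)
      have h2 := step k (hle k (by omega)) (Nat.one_le_two_pow.trans h1)
      rw [pow_succ]
      omega
  have h1 := grow ℓ le_rfl
  have h2 := (rotationEnds H Q l ℓ).card_le_univ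
  have := hH.card_lt
  omega

lemma Expanding.card_le_length_add (hH : Expanding H s ℓ)
    (hl : MaxAdmissible H s(a, b) l) : Fintype.card V ≤ l.length + s := by
  obtain ⟨z, hz⟩ := steps_ne_nil_head hl.1.2.2
  have hE := hH.four_mul_lt_card_rotationEnds hl hz
  set Q : Finset V := Finset.univ \ {a, b, z} with hQdef
  have hQf : ∀ w ∈ Q, w ∉ s(a, b) := by
    intro w hw; simp [hQdef] at hw; simp; tauto
  by_contra! hcon
  have hc : s ≤ (l.toFinset)ᶜ.card := by
    rw [Finset.card_compl, List.toFinset_card_of_nodup hl.1.1]; omega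
  have hsub : rotationEnds H Q l ℓ ⊆ l.toFinset := by
    intro y hy
    obtain ⟨j, _, l', hl', hy'⟩ := mem_rotationEnds.1 hy
    rw [List.mem_toFinset, ← hl'.perm.mem_iff]
    exact List.mem_of_getLast? hy'
  obtain ⟨y, hy, w, hw, hyw⟩ := hH.joined _ _
    (Finset.disjoint_of_subset_left hsub disjoint_compl_right) (by omega) hc
  obtain ⟨j, _, l', hl', hy'⟩ := mem_rotationEnds.1 hy
  have := hl'.perm.mem_iff.1 ((hl'.maxAdmissible hl hQf).mem_of_adj hy' hyw.symm)
  simp [this] at hw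

end Posa

end JumbledHamilton

namespace JumbledHamilton

section Core

variable {V : Type*} [Fintype V] [DecidableEq V]

/-- A set `Q` of inner vertices of the list `I` into which all small subsets of `K ⊆ I`
expand, such that the list neighbours of `Q` lie in `K`. -/
structure Core (H : SimpleGraph V) (f : Sym2 V) (s : ℕ) (I : List V) (K Q : Finset V) :
    Prop where
  subset_toFinset : K ⊆ I.toFinset
  subset : Q ⊆ K
  le_card : 2 * s ≤ Q.card
  notMem : ∀ w ∈ Q, w ∉ f
  head_ne : ∀ w ∈ Q, I.head? ≠ some w
  getLast_ne : ∀ w ∈ Q, I.getLast? ≠ some w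
  nbrs : ∀ w ∈ Q, listNbrs I w ⊆ K
  expand : ∀ X ⊆ K, X.card ≤ s → 7 * X.card ≤ (nbhd H X ∩ Q).card

variable {H : SimpleGraph V} {f : Sym2 V} {s ℓ : ℕ} {I l : List V} {K Q : Finset V}

lemma Core.reverse (h : Core H f s I K Q) : Core H f s I.reverse K Q where
  subset_toFinset := by simpa using h.subset_toFinset
  subset := h.subset
  le_card := h.le_card
  notMem := h.notMem
  head_ne := by simpa using h.getLast_ne
  getLast_ne := by simpa using h.head_ne
  nbrs w hw := by rw [listNbrs_reverse]; exact h.nbrs w hw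
  expand := h.expand

lemma Core.mem (h : Core H f s I K Q) {w : V} (hw : w ∈ K) : w ∈ I := by
  simpa using h.subset_toFinset hw

lemma Expanding.exists_core (hH : Expanding H s ℓ) (f : Sym2 V) (hn : I.Nodup)
    (hlen : 30 * s ≤ I.length) : ∃ K Q, Core H f s I K Q := by
  classical
  have hs := hH.pos
  induction f with | _ a b
  let ex (Z : Finset V) : Finset V := Z ∪ Z.biUnion (listNbrs I) ∪ {a, b} ∪
    (I.head?.toFinset ∪ I.getLast?.toFinset)
  have hex_mono : ∀ {Z Z' : Finset V}, Z ⊆ Z' → ex Z ⊆ ex Z' := by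
    intro Z Z' h
    exact Finset.union_subset_union_left (Finset.union_subset_union_left
      (Finset.union_subset_union h (Finset.biUnion_subset_biUnion_of_subset_left _ h)))
  have hex : ∀ Z : Finset V, (ex Z).card ≤ 3 * Z.card + 4 := by
    intro Z
    have h1 : ∀ o : Option V, o.toFinset.card ≤ 1 := by intro o; cases o <;> simp
    have h2 := card_biUnion_listNbrs_le hn Z
    have h3 : ({a, b} : Finset V).card ≤ 2 := Finset.card_le_two
    have h4 := Finset.card_union_le (Z ∪ Z.biUnion (listNbrs I) ∪ {a, b})
      (I.head?.toFinset ∪ I.getLast?.toFinset)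
    have h5 := Finset.card_union_le (Z ∪ Z.biUnion (listNbrs I)) {a, b}
    have h6 := Finset.card_union_le Z (Z.biUnion (listNbrs I))
    have h7 := Finset.card_union_le I.head?.toFinset I.getLast?.toFinset
    have := h1 I.head?
    have := h1 I.getLast?
    change _ ≤ _ at h4
    simp only [ex]
    omega
  let Int (Z : Finset V) : Finset V := I.toFinset \ ex Z
  have hInt : ∀ Z : Finset V, 30 * s ≤ (Int Z).card + (3 * Z.card + 4) := by
    intro Z
    have h1 := Finset.le_card_sdiff (ex Z) I.toFinset
    rw [List.toFinset_card_of_nodup hn] at h1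
    have := hex Z
    simp only [Int]
    omega
  let bad : Finset (Finset V) := I.toFinset.powerset.filter fun Z =>
    Z.card ≤ s ∧ (nbhd H Z ∩ Int Z).card ≤ 7 * Z.card
  have hbad : bad.Nonempty := by
    refine ⟨∅, ?_⟩
    have : nbhd H (∅ : Finset V) = ∅ := by ext v; simp
    simp [bad, this]
  obtain ⟨Z, hZ, hmax⟩ := bad.exists_max_image Finset.card hbad
  simp only [bad, Finset.mem_filter, Finset.mem_powerset] at hZ hmax
  obtain ⟨hZI, hZs, hZN⟩ := hZ
  refine ⟨I.toFinset \ Z, Int Z, Finset.sdiff_subset, ?_, ?_, ?_, ?_, ?_, ?_, ?_⟩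
  · intro w hw
    simp only [Int, ex, Finset.mem_sdiff, Finset.mem_union] at hw ⊢
    tauto
  · have := hInt Z
    omega
  · intro w hw
    simp only [Int, ex, Finset.mem_sdiff, Finset.mem_union, Finset.mem_insert,
      Finset.mem_singleton] at hw
    rw [Sym2.mem_iff]
    tauto
  · intro w hw h
    simp [Int, ex, h] at hw
  · intro w hw h
    simp [Int, ex, h] at hw
  · intro w hw c hc
    have hcI : c ∈ I := mem_of_mem_steps (mem_listNbrs.1 hc) (Sym2.mem_mk_right w c)
    rw [Finset.mem_sdiff, List.mem_toFinset]
    refine ⟨hcI, fun hcZ => ?_⟩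
    have : w ∈ Z.biUnion (listNbrs I) := Finset.mem_biUnion.2 ⟨c, hcZ, by
      rw [mem_listNbrs, Sym2.eq_swap]; exact mem_listNbrs.1 hc⟩
    simp only [Int, ex, Finset.mem_sdiff, Finset.mem_union] at hw
    tauto
  · intro X hX hXs
    by_contra! hlt
    have hdis : Disjoint Z X :=
      Finset.disjoint_of_subset_right hX Finset.disjoint_sdiff
    have hcard : (Z ∪ X).card = Z.card + X.card := Finset.card_union_of_disjoint hdis
    have hN : (nbhd H (Z ∪ X) ∩ Int (Z ∪ X)).card ≤ 7 * (Z ∪ X).card := by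
      have hsub : nbhd H (Z ∪ X) ∩ Int (Z ∪ X) ⊆
          (nbhd H Z ∩ Int Z) ∪ (nbhd H X ∩ Int Z) := by
        intro v hv
        rw [Finset.mem_inter, mem_nbhd] at hv
        obtain ⟨⟨x, hx, hxv⟩, hv⟩ := hv
        have hvZ : v ∈ Int Z :=
          Finset.sdiff_subset_sdiff (Finset.Subset.refl _)
            (hex_mono Finset.subset_union_left) hv
        rw [Finset.mem_union, Finset.mem_inter, Finset.mem_inter, mem_nbhd, mem_nbhd]
        rcases Finset.mem_union.1 hx with hx | hx
        · exact Or.inl ⟨⟨x, hx, hxv⟩, hvZ⟩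
        · exact Or.inr ⟨⟨x, hx, hxv⟩, hvZ⟩
      have := (Finset.card_le_card hsub).trans (Finset.card_union_le _ _)
      omega
    have hXpos : 0 < X.card := by
      rcases Nat.eq_zero_or_pos X.card with h | h
      · rw [h] at hlt; omega
      · exact h
    by_cases hle : (Z ∪ X).card ≤ s
    · have := hmax (Z ∪ X) ⟨Finset.union_subset hZI (hX.trans Finset.sdiff_subset), hle, hN⟩
      omega
    · have h1 := hInt (Z ∪ X)
      have h2 := Finset.card_sdiff_add_card_inter (Int (Z ∪ X)) (nbhd H (Z ∪ X))
      rw [Finset.inter_comm] at h2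
      have hd : Disjoint (Z ∪ X) (Int (Z ∪ X) \ nbhd H (Z ∪ X)) := by
        rw [Finset.disjoint_left]
        intro v hv hv'
        simp only [Int, ex, Finset.mem_sdiff, Finset.mem_union] at hv hv'
        tauto
      obtain ⟨x, hx, y, hy, hxy⟩ := hH.joined _ _ hd (by omega) (by omega)
      exact (Finset.mem_sdiff.1 hy).2 (mem_nbhd.2 ⟨x, hx, hxy⟩)

omit [DecidableEq V] in
lemma listNbrs_mono_of_isInfix (h : I <:+: l) (w : V) : listNbrs I w ⊆ listNbrs l w := by
  intro c hc
  rw [mem_listNbrs] at hc ⊢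
  exact steps_subset_of_isInfix h hc

lemma Core.listNbrs_eq (h : Core H f s I K Q) (hn : l.Nodup) (hI : I <:+: l) {w : V}
    (hw : w ∈ Q) : listNbrs l w = listNbrs I w := by
  refine (Finset.eq_of_subset_of_card_le (listNbrs_mono_of_isInfix hI w) ?_).symm
  rw [card_listNbrs_eq_two (hn.sublist hI.sublist) (h.mem (h.subset hw)) (h.head_ne w hw)
    (h.getLast_ne w hw)]
  exact card_listNbrs_le_two hn w

lemma Core.listNbrs_card (h : Core H f s I K Q) (hn : l.Nodup) (hI : I <:+: l) {w : V}
    (hw : w ∈ Q) : (listNbrs l w).card = 2 := by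
  rw [h.listNbrs_eq hn hI hw]
  exact card_listNbrs_eq_two (hn.sublist hI.sublist) (h.mem (h.subset hw)) (h.head_ne w hw)
    (h.getLast_ne w hw)

/-- Rotating inside a segment with a core yields many last vertices. -/
lemma Core.le_card_rotationEnds (h : Core H f s I K Q) (hn : l.Nodup) (hI : I <:+: l)
    {x w : V} (hx : l.getLast? = some x) (hw : w ∈ Q) (hwx : H.Adj w x) :
    s ≤ (rotationEnds H Q l (s + 1) ∩ K).card := by
  have hmem : ∀ v ∈ K, v ∈ l := fun v hv => hI.subset (h.mem hv)
  have hsub : ∀ k, rotationEnds H Q l k ⊆ insert x K := by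
    intro k y hy
    obtain ⟨j, _, l', hl', hy'⟩ := mem_rotationEnds.1 hy
    refine (hl'.getLast_mem (K := insert x K) ?_ ?_ ?_).1 y hy'
    · intro z hz
      rw [hx] at hz
      simp [Option.some.inj hz]
    · exact h.subset.trans (Finset.subset_insert _ _)
    · intro w hw
      rw [h.listNbrs_eq hn hI hw]
      exact (h.nbrs w hw).trans (Finset.subset_insert _ _)
  have hone : 1 ≤ (rotationEnds H Q l 1 ∩ K).card := by
    obtain ⟨p, q, rfl⟩ := List.append_of_mem (hmem w (h.subset hw))
    cases q with
    | nil =>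
      have : w = x := by simpa using hx
      exact absurd (this ▸ hwx) H.irrefl
    | cons c q =>
      refine Finset.card_pos.2 ⟨c, Finset.mem_inter.2 ⟨mem_rotationEnds.2
        ⟨1, le_rfl, _, Rotates.step Rotates.refl hw (y := x) ?_ hwx,
          getLast?_append_cons_reverse_cons _ _ _ _⟩, ?_⟩⟩
      · rw [List.getLast?_append, List.getLast?_cons_cons] at hx
        cases hq : (c :: q).getLast? with
        | none => simp at hq
        | some z => rw [hq] at hx; simpa using hx
      · apply h.nbrs w hw
        rw [← h.listNbrs_eq hn hI hw, mem_listNbrs, steps_append_cons_cons]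
        simp
  have grow : ∀ k, (rotationEnds H Q l k ∩ K).card ≤ s →
      1 ≤ (rotationEnds H Q l k ∩ K).card →
      (rotationEnds H Q l k ∩ K).card + 1 ≤ (rotationEnds H Q l (k + 1) ∩ K).card := by
    intro k hk hk1
    have h1 := h.expand _ Finset.inter_subset_right hk
    have h2 : (nbhd H (rotationEnds H Q l k) ∩ Q).card ≤
        3 * (rotationEnds H Q l (k + 1)).card := by
      apply card_nbhd_rotationEnds_inter_le hn
      · intro y _ w hw _; exact hmem w (h.subset hw)
      · intro w hw _; exact Or.inr (h.listNbrs_card hn hI hw)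
    have h3 : (nbhd H (rotationEnds H Q l k ∩ K) ∩ Q).card ≤
        (nbhd H (rotationEnds H Q l k) ∩ Q).card := by
      apply Finset.card_le_card
      intro v hv
      rw [Finset.mem_inter, mem_nbhd] at hv ⊢
      obtain ⟨⟨x, hx, hxv⟩, hv⟩ := hv
      exact ⟨⟨x, (Finset.mem_inter.1 hx).1, hxv⟩, hv⟩
    have h4 : (rotationEnds H Q l (k + 1)).card ≤
        (rotationEnds H Q l (k + 1) ∩ K).card + 1 := by
      calc _ ≤ (insert x (rotationEnds H Q l (k + 1) ∩ K)).card := by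
            apply Finset.card_le_card
            intro v hv
            have := hsub _ hv
            simp only [Finset.mem_insert, Finset.mem_inter] at this ⊢
            tauto
        _ ≤ _ := Finset.card_insert_le _ _
    omega
  have mono : ∀ {j k}, j ≤ k → (rotationEnds H Q l j ∩ K).card ≤
      (rotationEnds H Q l k ∩ K).card := fun h =>
    Finset.card_le_card (Finset.inter_subset_inter_right (rotationEnds_mono h))
  by_contra! hcon
  have key : ∀ k ≤ s, k + 1 ≤ (rotationEnds H Q l (k + 1) ∩ K).card := by
    intro k
    induction k with
    | zero => intro _; exact hone
    | succ k ih =>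
      intro hk
      have h1 := ih (by omega)
      have h2 := grow (k + 1) ((mono (by omega)).trans hcon.le) (by omega)
      omega
  have := key s le_rfl
  omega

open Classical in
lemma Expanding.exists_mem_few (hH : Expanding H s ℓ) {E : Finset V} (hE : 4 * s < E.card)
    {Q : Fin (4 * ℓ + 4) → Finset V} (hQ : ∀ j, 2 * s ≤ (Q j).card) :
    ∃ y ∈ E, (Finset.univ.filter fun j => ∀ w ∈ Q j, ¬ H.Adj w y).card ≤ ℓ := by
  by_contra! hcon
  have h1 := Finset.sum_card_bipartiteAbove_eq_sum_card_bipartiteBelow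
    (s := E) (t := (Finset.univ : Finset (Fin (4 * ℓ + 4))))
    (fun y j => ∀ w ∈ Q j, ¬ H.Adj w y)
  have h2 : E.card * (ℓ + 1) ≤ ∑ y ∈ E, (Finset.univ.bipartiteAbove
      (fun y j => ∀ w ∈ Q j, ¬ H.Adj w y) y).card := by
    rw [← smul_eq_mul]
    exact Finset.card_nsmul_le_sum _ _ _ fun y hy => hcon y hy
  have h3 : ∑ j, (E.bipartiteBelow (fun y j => ∀ w ∈ Q j, ¬ H.Adj w y) j).card ≤
      (4 * ℓ + 4) * s := by
    refine (Finset.sum_le_card_nsmul _ _ s fun j _ => ?_).trans (by simp)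
    by_contra! hlt
    obtain ⟨S, hS, hScard⟩ := Finset.exists_subset_card_eq hlt.le
    have h4 := Finset.le_card_sdiff S (Q j)
    have h5 := hQ j
    obtain ⟨x, hx, y, hy, hxy⟩ := hH.joined S (Q j \ S) Finset.disjoint_sdiff
      hScard.ge (by omega)
    have h6 := hS hx
    rw [Finset.mem_bipartiteBelow] at h6
    exact h6.2 y (Finset.mem_sdiff.1 hy).1 hxy.symm
  have h4 : E.card * (ℓ + 1) ≤ (4 * ℓ + 4) * s := by omega
  nlinarith

end Core

end JumbledHamilton

namespace JumbledHamilton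

section HamiltonPath

variable {V : Type*} {H : SimpleGraph V} {f : Sym2 V} {s ℓ : ℕ} {l : List V} {a b : V}

lemma Admissible.glue {A B A' B' : List V} (h₁ : Admissible H f (A' ++ B))
    (h₂ : Admissible H f (A ++ B')) (hA : A'.Perm A) (hB : B'.Perm B)
    (hlast : A'.getLast? = A.getLast?) (hhead : B'.head? = B.head?) :
    Admissible H f (A' ++ B') := by
  refine ⟨(hA.append_right B').nodup_iff.2 h₂.1, fun e he => ?_, ?_⟩
  · rcases mem_steps_append_iff.1 he with he | he | ⟨x, y, hx, hy, rfl⟩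
    · exact h₁.2.1 e (mem_steps_append_iff.2 (Or.inl he))
    · exact h₂.2.1 e (mem_steps_append_iff.2 (Or.inr (Or.inl he)))
    · exact h₁.2.1 _ (mem_steps_append_iff.2 (Or.inr (Or.inr ⟨x, y, hx, hhead ▸ hy, rfl⟩)))
  · rcases mem_steps_append_iff.1 h₁.2.2 with he | he | ⟨x, y, hx, hy, hf⟩
    · exact mem_steps_append_iff.2 (Or.inl he)
    · rcases mem_steps_append_iff.1 h₂.2.2 with he' | he' | ⟨x, y, hx, hy, hf⟩
      · exfalso
        induction f with | _ c d
        have h3 := mem_of_mem_steps he (Sym2.mem_mk_left c d)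
        have h4 := mem_of_mem_steps he' (Sym2.mem_mk_left c d)
        exact (List.nodup_append.1 h₂.1).2.2 c h4 c (hB.mem_iff.2 h3) rfl
      · exact mem_steps_append_iff.2 (Or.inr (Or.inl he'))
      · exact mem_steps_append_iff.2 (Or.inr (Or.inr ⟨x, y, hlast ▸ hx, hy, hf⟩))
    · exact mem_steps_append_iff.2 (Or.inr (Or.inr ⟨x, y, hx, hhead ▸ hy, hf⟩))

lemma mem_steps_cons_append {v u x y : V} {p q : List V} (hy : (p ++ u :: q).head? = some y)
    (hx : (p ++ u :: q).getLast? = some x) {e : Sym2 V}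
    (he : e ∈ steps (v :: (u :: q) ++ p)) :
    e = s(v, u) ∨ e = s(x, y) ∨ e ∈ steps (p ++ u :: q) := by
  have hx' : (v :: u :: q).getLast? = some x := by
    rw [List.getLast?_append] at hx
    rw [List.getLast?_cons_cons]
    cases h : (u :: q).getLast? with
    | none => simp at h
    | some z => rw [h] at hx; simpa using hx
  rw [List.cons_append, ← List.cons_append] at he
  rcases mem_steps_append_iff.1 he with he | he | ⟨c, d, hc, hd, rfl⟩
  · rw [steps_cons_cons, List.mem_cons] at he
    rcases he with he | he
    · exact Or.inl he
    · exact Or.inr (Or.inr (mem_steps_append_iff.2 (Or.inr (Or.inl he))))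
  · exact Or.inr (Or.inr (mem_steps_append_iff.2 (Or.inl he)))
  · right; left
    rw [List.head?_append, hd] at hy
    rw [hx'] at hc
    rw [Option.some.inj hc, show d = y by simpa using hy]

lemma Admissible.cons_append {v u x y : V} {p q : List V}
    (h : Admissible H f (p ++ u :: q)) (hy : (p ++ u :: q).head? = some y)
    (hx : (p ++ u :: q).getLast? = some x) (hxy : H.Adj x y) (hv : v ∉ p ++ u :: q)
    (hvu : H.Adj v u) (hf : f ∈ steps (u :: q)) : Admissible H f (v :: (u :: q) ++ p) := by
  refine ⟨?_, fun e he => ?_, ?_⟩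
  · rw [List.cons_append, List.nodup_cons]
    have hp : (u :: q ++ p).Perm (p ++ u :: q) := List.perm_append_comm
    exact ⟨fun hm => hv (hp.mem_iff.1 hm), hp.nodup_iff.2 h.1⟩
  · rcases mem_steps_cons_append hy hx he with rfl | rfl | he
    · exact Or.inl hvu
    · exact Or.inl hxy
    · exact h.2.1 e he
  · refine steps_subset_of_isInfix ?_ hf
    exact ⟨[v], p, by simp⟩

lemma MaxAdmissible.mem_of_adj_of_adj {u v x y : V} (h : MaxAdmissible H f l)
    (hy : l.head? = some y) (hx : l.getLast? = some x) (hxy : H.Adj x y) (hu : u ∈ l)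
    (huv : H.Adj v u) : v ∈ l := by
  by_contra hv
  obtain ⟨p, q, rfl⟩ := List.append_of_mem hu
  have hf := h.1.2.2
  rw [steps_append_cons, List.mem_append] at hf
  rcases hf with hf | hf
  · have hrev : (p ++ u :: q).reverse = q.reverse ++ u :: p.reverse := by simp
    have h' := h.1.reverse
    rw [hrev] at h'
    have := h.2 _ (h'.cons_append (v := v) (x := y) (y := x) ?_ ?_ hxy.symm ?_ huv ?_)
    · simp at this; omega
    · rw [← hrev, List.head?_reverse]; exact hx
    · rw [← hrev, List.getLast?_reverse]; exact hy
    · rw [← hrev, List.mem_reverse]; exact hv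
    · rw [← mem_steps_reverse]; simpa using hf
  · have := h.2 _ (h.1.cons_append hy hx hxy hv huv hf)
    simp at this; omega

/-- A Hamilton path, given as the list of its vertices. -/
structure IsHamPath (H : SimpleGraph V) (a b : V) (l : List V) : Prop where
  nodup : l.Nodup
  mem : ∀ v, v ∈ l
  adj : ∀ e ∈ steps l, e ∈ H.edgeSet
  head : l.head? = some a
  last : l.getLast? = some b

lemma IsHamPath.reverse (h : IsHamPath H a b l) : IsHamPath H b a l.reverse where
  nodup := List.nodup_reverse.2 h.nodup
  mem v := by simpa using h.mem v
  adj e he := h.adj e (mem_steps_reverse.1 he)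
  head := by simpa using h.last
  last := by simpa using h.head

lemma Admissible.exists_isHamPath [Fintype V] {x y : V} (h : Admissible H s(a, b) l)
    (hall : ∀ v, v ∈ l) (hV : 3 ≤ Fintype.card V) (hy : l.head? = some y)
    (hx : l.getLast? = some x) (hxy : H.Adj x y) : ∃ l', IsHamPath H a b l' := by
  classical
  obtain ⟨p, c, d, q, rfl, hf⟩ := exists_eq_append_of_mem_steps h.2.2
  have hperm : (d :: q ++ (p ++ [c])).Perm (p ++ c :: d :: q) := by
    rw [show p ++ c :: d :: q = (p ++ [c]) ++ d :: q by simp]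
    exact List.perm_append_comm
  have hn := hperm.nodup_iff.2 h.1
  have hlen : 3 ≤ (d :: q ++ (p ++ [c])).length := by
    rw [← List.toFinset_card_of_nodup hn]
    refine hV.trans (Finset.card_le_card fun v _ => ?_)
    rw [List.mem_toFinset, hperm.mem_iff]
    exact hall v
  have hdc : IsHamPath H d c (d :: q ++ (p ++ [c])) := by
    refine ⟨hn, fun v => hperm.mem_iff.2 (hall v), fun e he => ?_, rfl,
      by rw [← List.append_assoc, List.getLast?_append]; simp⟩
    have hne : e ≠ s(a, b) := by
      rintro rfl
      rw [hf, Sym2.eq_swap] at he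
      have h1 : d :: q ++ (p ++ [c]) = [] ++ d :: (q ++ (p ++ [c])) := by simp
      rw [h1] at he hn
      rcases getLast?_or_head?_of_mem_steps hn he with h2 | h2
      · simp at h2
      · obtain ⟨r, hr⟩ : ∃ r, q ++ (p ++ [c]) = c :: r := by
          cases hqp : q ++ (p ++ [c]) with
          | nil => simp at hqp
          | cons z r => rw [hqp] at h2; exact ⟨r, by simpa using h2⟩
        have hlen' : 1 ≤ (q ++ p).length := by simp at hlen ⊢; omega
        rw [← List.append_assoc] at hr hn
        cases hqp : q ++ p with
        | nil => rw [hqp] at hlen'; simp at hlen'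
        | cons z t =>
          rw [hqp] at hr hn
          simp only [List.cons_append, List.cons.injEq] at hr
          rw [hr.1] at hn
          simp at hn
    have h0 : e ∈ H.edgeSet ∨ e = s(a, b) := by
      rcases mem_steps_append_iff.1 he with he | he | ⟨z, w, hz, hw, rfl⟩
      · exact h.2.1 e (steps_subset_of_isInfix ⟨p ++ [c], [], by simp⟩ he)
      · exact h.2.1 e (steps_subset_of_isInfix ⟨[], d :: q, by simp⟩ he)
      · left
        have hz' : x = z := by
          rw [show p ++ c :: d :: q = (p ++ [c]) ++ d :: q by simp, List.getLast?_append,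
            hz] at hx
          simpa using hx.symm
        have hw' : y = w := by
          rw [show p ++ c :: d :: q = (p ++ [c]) ++ d :: q by simp, List.head?_append,
            hw] at hy
          simpa using hy.symm
        rw [← hz', ← hw']
        exact hxy
    exact h0.resolve_right hne
  rcases Sym2.eq_iff.1 hf with ⟨rfl, rfl⟩ | ⟨rfl, rfl⟩
  · exact ⟨_, hdc.reverse⟩
  · exact ⟨_, hdc⟩

variable [Fintype V] [DecidableEq V]

lemma Expanding.exists_adj_of_cores (hH : Expanding H s ℓ) {p J v J' q : List V}
    (h : Admissible H f (p ++ (J ++ (v ++ (J' ++ q))))) {K Q K' Q' : Finset V}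
    (hC : Core H f s J K Q) (hC' : Core H f s J' K' Q') {x y : V}
    (hy : (p ++ (J ++ (v ++ (J' ++ q)))).head? = some y)
    (hx : (p ++ (J ++ (v ++ (J' ++ q)))).getLast? = some x)
    (hyQ : ∃ w ∈ Q, H.Adj w y) (hxQ : ∃ w ∈ Q', H.Adj w x) :
    ∃ l, Admissible H f l ∧ l.Perm (p ++ (J ++ (v ++ (J' ++ q)))) ∧
      ∃ x y, l.head? = some y ∧ l.getLast? = some x ∧ H.Adj x y := by
  obtain ⟨w, hwQ, hwy⟩ := hyQ
  obtain ⟨w', hwQ', hwx⟩ := hxQ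
  set A := p ++ J with hA
  set B := v ++ (J' ++ q) with hB
  have hl : p ++ (J ++ B) = A ++ B := by simp [hA]
  rw [hl] at h hy hx ⊢
  have hdis : ∀ z ∈ A, z ∉ B := fun z hz hz' => (List.nodup_append.1 h.1).2.2 z hz z hz' rfl
  have hJA : ∀ z ∈ J, z ∈ A := fun z hz => by simp [hA, hz]
  have hJB : ∀ z ∈ J', z ∈ B := fun z hz => by simp [hB, hz]
  have hBn : B.Nodup := (List.nodup_append.1 h.1).2.1
  obtain ⟨A₁, a₀, hA₁⟩ : ∃ A₁ a₀, A = A₁ ++ [a₀] := by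
    rcases List.eq_nil_or_concat A with hn | ⟨r, c, hr⟩
    · have := hJA w (hC.mem (hC.subset hwQ))
      rw [hn] at this; simp at this
    · exact ⟨r, c, by simpa using hr⟩
  obtain ⟨b₀, B₁, hB₁⟩ : ∃ b₀ B₁, B = b₀ :: B₁ := by
    cases hn : B with
    | nil =>
      have := hJB w' (hC'.mem (hC'.subset hwQ'))
      rw [hn] at this; simp at this
    | cons b₀ B₁ => exact ⟨b₀, B₁, rfl⟩
  have ha₀ : ∀ z ∈ Q, z ≠ a₀ := by
    rintro z hz rfl
    have h1 : A.getLast? = some z := by rw [hA₁]; simp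
    rw [hA, List.getLast?_append] at h1
    cases hJ : J.getLast? with
    | none =>
      rw [List.getLast?_eq_none_iff] at hJ
      have := hC.mem (hC.subset hz)
      rw [hJ] at this; simp at this
    | some c =>
      rw [hJ] at h1
      simp only [Option.some_or, Option.some.injEq] at h1
      exact hC.getLast_ne z hz (h1 ▸ hJ)
  have hb₀ : ∀ z ∈ Q', z ≠ b₀ := by
    rintro z hz rfl
    have hzJ := hC'.mem (hC'.subset hz)
    cases v with
    | nil =>
      cases hJ : J' with
      | nil => rw [hJ] at hzJ; simp at hzJ
      | cons c J'' =>
        rw [hB, hJ] at hB₁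
        simp only [List.nil_append, List.cons_append, List.cons.injEq] at hB₁
        exact hC'.head_ne z hz (by rw [hJ, hB₁.1]; rfl)
    | cons c v =>
      rw [hB] at hB₁ hBn
      simp only [List.cons_append, List.cons.injEq] at hB₁
      rw [hB₁.1] at hBn
      simp only [List.cons_append, List.nodup_cons] at hBn
      exact hBn.1 (by simp [hzJ])
  have hright : s ≤ (rotationEnds H Q' (A ++ B) (s + 1) ∩ K').card :=
    hC'.le_card_rotationEnds h.1 ⟨A ++ v, q, by simp [hB]⟩ hx hwQ' hwx
  have hleft : s ≤ (rotationEnds H Q (A ++ B).reverse (s + 1) ∩ K).card :=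
    hC.reverse.le_card_rotationEnds h.reverse.1
      (List.IsInfix.reverse ⟨p, B, by simp [hA]⟩) (by simpa using hy) hwQ hwy
  obtain ⟨y', hy', x', hx', hyx⟩ := hH.joined _ _ (by
    refine Finset.disjoint_of_subset_left Finset.inter_subset_right
      (Finset.disjoint_of_subset_right Finset.inter_subset_right ?_)
    rw [Finset.disjoint_left]
    intro z hz hz'
    exact hdis z (hJA z (hC.mem hz)) (hJB z (hC'.mem hz'))) hleft hright
  rw [Finset.mem_inter, mem_rotationEnds] at hy' hx'
  obtain ⟨⟨j, -, m, hm, hmy⟩, -⟩ := hy'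
  obtain ⟨⟨j', -, m', hm', hmx⟩, -⟩ := hx'
  have hma := hm.admissible h.reverse hC.notMem
  have hma' := hm'.admissible h hC'.notMem
  obtain ⟨B₂, hB₂⟩ : ∃ B₂, m' = (A ++ [b₀]) ++ B₂ := by
    rw [hB₁, show A ++ b₀ :: B₁ = (A ++ [b₀]) ++ B₁ by simp] at hm'
    refine hm'.exists_append fun z hz => ?_
    rw [List.mem_append, List.mem_singleton]
    rintro (hzA | rfl)
    · exact hdis z hzA (hJB z (hC'.mem (hC'.subset hz)))
    · exact hb₀ z hz rfl
  obtain ⟨A₂, hA₂⟩ : ∃ A₂, m = (B.reverse ++ [a₀]) ++ A₂ := by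
    rw [hA₁, show (A₁ ++ [a₀] ++ B).reverse = (B.reverse ++ [a₀]) ++ A₁.reverse by simp] at hm
    refine hm.exists_append fun z hz => ?_
    rw [List.mem_append, List.mem_singleton, List.mem_reverse]
    rintro (hzB | rfl)
    · exact hdis z (hJA z (hC.mem (hC.subset hz))) hzB
    · exact ha₀ z hz rfl
  have hmr : m.reverse = (A₂.reverse ++ [a₀]) ++ B := by rw [hA₂]; simp
  have hm'r : m' = A ++ (b₀ :: B₂) := by rw [hB₂]; simp
  have hpA : (A₂.reverse ++ [a₀]).Perm A := by
    have : m.reverse.Perm (A ++ B) :=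
      (List.reverse_perm m).trans (hm.perm.trans (List.reverse_perm _))
    rw [hmr] at this
    exact (List.perm_append_right_iff _).1 this
  have hpB : (b₀ :: B₂).Perm B := by
    have := hm'.perm
    rw [hm'r] at this
    exact (List.perm_append_left_iff _).1 this
  refine ⟨(A₂.reverse ++ [a₀]) ++ (b₀ :: B₂), ?_, hpA.append hpB, x', y', ?_, ?_, hyx.symm⟩
  · refine Admissible.glue (A := A) (B := B) ?_ ?_ hpA hpB ?_ ?_
    · rw [← hmr]; exact hma.reverse
    · rw [← hm'r]; exact hma'
    · rw [hA₁]; simp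
    · rw [hB₁]; rfl
  · have : m.reverse.head? = some y' := by simpa using hmy
    rw [hmr, List.head?_append] at this
    rw [List.head?_append]
    cases hc : (A₂.reverse ++ [a₀]).head? with
    | none => simp at hc
    | some c => rw [hc] at this; simpa using this
  · rw [hm'r, List.getLast?_append] at hmx
    rw [List.getLast?_append]
    cases hc : (b₀ :: B₂).getLast? with
    | none => simp at hc
    | some c => rw [hc] at hmx; simpa using hmx

omit [Fintype V] [DecidableEq V] in
/-- Disjoint consecutive segments of a long list. -/
lemma exists_segments (hn : l.Nodup) {M L : ℕ} (hlen : M * L ≤ l.length) :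
    ∃ I : Fin M → List V, (∀ j, I j <:+: l) ∧ (∀ j, (I j).length = L) ∧
      ∀ i j, i ≠ j → ∀ x ∈ I i, x ∉ I j := by
  refine ⟨fun j => (l.drop (j * L)).take L, fun j => ?_, fun j => ?_, fun i j hij x hx hx' => ?_⟩
  · exact (List.IsPrefix.isInfix ⟨_, List.take_append_drop _ _⟩).trans (List.drop_suffix _ _).isInfix
  · have : (j + 1) * L ≤ l.length := (Nat.mul_le_mul_right L j.2).trans hlen
    rw [List.length_take, List.length_drop]
    rw [add_mul] at this
    omega
  · rw [List.mem_iff_getElem] at hx hx'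
    obtain ⟨r, hr, hrx⟩ := hx
    obtain ⟨t, ht, htx⟩ := hx'
    rw [List.getElem_take, List.getElem_drop] at hrx htx
    rw [List.length_take, List.length_drop] at hr ht
    have heq := (hn.getElem_inj_iff).1 (hrx.trans htx.symm)
    apply hij
    have hr' : r < L := by omega
    have ht' : t < L := by omega
    have h1 : ((i : ℕ) * L + r) / L = i := by
      rw [mul_comm, Nat.mul_add_div (by omega), Nat.div_eq_of_lt hr', add_zero]
    have h2 : ((j : ℕ) * L + t) / L = j := by
      rw [mul_comm, Nat.mul_add_div (by omega), Nat.div_eq_of_lt ht', add_zero]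
    exact Fin.ext (by rw [← h1, ← h2, heq])

end HamiltonPath

end JumbledHamilton

namespace JumbledHamilton

section HamiltonPathExists

variable {V : Type*} {H : SimpleGraph V} {f : Sym2 V} {s ℓ : ℕ} {l : List V} {a b : V}

lemma card_filter_exists_mem_le [DecidableEq V] {M : ℕ} {I : Fin M → List V}
    (hI : ∀ i j, i ≠ j → ∀ x ∈ I i, x ∉ I j) (P : Finset V) :
    (Finset.univ.filter fun j => ∃ x ∈ I j, x ∈ P).card ≤ P.card := by
  refine Finset.card_le_card_of_forall_subsingleton (fun j x => x ∈ I j) (fun j hj => ?_)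
    fun x _ i hi j hj => ?_
  · obtain ⟨x, hx, hxP⟩ := (Finset.mem_filter.1 hj).2
    exact ⟨x, hxP, hx⟩
  · by_contra hne
    exact hI i j hne x hi.2 hj.2

variable [Fintype V] [DecidableEq V]

lemma Expanding.exists_adj_of_infixes (hH : Expanding H s ℓ) (h : Admissible H f l)
    {J J' : List V} {K Q K' Q' : Finset V} (hJ : J <:+: l) (hJ' : J' <:+: l)
    (hd : ∀ z ∈ J, z ∉ J') (hC : Core H f s J K Q) (hC' : Core H f s J' K' Q') {x y : V}
    (hy : l.head? = some y) (hx : l.getLast? = some x)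
    (h₁ : ∃ w ∈ Q, H.Adj w y) (h₂ : ∃ w ∈ Q, H.Adj w x)
    (h₁' : ∃ w ∈ Q', H.Adj w y) (h₂' : ∃ w ∈ Q', H.Adj w x) :
    ∃ l', Admissible H f l' ∧ l'.Perm l ∧
      ∃ x y, l'.head? = some y ∧ l'.getLast? = some x ∧ H.Adj x y := by
  have hne : ∀ {J : List V} {K Q : Finset V}, Core H f s J K Q → (∃ w ∈ Q, H.Adj w y) →
      J ≠ [] := by
    rintro J K Q hC ⟨w, hw, -⟩ rfl
    simpa using hC.mem (hC.subset hw)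
  obtain ⟨p, q, rfl⟩ := hJ
  rw [List.append_assoc] at hJ' h hy hx ⊢
  rcases infix_or_infix_of_disjoint (hne hC' h₁') (hne hC h₁) hd hJ' with
    ⟨u, v, rfl⟩ | ⟨u, v, rfl⟩
  · simp only [List.append_assoc] at h hy hx ⊢
    exact hH.exists_adj_of_cores h hC' hC hy hx h₁' h₂
  · simp only [List.append_assoc] at h hy hx ⊢
    exact hH.exists_adj_of_cores h hC hC' hy hx h₁ h₂'

lemma Expanding.exists_maxAdmissible_adj (hH : Expanding H s ℓ) (hab : a ≠ b) :
    ∃ l, MaxAdmissible H s(a, b) l ∧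
      ∃ x y, l.head? = some y ∧ l.getLast? = some x ∧ H.Adj x y := by
  classical
  obtain ⟨l₀, h₀⟩ := exists_maxAdmissible (H := H) hab
  have hlen : (4 * ℓ + 4) * (30 * s) ≤ l₀.length := by
    have := hH.card_le_length_add h₀
    have := hH.le_card
    omega
  obtain ⟨I, hI, hIlen, hId⟩ := exists_segments h₀.1.1 hlen
  choose K Q hC using fun j => hH.exists_core s(a, b) (h₀.1.1.sublist (hI j).sublist)
    (hIlen j).ge
  have hQf : ∀ z, ∀ w ∈ Finset.univ \ ({a, b, z} : Finset V), w ∉ s(a, b) := by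
    intro z w hw; simp at hw; simp; tauto
  obtain ⟨z, hz⟩ := steps_ne_nil_head h₀.1.2.2
  obtain ⟨y, hyE, hyf⟩ := hH.exists_mem_few (hH.four_mul_lt_card_rotationEnds h₀ hz)
    fun j => (hC j).le_card
  obtain ⟨k, hk, l₁, hr₁, hl₁⟩ := mem_rotationEnds.1 hyE
  have h₁ : MaxAdmissible H s(a, b) l₁.reverse := (hr₁.maxAdmissible h₀ (hQf z)).reverse
  have hhead : l₁.reverse.head? = some y := by simpa using hl₁
  obtain ⟨x, hxE, hxf⟩ := hH.exists_mem_few (hH.four_mul_lt_card_rotationEnds h₁ hhead)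
    fun j => (hC j).le_card
  obtain ⟨k', hk', l₂, hr₂, hl₂⟩ := mem_rotationEnds.1 hxE
  have h₂ : MaxAdmissible H s(a, b) l₂ := hr₂.maxAdmissible h₁ (hQf y)
  have hhead₂ : l₂.head? = some y := by
    cases hl : l₁.reverse with
    | nil => rw [hl] at hhead; simp at hhead
    | cons c t =>
      rw [hl] at hhead hr₂
      have hcy : c = y := by simpa using hhead
      subst hcy
      rw [show c :: t = [c] ++ t by rfl] at hr₂
      obtain ⟨q, rfl⟩ := hr₂.exists_append (fun w hw => by simp at hw ⊢; tauto)
      rfl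
  obtain ⟨P₁, hP₁, hinf₁⟩ := hr₁.exists_pivots
  obtain ⟨P₂, hP₂, hinf₂⟩ := hr₂.exists_pivots
  set bad : Finset (Fin (4 * ℓ + 4)) :=
    (Finset.univ.filter fun j => ∀ w ∈ Q j, ¬ H.Adj w y) ∪
    (Finset.univ.filter fun j => ∀ w ∈ Q j, ¬ H.Adj w x) ∪
    (Finset.univ.filter fun j => ∃ v ∈ I j, v ∈ P₁ ∪ P₂) with hbad
  have hbadcard : bad.card ≤ ℓ + ℓ + (ℓ + ℓ) := by
    refine (Finset.card_union_le _ _).trans (add_le_add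
      ((Finset.card_union_le _ _).trans (add_le_add hyf hxf)) ?_)
    refine (card_filter_exists_mem_le hId _).trans ((Finset.card_union_le _ _).trans ?_)
    omega
  have hgood : 1 < badᶜ.card := by
    rw [Finset.card_compl, Fintype.card_fin]; omega
  obtain ⟨j, hj, j', hj', hne⟩ := Finset.one_lt_card.1 hgood
  have hseg : ∀ j ∈ badᶜ, (∃ w ∈ Q j, H.Adj w y) ∧ (∃ w ∈ Q j, H.Adj w x) ∧
      ∃ J, J <:+: l₂ ∧ (∀ v, v ∈ J ↔ v ∈ I j) ∧ Core H s(a, b) s J (K j) (Q j) := by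
    intro j hj
    simp only [hbad, Finset.mem_compl, Finset.mem_union, Finset.mem_filter, Finset.mem_univ,
      true_and, not_or] at hj
    push Not at hj
    obtain ⟨⟨h3, h4⟩, h5⟩ := hj
    refine ⟨h3, h4, ?_⟩
    have h6 := hinf₁ (I j) (fun v hv => (h5 v hv).1) (Or.inl (hI j))
    have h7 : I j <:+: l₁.reverse ∨ (I j).reverse <:+: l₁.reverse := by
      rcases h6 with h6 | h6
      · exact Or.inr (List.IsInfix.reverse h6)
      · left; simpa using List.IsInfix.reverse h6
    rcases hinf₂ (I j) (fun v hv => (h5 v hv).2) h7 with h8 | h8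
    · exact ⟨I j, h8, fun v => Iff.rfl, hC j⟩
    · exact ⟨(I j).reverse, h8, fun v => List.mem_reverse, (hC j).reverse⟩
  obtain ⟨a1, a2, J, hJ, hJm, hCJ⟩ := hseg j hj
  obtain ⟨b1, b2, J', hJ', hJm', hCJ'⟩ := hseg j' hj'
  obtain ⟨l, hl, hperm, hlast⟩ := hH.exists_adj_of_infixes h₂.1 hJ hJ'
    (fun v hv hv' => hId j j' hne v ((hJm v).1 hv) ((hJm' v).1 hv')) hCJ hCJ' hhead₂ hl₂
    a1 a2 b1 b2
  exact ⟨l, h₂.of_perm hperm hl, hlast⟩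

/-- Expanding graphs are Hamilton connected. -/
theorem Expanding.exists_isHamPath (hH : Expanding H s ℓ) (hab : a ≠ b) :
    ∃ l, IsHamPath H a b l := by
  obtain ⟨l, hl, x, y, hy, hx, hxy⟩ := hH.exists_maxAdmissible_adj hab
  have hs := hH.pos
  have hcard := hH.le_card
  refine hl.1.exists_isHamPath (fun v => ?_) (by nlinarith) hy hx hxy
  by_contra hv
  set X : Finset V := (l.toFinset)ᶜ with hX
  have hvX : v ∈ X := by simpa [hX] using hv
  have hXs : X.card ≤ s := by
    have := hH.card_le_length_add hl
    rw [hX, Finset.card_compl, List.toFinset_card_of_nodup hl.1.1]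
    omega
  have h1 := hH.expand X (by omega)
  have h2 : 0 < X.card := Finset.card_pos.2 ⟨v, hvX⟩
  obtain ⟨u, hu⟩ := Finset.card_pos.1 (show 0 < (nbhd H X \ X).card by omega)
  rw [Finset.mem_sdiff, mem_nbhd] at hu
  obtain ⟨⟨w, hw, hwu⟩, huX⟩ := hu
  have hul : u ∈ l := by simpa [hX] using huX
  have := hl.mem_of_adj_of_adj hy hx hxy hul hwu
  simp [hX, this] at hw

end HamiltonPathExists

end JumbledHamilton

namespace JumbledHamilton

section Links

variable {V : Type*}

/-- A path, given as the list of its vertices. -/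
structure IsPathList (G : SimpleGraph V) (a b : V) (l : List V) : Prop where
  nodup : l.Nodup
  adj : ∀ e ∈ steps l, e ∈ G.edgeSet
  head : l.head? = some a
  last : l.getLast? = some b

variable {G : SimpleGraph V} {a b c d : V} {l l' : List V}

lemma IsPathList.singleton (a : V) : IsPathList G a a [a] := ⟨by simp, by simp, rfl, rfl⟩

lemma IsPathList.reverse (h : IsPathList G a b l) : IsPathList G b a l.reverse where
  nodup := List.nodup_reverse.2 h.nodup
  adj e he := h.adj e (mem_steps_reverse.1 he)
  head := by simpa using h.last
  last := by simpa using h.head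

lemma IsPathList.append (h : IsPathList G a b l) (h' : IsPathList G c d l')
    (hbc : G.Adj b c) (hd : ∀ v ∈ l, v ∉ l') : IsPathList G a d (l ++ l') where
  nodup := List.nodup_append.2 ⟨h.nodup, h'.nodup, fun u hu v hv huv => hd u hu (huv ▸ hv)⟩
  adj e he := by
    rcases mem_steps_append_iff.1 he with he | he | ⟨x, y, hx, hy, rfl⟩
    · exact h.adj e he
    · exact h'.adj e he
    · rw [h.last] at hx
      rw [h'.head] at hy
      rw [← Option.some.inj hx, ← Option.some.inj hy]
      exact hbc
  head := by rw [List.head?_append, h.head]; rfl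
  last := by rw [List.getLast?_append, h'.last]; rfl

/-- Greedy choice of pairwise disjoint small sets. -/
lemma exists_disjoint_choice [DecidableEq V] {ι : Type*} [Fintype ι] [DecidableEq ι]
    (good : ι → Finset V → Prop) (c : ℕ)
    (h : ∀ i (P : Finset V), P.card ≤ Fintype.card ι * c →
      ∃ S, good i S ∧ S.card ≤ c ∧ Disjoint S P) :
    ∃ S : ι → Finset V, (∀ i, good i (S i)) ∧ ∀ i j, i ≠ j → Disjoint (S i) (S j) := by
  suffices H : ∀ T : Finset ι, ∃ S : ι → Finset V, (∀ i ∈ T, good i (S i) ∧ (S i).card ≤ c) ∧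
      ∀ i ∈ T, ∀ j ∈ T, i ≠ j → Disjoint (S i) (S j) by
    obtain ⟨S, h1, h2⟩ := H Finset.univ
    exact ⟨S, fun i => (h1 i (Finset.mem_univ i)).1,
      fun i j => h2 i (Finset.mem_univ i) j (Finset.mem_univ j)⟩
  intro T
  induction T using Finset.induction_on with
  | empty => exact ⟨fun _ => ∅, by simp, by simp⟩
  | insert i T hi ih =>
    obtain ⟨S, h1, h2⟩ := ih
    obtain ⟨S', hg, hc, hd⟩ := h i (T.biUnion S) ((Finset.card_biUnion_le_card_mul _ _ _
      fun j hj => (h1 j hj).2).trans (Nat.mul_le_mul_right _ (Finset.card_le_univ T)))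
    rw [Finset.disjoint_biUnion_right] at hd
    have hup : ∀ j ∈ T, Function.update S i S' j = S j := by
      intro j hj
      exact Function.update_of_ne (fun h => hi (by rw [← h]; exact hj)) _ _
    refine ⟨Function.update S i S', fun j hj => ?_, fun j hj j' hj' hne => ?_⟩
    · rcases Finset.mem_insert.1 hj with rfl | hj
      · simpa using ⟨hg, hc⟩
      · rw [hup j hj]; exact h1 j hj
    · rcases Finset.mem_insert.1 hj with h3 | h3 <;>
        rcases Finset.mem_insert.1 hj' with h4 | h4
      · exact absurd (h3.trans h4.symm) hne
      · rw [hup j' h4, h3, Function.update_self]; exact hd j' h4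
      · rw [hup j h3, h4, Function.update_self]; exact (hd j h3).symm
      · rw [hup j h3, hup j' h4]; exact h2 j h3 j' h4 hne

variable [Fintype V] [DecidableEq V]

/-- The expansion properties of a graph with large minimum degree and few edges inside
small sets, together with the size relations needed between the parameters. -/
structure Quasirandom (G : SimpleGraph V) (d D m s : ℕ) : Prop where
  degree : ∀ v, 2 * d ≤ (nbhd G {v}).card
  dense : ∀ X Y : Finset V, X.card ≤ m → (∀ x ∈ X, d ≤ (nbhd G {x} ∩ Y).card) →
    D * X.card ≤ Y.card
  joined : ∀ A B : Finset V, Disjoint A B → s ≤ A.card → s ≤ B.card →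
    ∃ x ∈ A, ∃ y ∈ B, G.Adj x y
  pos : 1 ≤ m
  pos_right : 1 ≤ s
  two_le : 2 ≤ d
  mul_le : 50 * s ≤ D * m

variable {D m s δ : ℕ}

omit [DecidableEq V] in
lemma nbhd_mono {X Y : Finset V} (h : X ⊆ Y) : nbhd G X ⊆ nbhd G Y := by
  intro v hv
  rw [mem_nbhd] at hv ⊢
  obtain ⟨x, hx, hxv⟩ := hv
  exact ⟨x, h hx, hxv⟩

lemma Quasirandom.card_nbhd (hG : Quasirandom G δ D m s) {X : Finset V} (hX : X.card ≤ m) :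
    D * X.card ≤ (nbhd G X).card := by
  refine hG.dense X _ hX fun x hx => ?_
  rw [Finset.inter_eq_left.2 (nbhd_mono (Finset.singleton_subset_iff.2 hx))]
  have := hG.degree x
  omega

lemma Quasirandom.exists_trees (hG : Quasirandom G δ D m s) {ι : Type*} [Fintype ι]
    [DecidableEq ι] {x : ι → V} (hx : Function.Injective x) {F : Finset V}
    (hF : ∀ j, x j ∉ F) (hD : F.card + 4 * Fintype.card ι + 2 ≤ D) (i : ℕ)
    (hi : 2 ^ i ≤ m) :
    ∃ U A : ι → Finset V, (∀ j j', j ≠ j' → Disjoint (U j) (U j')) ∧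
      (∀ j, Disjoint (U j) F) ∧ (∀ j, (U j).card ≤ 2 ^ (i + 1)) ∧
      (∀ j, (A j).card = 2 ^ i) ∧
      ∀ j, ∀ v ∈ A j, ∃ l, IsPathList G (x j) v l ∧ l.length = i + 1 ∧ ∀ u ∈ l, u ∈ U j := by
  induction i with
  | zero =>
    refine ⟨fun j => {x j}, fun j => {x j}, fun j j' h => ?_, fun j => ?_, fun j => ?_,
      fun j => ?_, fun j v hv => ?_⟩
    · simpa using fun h' => h (hx h')
    · simpa using hF j
    · simp
    · simp
    · rw [Finset.mem_singleton] at hv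
      subst hv
      exact ⟨[x j], IsPathList.singleton _, rfl, by simp⟩
  | succ i ih =>
    have h2 : 2 ^ (i + 1) = 2 * 2 ^ i := by rw [pow_succ]; ring
    have hpos : 1 ≤ 2 ^ i := Nat.one_le_two_pow
    obtain ⟨U, A, hU, hUF, hUc, hAc, hP⟩ := ih (by omega)
    have hUcard : (F ∪ Finset.univ.biUnion U).card ≤
        F.card + Fintype.card ι * 2 ^ (i + 1) :=
      (Finset.card_union_le _ _).trans (Nat.add_le_add_left
        (Finset.card_biUnion_le_card_mul _ _ _ fun j _ => hUc j) _)
    obtain ⟨S, hS, hSd⟩ := exists_disjoint_choice (fun j (S : Finset V) =>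
      S ⊆ nbhd G (A j) ∧ Disjoint S (F ∪ Finset.univ.biUnion U) ∧ S.card = 2 ^ (i + 1))
      (2 ^ (i + 1)) (by
      intro j P hPc
      have h3 := hG.card_nbhd (X := A j) (by rw [hAc]; omega)
      rw [hAc] at h3
      have h4 := Finset.le_card_sdiff (F ∪ Finset.univ.biUnion U ∪ P) (nbhd G (A j))
      have h5 := Finset.card_union_le (F ∪ Finset.univ.biUnion U) P
      have h6 : 2 ^ (i + 1) ≤ (nbhd G (A j) \ (F ∪ Finset.univ.biUnion U ∪ P)).card := by
        have h7 := Nat.mul_le_mul_right (2 ^ i) hD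
        have h8 : F.card ≤ F.card * 2 ^ i := Nat.le_mul_of_pos_right _ hpos
        have h9 : Fintype.card ι * 2 ^ (i + 1) = 2 * (Fintype.card ι * 2 ^ i) := by
          rw [h2]; ring
        have h10 : (F.card + 4 * Fintype.card ι + 2) * 2 ^ i =
          F.card * 2 ^ i + 4 * (Fintype.card ι * 2 ^ i) + 2 * 2 ^ i := by ring
        omega
      obtain ⟨S, hS, hSc⟩ := Finset.exists_subset_card_eq h6
      have hd : Disjoint S (F ∪ Finset.univ.biUnion U ∪ P) :=
        Finset.disjoint_of_subset_left hS Finset.sdiff_disjoint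
      rw [Finset.disjoint_union_right] at hd
      exact ⟨S, ⟨hS.trans Finset.sdiff_subset, hd.1, hSc⟩, hSc.le, hd.2⟩)
    have hSU : ∀ j j', Disjoint (S j) (U j') := fun j j' =>
      Finset.disjoint_of_subset_right ((Finset.subset_biUnion_of_mem U
        (Finset.mem_univ j')).trans Finset.subset_union_right) (hS j).2.1
    refine ⟨fun j => U j ∪ S j, S, fun j j' hne => ?_, fun j => ?_, fun j => ?_, fun j =>
      (hS j).2.2, fun j v hv => ?_⟩
    · rw [Finset.disjoint_union_left, Finset.disjoint_union_right, Finset.disjoint_union_right]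
      exact ⟨⟨hU j j' hne, (hSU j' j).symm⟩, hSU j j', hSd j j' hne⟩
    · rw [Finset.disjoint_union_left]
      exact ⟨hUF j, Finset.disjoint_of_subset_right Finset.subset_union_left (hS j).2.1⟩
    · change (U j ∪ S j).card ≤ _
      have := Finset.card_union_le (U j) (S j)
      have := hUc j
      have := (hS j).2.2
      rw [pow_succ 2 (i + 1)]
      omega
    · obtain ⟨w, hw, hwv⟩ := mem_nbhd.1 ((hS j).1 hv)
      obtain ⟨l, hl, hlen, hlU⟩ := hP j w hw
      refine ⟨l ++ [v], hl.append (IsPathList.singleton v) hwv ?_, by simp [hlen], ?_⟩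
      · intro u hu
        rw [List.mem_singleton]
        rintro rfl
        exact Finset.disjoint_left.1 (hSU j j) hv (hlU u hu)
      · intro u hu
        rw [List.mem_append, List.mem_singleton] at hu
        rcases hu with hu | rfl
        · exact Finset.mem_union_left _ (hlU u hu)
        · exact Finset.mem_union_right _ hv

/-- Disjoint paths of prescribed length between prescribed pairs of ends. -/
lemma Quasirandom.exists_links (hG : Quasirandom G δ D m s) {κ : Type*} [Fintype κ]
    [DecidableEq κ] {x y : κ → V} (hxy : Function.Injective (Sum.elim x y)) {F : Finset V}
    (hx : ∀ j, x j ∉ F) (hy : ∀ j, y j ∉ F)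
    (hD : 2 * F.card + 16 * Fintype.card κ + 4 ≤ D) :
    ∃ L : κ → List V, (∀ j, IsPathList G (x j) (y j) (L j)) ∧
      (∀ j, (L j).length = 2 * Nat.log 2 m + 4) ∧
      (∀ i j, i ≠ j → ∀ v ∈ L i, v ∉ L j) ∧ ∀ j, ∀ v ∈ L j, v ∉ F := by
  have hpos := hG.pos
  set t := Nat.log 2 m with ht
  have ht1 : 2 ^ t ≤ m := Nat.pow_log_le_self 2 (by omega)
  have ht2 : m < 2 ^ (t + 1) := Nat.lt_pow_succ_log_self (by norm_num) m
  have h2 : 2 ^ (t + 1) = 2 * 2 ^ t := by rw [pow_succ]; ring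
  have hpos2 : 1 ≤ 2 ^ t := Nat.one_le_two_pow
  obtain ⟨U, A, hU, hUF, hUc, hAc, hP⟩ := hG.exists_trees hxy
    (F := F) (by rintro (j | j); exacts [hx j, hy j])
    (by rw [Fintype.card_sum]; omega) t ht1
  set W := F ∪ Finset.univ.biUnion U with hW
  have hWc : W.card ≤ F.card + 2 * Fintype.card κ * 2 ^ (t + 1) := by
    refine (Finset.card_union_le _ _).trans (Nat.add_le_add_left
      ((Finset.card_biUnion_le_card_mul _ _ _ fun j _ => hUc j).trans ?_) _)
    rw [Finset.card_univ, Fintype.card_sum, two_mul]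
  have hbig : ∀ (j : κ ⊕ κ) (P : Finset V), P.card ≤ Fintype.card κ * 2 →
      2 * s ≤ (nbhd G (A j) \ (W ∪ P)).card := by
    intro j P hPc
    have h3 := hG.card_nbhd (X := A j) (by rw [hAc]; omega)
    rw [hAc] at h3
    have h4 := Finset.le_card_sdiff (W ∪ P) (nbhd G (A j))
    have h5 := Finset.card_union_le W P
    have h7 := Nat.mul_le_mul_right (2 ^ t) hD
    have h8 : F.card ≤ F.card * 2 ^ t := Nat.le_mul_of_pos_right _ hpos2
    have h8' : Fintype.card κ ≤ Fintype.card κ * 2 ^ t := Nat.le_mul_of_pos_right _ hpos2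
    have h9 : 2 * Fintype.card κ * 2 ^ (t + 1) = 4 * (Fintype.card κ * 2 ^ t) := by
      rw [h2]; ring
    have h10 : (2 * F.card + 16 * Fintype.card κ + 4) * 2 ^ t =
      2 * (F.card * 2 ^ t) + 16 * (Fintype.card κ * 2 ^ t) + 4 * 2 ^ t := by ring
    have h11 : D * m ≤ 2 * (D * 2 ^ t) := by
      calc D * m ≤ D * (2 * 2 ^ t) := Nat.mul_le_mul_left _ (by omega)
        _ = _ := by ring
    have h12 := hG.mul_le
    omega
  obtain ⟨S, hS, hSd⟩ := exists_disjoint_choice (fun (j : κ) (S : Finset V) =>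
      ∃ w ∈ nbhd G (A (Sum.inl j)), ∃ w' ∈ nbhd G (A (Sum.inr j)), G.Adj w w' ∧
        S = {w, w'} ∧ Disjoint S W) 2 (by
    intro j P hPc
    have h3 := hbig (Sum.inl j) P hPc
    have h4 := hbig (Sum.inr j) P hPc
    obtain ⟨B, hB, hBc⟩ := Finset.exists_subset_card_eq 
      (show s ≤ (nbhd G (A (Sum.inl j)) \ (W ∪ P)).card by omega)
    have h5 := Finset.le_card_sdiff B (nbhd G (A (Sum.inr j)) \ (W ∪ P))
    obtain ⟨w, hw, w', hw', hadj⟩ := hG.joined B _ Finset.disjoint_sdiff hBc.ge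
      (show s ≤ ((nbhd G (A (Sum.inr j)) \ (W ∪ P)) \ B).card by omega)
    have h6 := Finset.mem_sdiff.1 (hB hw)
    have h7 := Finset.mem_sdiff.1 (Finset.mem_sdiff.1 hw').1
    have hd : Disjoint ({w, w'} : Finset V) (W ∪ P) := by
      rw [Finset.disjoint_left]
      intro v hv
      rw [Finset.mem_insert, Finset.mem_singleton] at hv
      rcases hv with rfl | rfl
      exacts [h6.2, h7.2]
    rw [Finset.disjoint_union_right] at hd
    exact ⟨{w, w'}, ⟨w, h6.1, w', h7.1, hadj, rfl, hd.1⟩, Finset.card_le_two, hd.2⟩)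
  have hUW : ∀ j, U j ⊆ W := fun j =>
    (Finset.subset_biUnion_of_mem U (Finset.mem_univ j)).trans Finset.subset_union_right
  have hSU : ∀ j j', Disjoint (S j) (U j') := fun j j' => by
    obtain ⟨_, _, _, _, _, _, h⟩ := hS j
    exact Finset.disjoint_of_subset_right (hUW j') h
  have hL : ∀ j, ∃ L, IsPathList G (x j) (y j) L ∧ L.length = 2 * t + 4 ∧
      ∀ v ∈ L, v ∈ U (Sum.inl j) ∪ U (Sum.inr j) ∪ S j := by
    intro j
    obtain ⟨w, hw, w', hw', hadj, hSj, -⟩ := hS j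
    obtain ⟨c, hc, hcw⟩ := mem_nbhd.1 hw
    obtain ⟨c', hc', hcw'⟩ := mem_nbhd.1 hw'
    obtain ⟨l, hl, hlen, hlU⟩ := hP _ c hc
    obtain ⟨l', hl', hlen', hlU'⟩ := hP _ c' hc'
    simp only [Sum.elim_inl, Sum.elim_inr] at hl hl'
    have hwS : w ∈ S j := by simp [hSj]
    have hwS' : w' ∈ S j := by simp [hSj]
    have h1 : IsPathList G w w' ([w] ++ [w']) :=
      (IsPathList.singleton w).append (IsPathList.singleton w') hadj (by simpa using hadj.ne)
    have h2 : IsPathList G (x j) w' (l ++ ([w] ++ [w'])) := by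
      refine hl.append h1 hcw fun v hv hv' => ?_
      have : v ∈ S j := by simpa [hSj] using hv'
      exact Finset.disjoint_left.1 (hSU j _) this (hlU v hv)
    have h3 : IsPathList G (x j) (y j) (l ++ ([w] ++ [w']) ++ l'.reverse) := by
      refine h2.append hl'.reverse hcw'.symm fun v hv hv' => ?_
      rw [List.mem_reverse] at hv'
      have hvU := hlU' v hv'
      rcases List.mem_append.1 hv with hv | hv
      · exact Finset.disjoint_left.1 (hU (Sum.inl j) (Sum.inr j) (by simp)) (hlU v hv) hvU
      · have : v ∈ S j := by simpa [hSj] using hv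
        exact Finset.disjoint_left.1 (hSU j _) this hvU
    refine ⟨_, h3, by simp [hlen, hlen']; omega, fun v hv => ?_⟩
    simp only [List.mem_append, List.mem_singleton, List.mem_reverse] at hv
    simp only [Finset.mem_union]
    rcases hv with (hv | hv | hv) | hv
    · exact Or.inl (Or.inl (hlU v hv))
    · exact Or.inr (hv ▸ hwS)
    · exact Or.inr (hv ▸ hwS')
    · exact Or.inl (Or.inr (hlU' v hv))
  choose L hL1 hL2 hL3 using hL
  refine ⟨L, hL1, hL2, fun i j hij v hv hv' => ?_, fun j v hv hvF => ?_⟩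
  · have h3 := hL3 i v hv
    have h4 := hL3 j v hv'
    have hdl := fun p q (h : p ≠ q) (h₁ : v ∈ U p) (h₂ : v ∈ U q) =>
      Finset.disjoint_left.1 (hU p q h) h₁ h₂
    have hsl := fun p q (h₁ : v ∈ S p) (h₂ : v ∈ U q) =>
      Finset.disjoint_left.1 (hSU p q) h₁ h₂
    have hss := fun (h₁ : v ∈ S i) (h₂ : v ∈ S j) =>
      Finset.disjoint_left.1 (hSd i j hij) h₁ h₂
    simp only [Finset.mem_union] at h3 h4
    rcases h3 with (h3 | h3) | h3 <;> rcases h4 with (h4 | h4) | h4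
    · exact hdl _ _ (by simpa using hij) h3 h4
    · exact hdl _ _ (by simp) h3 h4
    · exact hsl _ _ h4 h3
    · exact hdl _ _ (by simp) h3 h4
    · exact hdl _ _ (by simpa using hij) h3 h4
    · exact hsl _ _ h4 h3
    · exact hsl _ _ h3 h4
    · exact hsl _ _ h3 h4
    · exact hss h3 h4
  · have h3 := hL3 j v hv
    simp only [Finset.mem_union] at h3
    rcases h3 with (h3 | h3) | h3
    · exact Finset.disjoint_left.1 (hUF _) h3 hvF
    · exact Finset.disjoint_left.1 (hUF _) h3 hvF
    · obtain ⟨_, _, _, _, _, _, h⟩ := hS j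
      exact Finset.disjoint_left.1 h h3 (Finset.mem_union_left _ hvF)

end Links

end JumbledHamilton

namespace JumbledHamilton

section Spanning

variable {V : Type*} {G : SimpleGraph V} {a b : V} {l : List V}

lemma steps_map {W : Type*} (g : V → W) (l : List V) :
    steps (l.map g) = (steps l).map (Sym2.map g) := by
  induction l with
  | nil => rfl
  | cons a l ih =>
    cases l with
    | nil => rfl
    | cons b l =>
      rw [List.map_cons, List.map_cons, steps_cons_cons, steps_cons_cons, List.map_cons,
        ← ih]
      rfl

lemma exists_first (P : V → Prop) [DecidablePred P] (h : 1 ≤ l.countP (fun v => P v)) :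
    ∃ p c q, l = p ++ c :: q ∧ P c ∧ p.countP (fun v => P v) = 0 := by
  induction l with
  | nil => simp at h
  | cons a l ih =>
    by_cases ha : P a
    · exact ⟨[], a, l, rfl, ha, rfl⟩
    · rw [List.countP_cons_of_neg (by simpa using ha)] at h
      obtain ⟨p, c, q, rfl, hc, hp⟩ := ih h
      exact ⟨a :: p, c, q, rfl, hc, by rw [List.countP_cons_of_neg (by simpa using ha), hp]⟩

lemma exists_last (P : V → Prop) [DecidablePred P] (h : 1 ≤ l.countP (fun v => P v)) :
    ∃ p c q, l = p ++ c :: q ∧ P c ∧ q.countP (fun v => P v) = 0 := by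
  rw [← List.countP_reverse] at h
  obtain ⟨p, c, q, hl, hc, hp⟩ := exists_first P h
  refine ⟨q.reverse, c, p.reverse, ?_, hc, by rw [List.countP_reverse, hp]⟩
  rw [← List.reverse_reverse l, hl]; simp

lemma exists_far_apart (P : V → Prop) [DecidablePred P] (h : 4 ≤ l.countP (fun v => P v)) :
    ∃ p c r d q, l = p ++ c :: (r ++ d :: q) ∧ P c ∧ P d ∧ 2 ≤ r.length := by
  obtain ⟨p, c, q, rfl, hc, hp⟩ := exists_first P (show 1 ≤ l.countP (fun v => P v) by omega)
  rw [List.countP_append, hp, List.countP_cons_of_pos (by simpa using hc)] at h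
  obtain ⟨r, d, q, rfl, hd, hq⟩ := exists_last P (show 1 ≤ q.countP (fun v => P v) by omega)
  rw [List.countP_append, List.countP_cons_of_pos (by simpa using hd), hq] at h
  have := List.countP_le_length (l := r) (p := fun v => decide (P v))
  exact ⟨p, c, r, d, q, rfl, hc, hd, by omega⟩

lemma IsPathList.shortcut {p r q : List V} {c d u : V}
    (h : IsPathList G a b (p ++ c :: (r ++ d :: q))) (hc : G.Adj c u) (hd : G.Adj u d)
    (hu : u ∉ p ++ c :: (r ++ d :: q)) : IsPathList G a b (p ++ c :: u :: d :: q) where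
  nodup := by
    have hs : (p ++ c :: d :: q).Sublist (p ++ c :: (r ++ d :: q)) :=
      List.Sublist.append_left ((List.sublist_append_right r (d :: q)).cons_cons c) p
    have h1 := h.nodup.sublist hs
    have h2 : (p ++ c :: u :: d :: q).Perm (u :: (p ++ c :: d :: q)) := by
      have : p ++ c :: u :: d :: q = (p ++ [c]) ++ u :: (d :: q) := by simp
      rw [this]
      refine List.perm_middle.trans ?_
      simp
    rw [h2.nodup_iff, List.nodup_cons]
    exact ⟨fun hm => hu (hs.subset hm), h1⟩
  adj e he := by
    rw [steps_append_cons_cons, List.mem_append, List.mem_cons, steps_cons_cons,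
      List.mem_cons] at he
    rcases he with he | rfl | rfl | he
    · exact h.adj e (steps_subset_of_isInfix ⟨[], r ++ d :: q, by simp⟩ he)
    · exact hc
    · exact hd
    · exact h.adj e (steps_subset_of_isInfix ⟨p ++ c :: r, [], by simp⟩ he)
  head := by
    have := h.head
    rw [List.head?_append] at this ⊢
    exact this
  last := by
    have := h.last
    have e1 : p ++ c :: (r ++ d :: q) = (p ++ c :: r) ++ d :: q := by simp
    have e2 : p ++ c :: u :: d :: q = (p ++ [c, u]) ++ d :: q := by simp
    rw [e1, List.getLast?_append] at this
    rw [e2, List.getLast?_append]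
    cases hq : (d :: q).getLast? with
    | none => simp at hq
    | some z => rw [hq] at this; exact this

/-- Pairwise disjoint paths joining `x j` to `y j`. -/
structure IsLinkage {κ : Type*} (G : SimpleGraph V) (x y : κ → V) (L : κ → List V) : Prop where
  path : ∀ j, IsPathList G (x j) (y j) (L j)
  disjoint : ∀ i j, i ≠ j → ∀ v ∈ L i, v ∉ L j

variable {κ : Type*} {x y : κ → V} {L : κ → List V}

lemma IsLinkage.update [DecidableEq κ] (h : IsLinkage G x y L) {j : κ}
    (hl : IsPathList G (x j) (y j) l) (hd : ∀ v ∈ l, v ∈ L j ∨ ∀ i, v ∉ L i) :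
    IsLinkage G x y (Function.update L j l) where
  path i := by
    rcases eq_or_ne i j with rfl | hij
    · simpa using hl
    · rw [Function.update_of_ne hij]; exact h.path i
  disjoint i i' hne v hv hv' := by
    rcases eq_or_ne i j with rfl | hij
    · rw [Function.update_self] at hv
      rw [Function.update_of_ne hne.symm] at hv'
      rcases hd v hv with hv | hv
      · exact h.disjoint _ _ hne v hv hv'
      · exact hv i' hv'
    · rw [Function.update_of_ne hij] at hv
      rcases eq_or_ne i' j with rfl | hij'
      · rw [Function.update_self] at hv'
        rcases hd v hv' with hv' | hv'
        · exact h.disjoint _ _ hne v hv hv'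
        · exact hv' i hv
      · rw [Function.update_of_ne hij'] at hv'
        exact h.disjoint _ _ hne v hv hv'

variable [Fintype V] [DecidableEq V] {δ D m s ℓ : ℕ}

lemma IsLinkage.card_nbhd_inter_le [Fintype κ] [DecidableEq κ] (h : IsLinkage G x y L)
    (hmin : ∀ L', IsLinkage G x y L' → ∑ j, (L j).length ≤ ∑ j, (L' j).length) {u : V}
    (hu : ∀ j, u ∉ L j) :
    (nbhd G {u} ∩ Finset.univ.biUnion fun j => (L j).toFinset).card ≤ 3 * Fintype.card κ := by
  classical
  have hj : ∀ j, (nbhd G {u} ∩ (L j).toFinset).card ≤ 3 := by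
    intro j
    by_contra! hlt
    have heq : (nbhd G {u} ∩ (L j).toFinset).card = (L j).countP fun v => G.Adj u v := by
      rw [List.countP_eq_length_filter,
        ← List.toFinset_card_of_nodup ((h.path j).nodup.filter _)]
      congr 1
      ext v
      simp [and_comm]
    rw [heq] at hlt
    obtain ⟨p, c, r, d, q, hL, hc, hd, hr⟩ := exists_far_apart (fun v => G.Adj u v) hlt
    have hpath := h.path j
    rw [hL] at hpath
    have hnew := hpath.shortcut hc.symm hd (hL ▸ hu j)
    have hlink := h.update hnew (fun v hv => by
      rw [hL]
      simp only [List.mem_append, List.mem_cons] at hv ⊢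
      by_cases hvu : v = u
      · right; rw [hvu]; exact hu
      · tauto)
    have h1 := hmin _ hlink
    rw [← Finset.add_sum_erase _ _ (Finset.mem_univ j),
      ← Finset.add_sum_erase _ (fun i => (Function.update L j _ i).length)
        (Finset.mem_univ j), Function.update_self] at h1
    have h2 : ∑ i ∈ Finset.univ.erase j,
        (Function.update L j (p ++ c :: u :: d :: q) i).length =
        ∑ i ∈ Finset.univ.erase j, (L i).length :=
      Finset.sum_congr rfl fun i hi => by
        rw [Function.update_of_ne (Finset.ne_of_mem_erase hi)]
    rw [h2, hL] at h1
    simp at h1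
    omega
  have hsub : nbhd G {u} ∩ (Finset.univ.biUnion fun j => (L j).toFinset) ⊆
      Finset.univ.biUnion fun j => nbhd G {u} ∩ (L j).toFinset := by
    intro v hv
    simp only [Finset.mem_inter, Finset.mem_biUnion] at hv ⊢
    obtain ⟨h1, j, hj, h2⟩ := hv
    exact ⟨j, hj, h1, h2⟩
  refine (Finset.card_le_card hsub).trans ((Finset.card_biUnion_le_card_mul _ _ 3
    fun j _ => hj j).trans ?_)
  rw [Finset.card_univ, mul_comm]

omit [Fintype V] [DecidableEq V] in
lemma IsLinkage.exists_minimal [Fintype κ] (h : IsLinkage G x y L) :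
    ∃ L', IsLinkage G x y L' ∧ ∑ j, (L' j).length ≤ ∑ j, (L j).length ∧
      ∀ L'', IsLinkage G x y L'' → ∑ j, (L' j).length ≤ ∑ j, (L'' j).length := by
  classical
  have hex : ∃ n, ∃ L', IsLinkage G x y L' ∧ ∑ j, (L' j).length = n := ⟨_, L, h, rfl⟩
  obtain ⟨L', hL', hn⟩ := Nat.find_spec hex
  refine ⟨L', hL', ?_, fun L'' h'' => ?_⟩ <;> rw [hn]
  · exact Nat.find_min' hex ⟨L, h, rfl⟩
  · exact Nat.find_min' hex ⟨L'', h'', rfl⟩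

lemma Quasirandom.expanding_induce (hG : Quasirandom G δ D m s) (hD : 11 ≤ D)
    {W : Finset V} (hW : ∀ u ∉ W, (nbhd G {u} ∩ W).card ≤ δ)
    (hℓ : Fintype.card V < 2 ^ ℓ)
    (hn : (4 * ℓ + 4) * (30 * s) + s + W.card ≤ Fintype.card V) :
    Expanding (G.induce {v | v ∉ W}) s ℓ := by
  have hsub : ∀ X : Finset {v | v ∉ W}, nbhd G (X.map (.subtype _)) \ W =
      (nbhd (G.induce {v | v ∉ W}) X).map (.subtype _) := by
    intro X
    ext v
    simp only [Finset.mem_sdiff, mem_nbhd, Finset.mem_map, Function.Embedding.subtype_apply]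
    constructor
    · rintro ⟨⟨_, ⟨x, hx, rfl⟩, hxv⟩, hv⟩
      exact ⟨⟨v, hv⟩, ⟨x, hx, hxv⟩, rfl⟩
    · rintro ⟨w, ⟨x, hx, hxw⟩, rfl⟩
      exact ⟨⟨x, ⟨x, hx, rfl⟩, hxw⟩, w.2⟩
  have hbig : ∀ X : Finset {v | v ∉ W}, X.card ≤ m →
      D * X.card ≤ (nbhd (G.induce {v | v ∉ W}) X).card := by
    intro X hX
    have h1 := hG.dense (X.map (.subtype _)) (nbhd G (X.map (.subtype _)) \ W)
      (by rwa [Finset.card_map]) (fun x hx => by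
        have h2 : x ∉ W := by
          obtain ⟨z, -, rfl⟩ := Finset.mem_map.1 hx
          exact z.2
        have h3 : nbhd G {x} ∩ (nbhd G (X.map (.subtype _)) \ W) = nbhd G {x} \ W := by
          ext v
          have := @nbhd_mono V G _ _ _ (Finset.singleton_subset_iff.2 hx) v
          simp only [Finset.mem_inter, Finset.mem_sdiff]
          tauto
        rw [h3]
        have h4 := Finset.card_sdiff_add_card_inter (nbhd G {x}) W
        have h5 := hW x h2
        have h6 := hG.degree x
        omega)
    rwa [hsub, Finset.card_map, Finset.card_map] at h1
  have hs := hG.mul_le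
  refine ⟨fun X hX => ?_, fun A B hAB hA hB => ?_, hG.pos_right, ?_, ?_⟩
  · have h1 := Finset.le_card_sdiff X (nbhd (G.induce {v | v ∉ W}) X)
    by_cases hXm : X.card ≤ m
    · have h2 := hbig X hXm
      have h3 := Nat.mul_le_mul_right X.card hD
      omega
    · obtain ⟨X', hX', hc⟩ := Finset.exists_subset_card_eq (show m ≤ X.card by omega)
      have h2 := hbig X' hc.le
      have h3 := Finset.card_le_card (nbhd_mono (G := G.induce {v | v ∉ W}) hX')
      rw [hc] at h2
      omega
  · obtain ⟨x, hx, y, hy, hxy⟩ := hG.joined (A.map (.subtype _)) (B.map (.subtype _))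
      (by rwa [Finset.disjoint_map]) (by rwa [Finset.card_map]) (by rwa [Finset.card_map])
    obtain ⟨x, hxA, rfl⟩ := Finset.mem_map.1 hx
    obtain ⟨y, hyB, rfl⟩ := Finset.mem_map.1 hy
    exact ⟨x, hxA, y, hyB, hxy⟩
  · exact (Fintype.card_subtype_le _).trans_lt hℓ
  · have : Fintype.card {v | v ∉ W} = Fintype.card V - W.card := by
      rw [← Finset.card_compl, ← Fintype.card_coe]
      exact Fintype.card_congr (Equiv.subtypeEquivRight (by simp))
    rw [this]
    omega

/-- A path through exactly the vertices outside `W`. -/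
lemma Quasirandom.exists_isPathList_compl (hG : Quasirandom G δ D m s) (hD : 11 ≤ D)
    {W : Finset V} (hW : ∀ u ∉ W, (nbhd G {u} ∩ W).card ≤ δ)
    (hℓ : Fintype.card V < 2 ^ ℓ)
    (hn : (4 * ℓ + 4) * (30 * s) + s + W.card ≤ Fintype.card V) {u u' : V} (hu : u ∉ W)
    (hu' : u' ∉ W) (hne : u ≠ u') : ∃ P, IsPathList G u u' P ∧ ∀ v, v ∈ P ↔ v ∉ W := by
  obtain ⟨l, hl⟩ := (hG.expanding_induce hD hW hℓ hn).exists_isHamPath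
    (a := ⟨u, hu⟩) (b := ⟨u', hu'⟩) (by simpa using hne)
  refine ⟨l.map Subtype.val, ⟨hl.nodup.map Subtype.val_injective, fun e he => ?_, ?_, ?_⟩,
    fun v => ?_⟩
  · rw [steps_map, List.mem_map] at he
    obtain ⟨e, he, rfl⟩ := he
    have := hl.adj e he
    induction e with | _ c d
    exact this
  · rw [List.head?_map, hl.head]; rfl
  · rw [List.getLast?_map, hl.last]; rfl
  · constructor
    · intro hv
      obtain ⟨z, -, rfl⟩ := List.mem_map.1 hv
      exact z.2
    · intro hv
      exact List.mem_map.2 ⟨⟨v, hv⟩, hl.mem _, rfl⟩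

/-- A linkage of prescribed pairs of ends covering all vertices. -/
theorem Quasirandom.exists_spanning_linkage (hG : Quasirandom G δ D m s) [Fintype κ]
    [DecidableEq κ] [Nonempty κ] (hxy : Function.Injective (Sum.elim x y))
    (hD : 16 * Fintype.card κ + 4 ≤ D) (hδ : 3 * Fintype.card κ ≤ δ)
    (hm : Fintype.card κ ≤ m) (ht : 2 * Nat.log 2 m + 4 < D) (hℓ : Fintype.card V < 2 ^ ℓ)
    (hn : (4 * ℓ + 4) * (30 * s) + s + Fintype.card κ * (2 * Nat.log 2 m + 4) ≤
      Fintype.card V) :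
    ∃ L : κ → List V, IsLinkage G x y L ∧ ∀ v, ∃ j, v ∈ L j := by
  have hk : 0 < Fintype.card κ := Fintype.card_pos
  obtain ⟨L₀, h01, h02, h03, -⟩ := hG.exists_links hxy (F := ∅) (by simp) (by simp)
    (by simpa using hD)
  obtain ⟨L, hL, hsum, hmin⟩ := (IsLinkage.mk h01 h03).exists_minimal
  have hsum₀ : ∑ j, (L₀ j).length = Fintype.card κ * (2 * Nat.log 2 m + 4) := by
    simp [h02]
  set W : Finset V := Finset.univ.biUnion fun j => (L j).toFinset with hWdef
  have hmemW : ∀ v, v ∈ W ↔ ∃ j, v ∈ L j := by intro v; simp [hWdef]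
  have hWc : W.card ≤ Fintype.card κ * (2 * Nat.log 2 m + 4) := by
    rw [← hsum₀]
    refine Finset.card_biUnion_le.trans (le_trans ?_ hsum)
    exact Finset.sum_le_sum fun j _ => List.toFinset_card_le _
  have hWd : ∀ u ∉ W, (nbhd G {u} ∩ W).card ≤ δ := by
    intro u hu
    rw [hmemW] at hu
    push Not at hu
    exact (hL.card_nbhd_inter_le hmin hu).trans hδ
  have htwo : ∀ j, ∃ c c' q, L j = c :: c' :: q := by
    intro j
    have hne : x j ≠ y j := fun h => by simpa using hxy (a₁ := Sum.inl j) (a₂ := Sum.inr j) h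
    have h1 := (hL.path j).head
    have h2 := (hL.path j).last
    match hLj : L j with
    | [] => rw [hLj] at h1; simp at h1
    | [c] =>
      rw [hLj] at h1 h2
      simp only [List.head?_cons, List.getLast?_singleton, Option.some.injEq] at h1 h2
      exact absurd (h1.symm.trans h2) hne
    | c :: c' :: q => exact ⟨c, c', q, rfl⟩
  choose c c' q hLq using htwo
  obtain ⟨j, hj1, hj2⟩ : ∃ j, (nbhd G {c j} ∩ W).card < δ ∧ (nbhd G {c' j} ∩ W).card < δ := by
    by_contra! hcon
    have hch : ∀ j, ∃ z ∈ L j, δ ≤ (nbhd G {z} ∩ W).card := by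
      intro j
      by_cases h : (nbhd G {c j} ∩ W).card < δ
      · exact ⟨c' j, by rw [hLq]; simp, hcon j h⟩
      · exact ⟨c j, by rw [hLq]; simp, by omega⟩
    choose z hz hzd using hch
    have hinj : Function.Injective z := by
      intro i j hij
      by_contra hne
      exact hL.disjoint i j hne _ (hz i) (hij ▸ hz j)
    have hc : (Finset.univ.image z).card = Fintype.card κ := by
      rw [Finset.card_image_of_injective _ hinj, Finset.card_univ]
    have h1 := hG.dense (Finset.univ.image z) W (by rwa [hc]) (by
      intro v hv
      obtain ⟨j, -, rfl⟩ := Finset.mem_image.1 hv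
      exact hzd j)
    rw [hc] at h1
    have h2 := h1.trans hWc
    rw [mul_comm] at h2
    exact absurd (Nat.le_of_mul_le_mul_left h2 hk) (by omega)
  have hout : ∀ v, (nbhd G {v} ∩ W).card < δ → 1 < (nbhd G {v} \ W).card := by
    intro v hv
    have h1 := Finset.card_sdiff_add_card_inter (nbhd G {v}) W
    have h2 := hG.degree v
    have h3 := hG.two_le
    omega
  obtain ⟨u, hu⟩ := Finset.card_pos.1 (zero_lt_one.trans (hout _ hj1))
  obtain ⟨u', hu', hne⟩ := Finset.exists_mem_ne (hout _ hj2) u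
  simp only [Finset.mem_sdiff, mem_nbhd, Finset.mem_singleton, exists_eq_left] at hu hu'
  obtain ⟨P, hP, hPW⟩ := hG.exists_isPathList_compl (by omega) hWd hℓ (by omega)
    hu.2 hu'.2 hne.symm
  have hpath := hL.path j
  rw [hLq] at hpath
  have hcx : c j = x j := by simpa using hpath.head
  have hnotP : ∀ i, ∀ v ∈ L i, v ∉ P := fun i v hv hvP => (hPW v).1 hvP ((hmemW v).2 ⟨i, hv⟩)
  have htail : IsPathList G (c' j) (y j) (c' j :: q j) := by
    refine ⟨hpath.nodup.of_cons, fun e he => hpath.adj e ?_, rfl, ?_⟩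
    · rw [steps_cons_cons]; exact List.mem_cons_of_mem _ he
    · simpa [List.getLast?_cons_cons] using hpath.last
  have h1 : IsPathList G (x j) u' ([c j] ++ P) := by
    rw [← hcx]
    refine (IsPathList.singleton (c j)).append hP hu.1 fun v hv => ?_
    rw [List.mem_singleton] at hv
    subst hv
    exact hnotP j _ (by rw [hLq]; simp)
  have h2 : IsPathList G (x j) (y j) ([c j] ++ P ++ c' j :: q j) := by
    refine h1.append htail hu'.1.symm fun v hv hv' => ?_
    rw [List.mem_append, List.mem_singleton] at hv
    rcases hv with rfl | hv
    · exact (List.nodup_cons.1 hpath.nodup).1 hv'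
    · exact hnotP j v (by rw [hLq]; exact List.mem_cons_of_mem _ hv') hv
  refine ⟨Function.update L j _, hL.update h2 fun v hv => ?_, fun v => ?_⟩
  · rw [hLq]
    simp only [List.mem_append, List.mem_cons, List.not_mem_nil, or_false] at hv ⊢
    rcases hv with (hv | hv) | hv
    · exact Or.inl (Or.inl hv)
    · right; intro i hi; exact hnotP i v hi hv
    · exact Or.inl (Or.inr hv)
  · by_cases hv : v ∈ W
    · obtain ⟨i, hi⟩ := (hmemW v).1 hv
      refine ⟨i, ?_⟩
      rcases eq_or_ne i j with rfl | hij
      · rw [hLq] at hi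
        rw [Function.update_self]
        simp only [List.mem_append, List.mem_cons, List.not_mem_nil, or_false] at hi ⊢
        tauto
      · rwa [Function.update_of_ne hij]
    · refine ⟨j, ?_⟩
      rw [Function.update_self]
      simp [(hPW v).2 hv]

end Spanning

end JumbledHamilton

namespace JumbledHamilton

section Weight

variable {V : Type*} {G : SimpleGraph V} {a b : V} {l : List V} (R : Sym2 V → ZMod 2)

/-- The total weight of the pairs of consecutive entries of a list. -/
def weight (l : List V) : ZMod 2 := ((steps l).map R).sum

@[simp] lemma weight_singleton (x : V) : weight R [x] = 0 := rfl

@[simp] lemma weight_cons_cons (x y : V) (l : List V) :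
    weight R (x :: y :: l) = R s(x, y) + weight R (y :: l) := by
  simp [weight]

lemma weight_append_cons (p : List V) (x : V) (q : List V) :
    weight R (p ++ x :: q) = weight R (p ++ [x]) + weight R (x :: q) := by
  simp only [weight]
  rw [steps_append_cons, List.map_append, List.sum_append]

lemma weight_append_append (p q : List V) (ha : l.head? = some a) (hb : l.getLast? = some b) :
    weight R (p ++ l ++ q) = weight R (p ++ [a]) + weight R l + weight R (b :: q) := by
  obtain ⟨l, rfl⟩ := List.head?_eq_some_iff.1 ha
  obtain ⟨l', hl'⟩ := List.getLast?_eq_some_iff.1 hb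
  have h1 : p ++ a :: l ++ q = p ++ a :: (l ++ q) := by simp
  have h2 : a :: (l ++ q) = l' ++ b :: q := by rw [← List.cons_append, hl']; simp
  rw [h1, weight_append_cons, h2, weight_append_cons R l', hl', add_assoc]

lemma weight_reverse (l : List V) : weight R l.reverse = weight R l := by
  simp [weight, steps_reverse, List.map_reverse, List.sum_reverse]

variable {κ : Type*} {x y : κ → V} {L : κ → List V}

/-- The concatenation of the lists `L j`, traversed alternately forwards and backwards. -/
def zigzag (L : κ → List V) : Bool → List κ → List V
  | _, [] => []
  | b, j :: js => (if b then L j else (L j).reverse) ++ zigzag L (!b) js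

lemma mem_zigzag {c : Bool} {js : List κ} {v : V} :
    v ∈ zigzag L c js ↔ ∃ j ∈ js, v ∈ L j := by
  induction js generalizing c with
  | nil => simp [zigzag]
  | cons j js ih => cases c <;> simp [zigzag, ih]

lemma weight_zigzag_add (hL : IsLinkage G x y L) (u u' : V) (q : List V) (js : List κ) :
    weight R ([u] ++ zigzag L true js ++ q) + weight R ([u'] ++ zigzag L false js ++ q) =
      weight R (u :: js.map x ++ q) + weight R (u' :: js.map y ++ q) := by
  induction js generalizing u u' with
  | nil => rfl
  | cons j js ih =>
    have h1 := weight_append_append R [u] (zigzag L false js ++ q) (hL.path j).head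
      (hL.path j).last
    have h2 := weight_append_append R [u'] (zigzag L true js ++ q) (hL.path j).reverse.head
      (hL.path j).reverse.last
    have h3 := ih (x j) (y j)
    rw [weight_reverse] at h2
    simp only [zigzag, List.map_cons, Bool.not_true, Bool.not_false, if_true,
      Bool.false_eq_true, if_false, List.append_assoc, List.cons_append, List.nil_append,
      weight_cons_cons, weight_singleton] at h1 h2 h3 ⊢
    linear_combination (exp := 1) h1 + h2 + h3 + CharTwo.add_self_eq_zero (weight R (L j))

lemma IsLinkage.isPathList_zigzag (hL : IsLinkage G x y L) {p r : V} {js : List κ}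
    (hjs : js.Nodup) (c : Bool) {l : List V} {u u' : V} (hl : IsPathList G p u l)
    (hd : ∀ j ∈ js, ∀ v ∈ L j, v ∉ l)
    (hx : ∀ e ∈ steps (u :: js.map (if c then x else y) ++ [r]), e ∈ G.edgeSet)
    (hy : ∀ e ∈ steps (u' :: js.map (if c then y else x) ++ [r]), e ∈ G.edgeSet) :
    ∃ w, IsPathList G p w (l ++ zigzag L c js) ∧ G.Adj w r := by
  induction js generalizing c l u u' with
  | nil => exact ⟨u, by simpa [zigzag] using hl, hx s(u, r) (by simp)⟩
  | cons j js ih =>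
    rw [List.nodup_cons] at hjs
    have hpath : IsPathList G (if c then x j else y j) (if c then y j else x j)
        (if c then L j else (L j).reverse) := by
      cases c
      · exact (hL.path j).reverse
      · exact hL.path j
    have hmem : ∀ v, v ∈ (if c then L j else (L j).reverse) ↔ v ∈ L j := by cases c <;> simp
    have h1 := hl.append hpath
      (hx s(u, if c then x j else y j) (by cases c <;> simp)) fun v hv hv' =>
      hd j (by simp) v ((hmem v).1 hv') hv
    obtain ⟨w, hw⟩ := ih hjs.2 (!c) (u' := if c then x j else y j) h1
      (fun i hi v hv hv' => by
        rw [List.mem_append, hmem] at hv'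
        rcases hv' with hv' | hv'
        · exact hd i (by simp [hi]) v hv hv'
        · exact hL.disjoint i j (fun h => hjs.1 (h ▸ hi)) v hv hv')
      (fun e he => hy e (by cases c <;> simpa using Or.inr he))
      (fun e he => hx e (by cases c <;> simpa using Or.inr he))
    exact ⟨w, by simpa [zigzag] using hw⟩

end Weight

end JumbledHamilton

namespace JumbledHamilton

section Switching

variable {V : Type*} {G : SimpleGraph V} {a b : V} {l : List V} {R : Sym2 V → ZMod 2}

/-- Every Hamilton cycle, given as a list closed up by its first entry, has weight zero. -/
def Balanced (G : SimpleGraph V) (R : Sym2 V → ZMod 2) : Prop :=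
  ∀ l a b, IsPathList G a b l → (∀ v, v ∈ l) → G.Adj b a → weight R (l ++ [a]) = 0

variable [Fintype V] [DecidableEq V] {δ D m s ℓ : ℕ}

/-- A quasirandom graph whose parameters leave room for linking along paths of length
`2 * Nat.log 2 m + 4`. -/
structure Robust (G : SimpleGraph V) (δ D m s ℓ : ℕ) : Prop extends
    Quasirandom G δ D m s where
  le_right : 16 * (2 * Nat.log 2 m + 4) + 24 ≤ D
  le_left : 3 * (2 * Nat.log 2 m + 4) ≤ δ
  le_card : 2 * Nat.log 2 m + 4 ≤ m
  card_lt : Fintype.card V < 2 ^ ℓ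
  room : (4 * ℓ + 4) * (30 * s) + s + (2 * Nat.log 2 m + 4) * (2 * Nat.log 2 m + 4) ≤
    Fintype.card V

lemma Robust.weight_ofFn_eq (hG : Robust G δ D m s ℓ) (hR : Balanced G R) {x z : V} {k : ℕ}
    {f g : Fin k → V} (hf : IsPathList G x z (x :: List.ofFn f ++ [z]))
    (hg : IsPathList G x z (x :: List.ofFn g ++ [z])) (hk : k < 2 * Nat.log 2 m + 4)
    (hfg : ∀ i j, f i ≠ g j) :
    weight R (x :: List.ofFn f ++ [z]) = weight R (x :: List.ofFn g ++ [z]) := by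
  have hfn := hf.nodup
  have hgn := hg.nodup
  simp only [List.cons_append, List.nodup_cons, List.nodup_append, List.mem_append,
    List.mem_singleton, List.nodup_ofFn, List.mem_ofFn, not_or, not_exists,
    List.nodup_nil, List.not_mem_nil, forall_eq, forall_exists_index,
    forall_apply_eq_imp_iff] at hfn hgn
  obtain ⟨⟨hfx, hxz⟩, hfi, -, hfz⟩ := hfn
  obtain ⟨⟨hgx, -⟩, hgi, -, hgz⟩ := hgn
  let X : Option (Fin k) → V := fun i => i.elim z f
  let Y : Option (Fin k) → V := fun i => i.elim x g
  have hinj : Function.Injective (Sum.elim X Y) := by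
    refine Function.Injective.sumElim ?_ ?_ ?_
    · rintro (_ | i) (_ | j) h
      exacts [rfl, absurd h.symm (hfz j), absurd h (hfz i), congrArg some (hfi h)]
    · rintro (_ | i) (_ | j) h
      exacts [rfl, absurd h.symm (hgx j), absurd h (hgx i), congrArg some (hgi h)]
    · rintro (_ | i) (_ | j) h
      exacts [hxz h.symm, hgz j h.symm, hfx i h, hfg i j h]
  have hcard : Fintype.card (Option (Fin k)) = k + 1 := by simp
  have hr := hG.room
  obtain ⟨L, hL, hspan⟩ := hG.toQuasirandom.exists_spanning_linkage (x := X) (y := Y) (ℓ := ℓ)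
    hinj (by have := hG.le_right; omega) (by have := hG.le_left; omega)
    (by have := hG.le_card; omega) (by have := hG.le_right; omega) hG.card_lt
    (by
      have := Nat.mul_le_mul_right (2 * Nat.log 2 m + 4) (show k + 1 ≤ _ from hk)
      rw [hcard]
      omega)
  set js : List (Option (Fin k)) := (List.finRange k).map some with hjs
  have hX : js.map X = List.ofFn f := by
    rw [hjs, List.map_map, List.ofFn_eq_map]; rfl
  have hY : js.map Y = List.ofFn g := by
    rw [hjs, List.map_map, List.ofFn_eq_map]; rfl
  have hjsn : js.Nodup := (List.nodup_finRange k).map (Option.some_injective _)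
  have h0 : IsPathList G z x (L none) := hL.path none
  have hclosed : ∀ c, weight R (L none ++ zigzag L c js ++ [z]) = 0 := by
    intro c
    obtain ⟨w, hw, hwz⟩ := hL.isPathList_zigzag (r := z) (u' := x) hjsn c h0
      (by
        intro j hj v hv hv0
        obtain ⟨i, -, rfl⟩ := List.mem_map.1 hj
        exact hL.disjoint _ _ (by simp) v hv hv0)
      (by cases c <;> simp only [hX, hY, if_true, Bool.false_eq_true, if_false]
          exacts [hg.adj, hf.adj])
      (by cases c <;> simp only [hX, hY, if_true, Bool.false_eq_true, if_false]
          exacts [hf.adj, hg.adj])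
    refine hR _ _ _ hw (fun v => ?_) hwz
    obtain ⟨j, hj⟩ := hspan v
    rw [List.mem_append, mem_zigzag]
    cases j with
    | none => exact Or.inl hj
    | some i => exact Or.inr ⟨some i, by simp [hjs], hj⟩
  have hsplit : ∀ c, weight R (L none) + weight R ([x] ++ zigzag L c js ++ [z]) = 0 := by
    intro c
    have h1 := weight_append_append R [] (zigzag L c js ++ [z]) h0.head h0.last
    have h2 := hclosed c
    rw [List.append_assoc, ← List.nil_append (L none ++ _), ← List.append_assoc, h1] at h2
    simpa using h2
  have hsum := weight_zigzag_add R hL x x [z] js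
  rw [hX, hY] at hsum
  have h1 := hsplit true
  have h2 := hsplit false
  clear hsplit
  generalize weight R ([x] ++ zigzag L true js ++ [z]) = A at *
  generalize weight R ([x] ++ zigzag L false js ++ [z]) = B at *
  generalize weight R (x :: List.ofFn f ++ [z]) = A' at *
  generalize weight R (x :: List.ofFn g ++ [z]) = B' at *
  generalize weight R (L none) = C at *
  clear * - hsum h1 h2
  revert A B A' B' C
  decide

/-- Any two ends can be joined by a path with `q` inner vertices, all outside `F`. -/
def HasRoutes (G : SimpleGraph V) (q f : ℕ) : Prop :=
  ∀ x z (F : Finset V), x ≠ z → x ∉ F → z ∉ F → F.card ≤ f →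
    ∃ a : List V, a.length = q ∧ IsPathList G x z (x :: a ++ [z]) ∧ ∀ v ∈ a, v ∉ F

omit [Fintype V] [DecidableEq V] in
lemma IsPathList.exists_eq_cons_append (h : IsPathList G a b l) (hab : a ≠ b) :
    ∃ c, l = a :: c ++ [b] := by
  obtain ⟨l, rfl⟩ := List.head?_eq_some_iff.1 h.head
  rcases List.eq_nil_or_concat l with rfl | ⟨c, d, rfl⟩
  · have := h.last
    simp_all
  · have := h.last
    rw [List.concat_eq_append, ← List.cons_append, List.getLast?_append] at this
    simp at this
    exact ⟨c, by simp [this]⟩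

omit [Fintype V] [DecidableEq V] in
lemma IsPathList.cons (h : IsPathList G a b l) {x : V} (hx : G.Adj x a) (hxl : x ∉ l) :
    IsPathList G x b (x :: l) :=
  (IsPathList.singleton x).append h hx (by simpa using hxl)

lemma Robust.hasRoutes (hG : Robust G δ D m s ℓ) :
    HasRoutes G (2 * Nat.log 2 m + 2) (2 * (2 * Nat.log 2 m + 4) - 1) := by
  intro x z F hxz hx hz hF
  have hinj : Function.Injective (Sum.elim (fun _ : Unit => x) fun _ : Unit => z) :=
    Function.Injective.sumElim (Function.injective_of_subsingleton _)
      (Function.injective_of_subsingleton _) fun _ _ => hxz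
  have h := hG.le_right
  obtain ⟨L, hL, hlen, -, hLF⟩ := hG.toQuasirandom.exists_links hinj (F := F) (fun _ => hx)
    (fun _ => hz) (by simp; omega)
  obtain ⟨a, ha⟩ := (hL ()).exists_eq_cons_append hxz
  refine ⟨a, ?_, ha ▸ hL (), fun v hv => hLF () v (by rw [ha]; simp [hv])⟩
  have := hlen ()
  rw [ha] at this
  simpa using this

lemma Robust.hasRoutes_succ (hG : Robust G δ D m s ℓ) :
    HasRoutes G (2 * Nat.log 2 m + 3) (2 * (2 * Nat.log 2 m + 4) - 2) := by
  intro x z F hxz hx hz hF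
  obtain ⟨y, hy, hyF⟩ : ∃ y ∈ nbhd G {x}, y ∉ insert z F := by
    by_contra! h
    have h1 := Finset.card_le_card (show nbhd G {x} ⊆ insert z F from h)
    have h2 := Finset.card_insert_le z F
    have h3 := hG.degree x
    have h4 := hG.le_left
    omega
  simp only [mem_nbhd, Finset.mem_singleton, exists_eq_left, Finset.mem_insert,
    not_or] at hy hyF
  obtain ⟨a, ha, hpath, haF⟩ := hG.hasRoutes y z (insert x F) hyF.1
    (by simp [hyF.2, hy.ne']) (by simp [hz, hxz.symm])
    (by have := Finset.card_insert_le x F; omega)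
  have hxa : x ∉ y :: a ++ [z] := by
    have hxa : x ∉ a := fun h => haF x h (by simp)
    simp [hxz, hy.ne, hxa]
  refine ⟨y :: a, by simp [ha], hpath.cons hy hxa, ?_⟩
  intro v hv
  rcases List.mem_cons.1 hv with rfl | hv
  · exact hyF.2
  · exact fun h => haF v hv (by simp [h])

lemma Robust.exists_potential (hG : Robust G δ D m s ℓ) (hR : Balanced G R) {q f : ℕ}
    (hq : q < 2 * Nat.log 2 m + 4) (hf : 2 * q ≤ f) (hroutes : HasRoutes G q f) (z : V) :
    ∃ g : V → ZMod 2, ∀ x a, a.length = q → IsPathList G x z (x :: a ++ [z]) →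
      weight R (x :: a ++ [z]) = g x := by
  have hdisj : ∀ x a b, a.length = q → b.length = q → IsPathList G x z (x :: a ++ [z]) →
      IsPathList G x z (x :: b ++ [z]) → (∀ v ∈ a, v ∉ b) →
      weight R (x :: a ++ [z]) = weight R (x :: b ++ [z]) := by
    intro x a b ha hb hpa hpb hab
    obtain ⟨f, rfl⟩ : ∃ f : Fin q → V, List.ofFn f = a := by
      subst ha; exact ⟨_, List.ofFn_getElem⟩
    obtain ⟨g, rfl⟩ : ∃ g : Fin q → V, List.ofFn g = b := by
      subst hb; exact ⟨_, List.ofFn_getElem⟩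
    refine hG.weight_ofFn_eq hR hpa hpb hq fun i j h => ?_
    exact hab (f i) (by simp) (by simp [h])
  have hall : ∀ x a b, a.length = q → b.length = q → IsPathList G x z (x :: a ++ [z]) →
      IsPathList G x z (x :: b ++ [z]) → weight R (x :: a ++ [z]) = weight R (x :: b ++ [z]) := by
    intro x a b ha hb hpa hpb
    have hna := hpa.nodup
    have hnb := hpb.nodup
    obtain ⟨c, hc, hpc, hcF⟩ := hroutes x z (a.toFinset ∪ b.toFinset)
      (by rintro rfl; simp at hna) (by simp at hna hnb ⊢; tauto)
      (by
        simp [List.nodup_append] at hna hnb ⊢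
        exact ⟨fun h => hna.2.2 z h rfl, fun h => hnb.2.2 z h rfl⟩)
      (by
        have h1 := Finset.card_union_le a.toFinset b.toFinset
        have h2 := a.toFinset_card_le
        have h3 := b.toFinset_card_le
        omega)
    rw [hdisj x a c ha hc hpa hpc fun v hv hvc => hcF v hvc (by simp [hv]),
      hdisj x b c hb hc hpb hpc fun v hv hvc => hcF v hvc (by simp [hv])]
  classical
  refine ⟨fun x => if h : ∃ a, a.length = q ∧ IsPathList G x z (x :: a ++ [z]) then
    weight R (x :: h.choose ++ [z]) else 0, fun x a ha hpa => ?_⟩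
  have h : ∃ a, a.length = q ∧ IsPathList G x z (x :: a ++ [z]) := ⟨a, ha, hpa⟩
  simp only [dif_pos h]
  exact hall x a _ ha h.choose_spec.1 hpa h.choose_spec.2

end Switching

end JumbledHamilton

namespace JumbledHamilton

section Potential

variable {V : Type*} {G : SimpleGraph V} {R : Sym2 V → ZMod 2}

lemma weight_eq_of_potential {g : V → ZMod 2} {κ : ZMod 2} {a b : V} {l : List V}
    (hg : ∀ x y, s(x, y) ∈ steps l → R s(x, y) = g x + g y + κ)
    (ha : l.head? = some a) (hb : l.getLast? = some b) :
    weight R l = g a + g b + (l.length + 1) * κ := by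
  induction l generalizing a with
  | nil => simp at ha
  | cons x l ih =>
    cases l with
    | nil =>
      simp only [List.head?_cons, Option.some.injEq, List.getLast?_singleton] at ha hb
      subst ha hb
      simp [CharTwo.add_self_eq_zero]
    | cons y l =>
      simp only [List.head?_cons, Option.some.injEq] at ha
      subst ha
      rw [weight_cons_cons, hg x y (by simp), ih (fun u v h => hg u v (by simp [h])) rfl
        (by rwa [List.getLast?_cons_cons] at hb)]
      simp only [List.length_cons, Nat.cast_add, Nat.cast_one]
      linear_combination CharTwo.add_self_eq_zero (g y)

lemma eq_of_steps {g : V → ZMod 2} {a : V} {l : List V}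
    (hg : ∀ x y, s(x, y) ∈ steps l → g x = g y) (ha : l.head? = some a) :
    ∀ v ∈ l, g v = g a := by
  induction l generalizing a with
  | nil => simp
  | cons x l ih =>
    simp only [List.head?_cons, Option.some.injEq] at ha
    subst ha
    cases l with
    | nil => simp
    | cons y l =>
      intro v hv
      rcases List.mem_cons.1 hv with rfl | hv
      · rfl
      · rw [hg x y (by simp), ih (fun u w h => hg u w (by simp [h])) rfl v hv]

variable [Fintype V] [DecidableEq V] {δ D m s ℓ : ℕ}

/-- Away from a given vertex, a balanced weight is the coboundary of a potential. -/
theorem Robust.exists_coboundary (hG : Robust G δ D m s ℓ) (hR : Balanced G R)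
    (hodd : Odd (Fintype.card V)) (z : V) :
    ∃ g : V → ZMod 2, ∀ x y, x ≠ z → y ≠ z → G.Adj x y → R s(x, y) = g x + g y := by
  obtain ⟨g, hg⟩ := hG.exists_potential hR (by omega) (by omega) hG.hasRoutes z
  obtain ⟨g', hg'⟩ := hG.exists_potential hR (by omega) (by omega) hG.hasRoutes_succ z
  have hstep : ∀ x y, x ≠ z → y ≠ z → G.Adj x y → R s(x, y) = g y + g' x := by
    intro x y hx hy hxy
    obtain ⟨a, ha, hp, haF⟩ := hG.hasRoutes y z {x} hy (by simpa using hxy.ne')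
      (by simpa using hx.symm) (by rw [Finset.card_singleton]; omega)
    have hxa : x ∉ a := fun h => haF x h (by simp)
    have h1 := hg' x (y :: a) (by simp [ha]) (hp.cons hxy (by simp [hx, hxy.ne, hxa]))
    have h2 := hg y a ha hp
    simp only [List.cons_append, weight_cons_cons] at h1 h2
    rw [h2] at h1
    rw [← h1]
    linear_combination -CharTwo.add_self_eq_zero (g y)
  obtain ⟨w, hwz⟩ : ∃ w, G.Adj z w := by
    have h1 := hG.degree z
    have h2 := hG.two_le
    obtain ⟨w, hw⟩ := Finset.card_pos.1 (show 0 < (nbhd G {z}).card by omega)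
    exact ⟨w, by simpa using hw⟩
  obtain ⟨l, hl, hmem⟩ := hG.toQuasirandom.exists_isPathList_compl (W := ∅)
    (by have := hG.le_right; omega) (by simp) hG.card_lt (by have := hG.room; simp; omega)
    (by simp) (by simp) hwz.ne
  simp only [Finset.notMem_empty, not_false_eq_true, iff_true] at hmem
  obtain ⟨l, rfl⟩ := List.head?_eq_some_iff.1 hl.head
  have hlz := (List.nodup_cons.1 hl.nodup).1
  have hlen : (z :: l).length = Fintype.card V := by
    rw [← List.toFinset_card_of_nodup hl.nodup, ← Finset.card_univ]
    congr 1
    ext v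
    simp only [List.mem_toFinset, hmem, Finset.mem_univ]
  obtain _ | ⟨x, l⟩ := l
  · have := hl.last
    simp only [List.getLast?_singleton, Option.some.injEq] at this
    exact absurd this hwz.ne
  have hlast : (x :: l).getLast? = some w := by
    have := hl.last
    rwa [List.getLast?_cons_cons] at this
  have hzx : G.Adj z x := hl.adj s(z, x) (by simp)
  have hadj : ∀ u v, s(u, v) ∈ steps (x :: l) → u ≠ z ∧ v ≠ z ∧ G.Adj u v := by
    intro u v huv
    have hne : ∀ y ∈ s(u, v), y ≠ z := by
      rintro y hy rfl
      exact hlz (mem_of_mem_steps huv hy)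
    exact ⟨hne u (by simp), hne v (by simp), hl.adj s(u, v) (by simp [huv])⟩
  have two : (2 : ZMod 2) = 0 := CharTwo.two_eq_zero
  have hconst : ∀ v, v ≠ z → g v + g' v = g x + g' x := by
    intro v hv
    refine eq_of_steps (g := fun v => g v + g' v) (l := x :: l) (fun u v huv => ?_) rfl v ?_
    · obtain ⟨hu, hv, huv⟩ := hadj u v huv
      have h1 := hstep u v hu hv huv
      have h2 := hstep v u hv hu huv.symm
      rw [Sym2.eq_swap] at h2
      linear_combination h1 - h2 + (g' u - g' v) * two
    · have := hmem v
      rw [List.mem_cons] at this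
      exact this.resolve_left hv
  set κ := g x + g' x with hκ
  have hedge : ∀ u v, u ≠ z → v ≠ z → G.Adj u v → R s(u, v) = g u + g v + κ := by
    intro u v hu hv huv
    linear_combination hstep u v hu hv huv - hconst u hu + (g' u - g x - g' x) * two
  suffices h : κ = 0 by
    exact ⟨g, fun u v hu hv huv => by rw [hedge u v hu hv huv, h, add_zero]⟩
  have hcycle := hR _ _ _ hl hmem hwz.symm
  have hcov : weight R (x :: l) = g x + g w + κ := by
    rw [weight_eq_of_potential (fun u v huv => hedge u v (hadj u v huv).1 (hadj u v huv).2.1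
      (hadj u v huv).2.2) rfl hlast]
    have hodd' : Odd ((x :: l).length + 1) := by
      rw [← hlen] at hodd
      simpa using hodd
    have h1 : (((x :: l).length + 1 : ℕ) : ZMod 2) = 1 := (ZMod.natCast_eq_one_iff_odd).2 hodd'
    push_cast at h1
    rw [h1, one_mul]
  have hsplit : weight R (z :: x :: l ++ [z]) = R s(z, x) + weight R (x :: l) + R s(w, z) := by
    obtain ⟨p, hp⟩ := List.getLast?_eq_some_iff.1 hlast
    rw [List.cons_append, List.cons_append, weight_cons_cons, ← List.cons_append, hp,
      List.append_assoc, List.singleton_append, weight_append_cons, weight_cons_cons,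
      weight_singleton]
    ring
  have hxw : x ≠ w := by
    rintro rfl
    cases l with
    | nil => simp [← hlen, Nat.odd_iff] at hodd
    | cons y l =>
      rw [List.getLast?_cons_cons] at hlast
      exact (List.nodup_cons.1 (List.nodup_cons.1 hl.nodup).2).1 (List.mem_of_getLast? hlast)
  obtain ⟨a, ha, hp, haF⟩ := hG.hasRoutes x w {z} hxw (by simpa using hzx.ne')
    (by simpa using hwz.ne') (by rw [Finset.card_singleton]; omega)
  have hza : z ∉ a := fun h => haF z h (by simp)
  have hzp : z ∉ x :: a ++ [w] := by simp [hzx.ne, hwz.ne, hza]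
  have h1 := hg' x (a ++ [w]) (by simp [ha]) (by
    simpa using hp.append (IsPathList.singleton z) hwz.symm (by
      intro v hv; simp only [List.mem_singleton]; rintro rfl; exact hzp hv))
  have h2 := hg' w (a.reverse ++ [x]) (by simp [ha]) (by
    simpa using hp.reverse.append (IsPathList.singleton z) hzx.symm (by
      intro v hv; simp only [List.mem_singleton]; rintro rfl
      exact hzp (List.mem_reverse.1 hv)))
  have e1 : weight R (x :: (a ++ [w]) ++ [z]) = weight R (x :: a ++ [w]) + R s(w, z) := by
    have : x :: (a ++ [w]) ++ [z] = (x :: a) ++ w :: [z] := by simp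
    rw [this, weight_append_cons, weight_cons_cons, weight_singleton, add_zero]
  have e2 : weight R (w :: (a.reverse ++ [x]) ++ [z]) =
      weight R (x :: a ++ [w]) + R s(z, x) := by
    have : w :: (a.reverse ++ [x]) ++ [z] = (w :: a.reverse) ++ x :: [z] := by simp
    have h3 : (w :: a.reverse) ++ [x] = (x :: a ++ [w]).reverse := by simp
    rw [this, weight_append_cons, weight_cons_cons, weight_singleton, add_zero, h3,
      weight_reverse, Sym2.eq_swap]
  have h3 := hconst w hwz.ne'
  linear_combination hcycle - hsplit - hcov + h1 - e1 + h2 - e2 + h3 +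
    (g' x - R s(z, x) - R s(w, z) - g w - weight R (x :: a ++ [w])) * two

end Potential

end JumbledHamilton

namespace JumbledHamilton

section CycleSpace

variable {V : Type*} {G : SimpleGraph V} {R : Sym2 V → ZMod 2}

lemma edges_eq_steps {a b : V} (p : G.Walk a b) : p.edges = steps p.support := by
  induction p with
  | nil => rfl
  | cons h p ih =>
    rw [Walk.edges_cons, ih, Walk.support_cons]
    cases p <;> simp

lemma IsPathList.exists_walk {a b : V} {l : List V} (h : IsPathList G a b l) :
    ∃ p : G.Walk a b, p.support = l := by
  induction l generalizing a with
  | nil => simpa using h.head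
  | cons x l ih =>
    obtain rfl : x = a := by simpa using h.head
    cases l with
    | nil =>
      obtain rfl : x = b := by simpa using h.last
      exact ⟨.nil, rfl⟩
    | cons y l =>
      obtain ⟨p, hp⟩ := ih (a := y) ⟨h.nodup.of_cons, fun e he => h.adj e (by simp [he]), rfl,
        by simpa [List.getLast?_cons_cons] using h.last⟩
      have hxy : G.Adj x y := h.adj s(x, y) (by simp)
      exact ⟨.cons hxy p, by rw [Walk.support_cons, hp]⟩

lemma sum_edges_eq_of_coboundary {g : V → ZMod 2} {z : V}
    (hg : ∀ x y, x ≠ z → y ≠ z → G.Adj x y → R s(x, y) = g x + g y) {a b : V}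
    (p : G.Walk a b) (hz : z ∉ p.support) : (p.edges.map R).sum = g a + g b := by
  induction p with
  | nil => simp [CharTwo.add_self_eq_zero]
  | @cons u v w h p ih =>
    rw [Walk.support_cons, List.mem_cons, not_or] at hz
    have hv : v ≠ z := by rintro rfl; exact hz.2 p.start_mem_support
    rw [Walk.edges_cons, List.map_cons, List.sum_cons, ih hz.2, hg _ _ (Ne.symm hz.1) hv h]
    linear_combination CharTwo.add_self_eq_zero (g v)

lemma indicator_eq_sum [DecidableEq V] {l : List (Sym2 V)} (hl : l.Nodup) :
    (fun e => if e ∈ l then (1 : ZMod 2) else 0) = (l.map fun e => Pi.single e 1).sum := by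
  induction l with
  | nil => ext; simp
  | cons a l ih =>
    rw [List.nodup_cons] at hl
    rw [List.map_cons, List.sum_cons, ← ih hl.2]
    ext e
    rcases eq_or_ne e a with rfl | he
    · simp [hl.1]
    · simp [he]

lemma map_indicator [DecidableEq V] (φ : (Sym2 V → ZMod 2) →ₗ[ZMod 2] ZMod 2)
    {l : List (Sym2 V)} (hl : l.Nodup) : φ (fun e => if e ∈ l then 1 else 0) =
      (l.map fun e => φ (Pi.single e 1)).sum := by
  rw [indicator_eq_sum hl, map_list_sum, List.map_map]
  rfl

end CycleSpace

section

variable {V : Type} [Fintype V] [DecidableEq V] {G : SimpleGraph V} {δ D m s ℓ : ℕ}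

lemma balanced_of_hamiltonSpace_le_ker (φ : (Sym2 V → ZMod 2) →ₗ[ZMod 2] ZMod 2)
    (hφ : hamiltonSpace G ≤ LinearMap.ker φ) (hcard : 3 ≤ Fintype.card V) :
    Balanced G fun e => φ (Pi.single e 1) := by
  intro l a b hl hmem hba
  obtain ⟨p, rfl⟩ := hl.exists_walk
  have hpath : p.IsPath := ⟨⟨Walk.edges_nodup_of_support_nodup hl.nodup⟩, hl.nodup⟩
  have hham : p.IsHamiltonian := hpath.isHamiltonian_of_mem hmem
  have hlen := hham.length_support
  have hcycle : (Walk.cons hba p).IsHamiltonianCycle := by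
    rw [Walk.isHamiltonianCycle_iff_isCycle_and_length_eq, Walk.cons_isCycle_iff]
    refine ⟨⟨hpath, fun he => ?_⟩, by rw [← hlen]; simp⟩
    rw [edges_eq_steps] at he
    cases p with
    | nil => simp at he
    | cons h q =>
      rw [Walk.support_cons, ← List.nil_append (_ :: _), Sym2.eq_swap] at he
      have hn := hl.nodup
      rw [Walk.support_cons] at hn
      rcases getLast?_or_head?_of_mem_steps hn he with h1 | h1
      · simp at h1
      · obtain ⟨r, hr⟩ := List.head?_eq_some_iff.1 h1
        have hlast := hl.last
        rw [Walk.support_cons, hr, List.getLast?_cons_cons] at hlast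
        rw [hr] at hn
        cases r with
        | nil => rw [Walk.support_cons, hr] at hlen; simp at hlen; omega
        | cons c r =>
          rw [List.getLast?_cons_cons] at hlast
          exact (List.nodup_cons.1 hn.of_cons).1 (List.mem_of_getLast? hlast)
  have hzero := hφ (Submodule.subset_span ⟨b, _, hcycle, rfl⟩)
  rw [LinearMap.mem_ker, map_indicator φ hcycle.isCycle.edges_nodup] at hzero
  obtain ⟨r, hr⟩ := List.getLast?_eq_some_iff.1 hl.last
  rw [Walk.edges_cons, List.map_cons, List.sum_cons, edges_eq_steps] at hzero
  rw [hr, List.append_assoc, List.singleton_append, weight_append_cons, ← hr,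
    weight_cons_cons, weight_singleton, add_zero, add_comm]
  exact hzero

theorem Robust.hamiltonSpace_eq_cycleSpace (hG : Robust G δ D m s ℓ)
    (hodd : Odd (Fintype.card V)) (hcard : 3 ≤ Fintype.card V) :
    hamiltonSpace G = cycleSpace G := by
  refine le_antisymm (Submodule.span_mono ?_) ?_
  · rintro f ⟨x, c, hc, rfl⟩
    exact ⟨x, c, hc.isCycle, rfl⟩
  · refine Submodule.span_le.2 ?_
    rintro f ⟨x, c, hc, rfl⟩
    by_contra hnot
    obtain ⟨φ, hφc, hφ⟩ := Submodule.exists_le_ker_of_notMem hnot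
    refine hφc ?_
    by_cases hall : ∀ v, v ∈ c.support
    · refine hφ (Submodule.subset_span ⟨x, c, ⟨hc, ?_⟩, rfl⟩)
      refine hc.isPath_tail.isHamiltonian_of_mem fun v => ?_
      have hv := hall v
      rw [← Walk.cons_support_tail hc.not_nil, List.mem_cons] at hv
      rcases hv with rfl | hv
      · exact Walk.end_mem_support _
      · exact hv
    · push Not at hall
      obtain ⟨z, hz⟩ := hall
      obtain ⟨g, hg⟩ := hG.exists_coboundary
        (balanced_of_hamiltonSpace_le_ker φ hφ hcard) hodd z
      rw [map_indicator φ hc.edges_nodup, sum_edges_eq_of_coboundary hg c hz,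
        CharTwo.add_self_eq_zero]

end

end JumbledHamilton

namespace JumbledHamilton

section Jumbled

variable {V : Type} {G : SimpleGraph V} {p β : ℝ}

lemma interiorEdgeCount_union_le [Finite V] {A B : Set V}
    (hAB : ∀ x ∈ A, ∀ y ∈ B, ¬ G.Adj x y) : interiorEdgeCount G (A ∪ B) ≤
      interiorEdgeCount G A + interiorEdgeCount G B := by
  refine (Set.ncard_le_ncard ?_ (Set.toFinite _)).trans (Set.ncard_union_le _ _)
  rintro e ⟨he, hv⟩
  induction e with | _ x y
  rw [mem_edgeSet] at he
  simp only [Sym2.mem_iff, forall_eq_or_imp, forall_eq, Set.mem_union] at hv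
  rcases hv with ⟨hx | hx, hy | hy⟩
  · exact Or.inl ⟨he, by simp [hx, hy]⟩
  · exact absurd he (hAB x hx y hy)
  · exact absurd he.symm (hAB y hy x hx)
  · exact Or.inr ⟨he, by simp [hx, hy]⟩

lemma exists_adj_of_isJumbled [Finite V] (hG : IsJumbled G p β) {s : ℕ} (hs : 4 * β < p * s)
    {A B : Finset V} (hAB : Disjoint A B) (hA : s ≤ A.card) (hB : s ≤ B.card) :
    ∃ x ∈ A, ∃ y ∈ B, G.Adj x y := by
  classical
  obtain ⟨hp, -, hβ, hU⟩ := hG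
  obtain ⟨A', hA', hAc⟩ := Finset.exists_subset_card_eq hA
  obtain ⟨B', hB', hBc⟩ := Finset.exists_subset_card_eq hB
  by_contra! hcon
  have h0 := interiorEdgeCount_union_le (G := G) (A := A') (B := B')
    fun x hx y hy => hcon x (hA' hx) y (hB' hy)
  have hc : ((A' : Set V) ∪ B').ncard = s + s := by
    rw [← Finset.coe_union, Set.ncard_coe_finset,
      Finset.card_union_of_disjoint (Finset.disjoint_of_subset_left hA'
        (Finset.disjoint_of_subset_right hB' hAB)), hAc, hBc]
  have h1 := (abs_le.1 (hU A')).2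
  have h2 := (abs_le.1 (hU B')).2
  have h3 := (abs_le.1 (hU (A' ∪ B'))).1
  rw [Set.ncard_coe_finset, hAc, Nat.cast_choose_two] at h1
  rw [Set.ncard_coe_finset, hBc, Nat.cast_choose_two] at h2
  rw [hc, Nat.cast_choose_two] at h3
  have h0' : (interiorEdgeCount G (A' ∪ B') : ℝ) ≤
    interiorEdgeCount G A' + interiorEdgeCount G B' := by exact_mod_cast h0
  push_cast at h3
  have hs0 : (0 : ℝ) < s := by
    rcases Nat.eq_zero_or_pos s with rfl | h
    · simp at hs; linarith
    · exact_mod_cast h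
  nlinarith [mul_lt_mul_of_pos_right hs hs0]

variable [Fintype V] [DecidableEq V]

lemma mul_card_le_two_mul_interiorEdgeCount {δ : ℕ} {X Y : Finset V}
    (h : ∀ x ∈ X, δ ≤ (nbhd G {x} ∩ Y).card) :
    δ * X.card ≤ 2 * interiorEdgeCount G (X ∪ Y) := by
  classical
  set S : Finset (V × V) := (X ×ˢ Y).filter fun q => G.Adj q.1 q.2 with hS
  have h1 : δ * X.card ≤ S.card := by
    rw [Finset.card_eq_sum_card_fiberwise (f := Prod.fst) (t := X) fun q hq =>
      (Finset.mem_product.1 (Finset.mem_filter.1 hq).1).1, mul_comm, ← smul_eq_mul]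
    refine Finset.card_nsmul_le_sum _ _ _ fun x hx => (h x hx).trans ?_
    rw [← Finset.card_map (Function.Embedding.sectR x V)]
    refine Finset.card_le_card fun q hq => ?_
    obtain ⟨y, hy, rfl⟩ := Finset.mem_map.1 hq
    simp only [Finset.mem_inter, mem_nbhd, Finset.mem_singleton, exists_eq_left] at hy
    simp [hx, hy.1, hy.2]
  have h2 := Finset.card_le_mul_card_image (f := fun q : V × V => s(q.1, q.2)) S 2 (by
    intro e he
    obtain ⟨⟨x, y⟩, -, rfl⟩ := Finset.mem_image.1 he
    refine (Finset.card_le_card (t := {(x, y), (y, x)}) ?_).trans Finset.card_le_two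
    rintro ⟨u, v⟩ huv
    have := (Finset.mem_filter.1 huv).2
    simpa [Sym2.eq_iff] using this)
  refine h1.trans (h2.trans (Nat.mul_le_mul_left 2 ?_))
  rw [interiorEdgeCount, ← Set.ncard_coe_finset]
  refine Set.ncard_le_ncard ?_ (Set.toFinite _)
  intro e he
  obtain ⟨⟨x, y⟩, hxy, rfl⟩ := Finset.mem_image.1 (Finset.mem_coe.1 he)
  simp only [hS, Finset.mem_filter, Finset.mem_product] at hxy
  exact ⟨hxy.2, by simp [hxy.1.1, hxy.1.2]⟩

lemma mul_card_le_of_isJumbled (hG : IsJumbled G p β) {δ D m : ℕ}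
    (hδ : (D + 1) * (p * ((D + 1) * m) + 2 * β) < δ) {X Y : Finset V} (hX : X.card ≤ m)
    (h : ∀ x ∈ X, δ ≤ (nbhd G {x} ∩ Y).card) : D * X.card ≤ Y.card := by
  obtain ⟨hp, -, hβ, hU⟩ := hG
  by_contra! hlt
  have hX0 : (0 : ℝ) < X.card := by
    have : 0 < X.card := by by_contra h0; simp_all
    exact_mod_cast this
  have h1 : (δ * X.card : ℝ) ≤ 2 * interiorEdgeCount G (X ∪ Y) := by
    exact_mod_cast mul_card_le_two_mul_interiorEdgeCount h
  have h2 := (abs_le.1 (hU (X ∪ Y))).2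
  rw [← Finset.coe_union, Set.ncard_coe_finset, Finset.coe_union, Nat.cast_choose_two] at h2
  have h3 : ((X ∪ Y).card : ℝ) ≤ (D + 1) * X.card := by
    have := Finset.card_union_le X Y
    have : (X ∪ Y).card ≤ (D + 1) * X.card := by nlinarith
    exact_mod_cast this
  have hXm : (X.card : ℝ) ≤ m := by exact_mod_cast hX
  set u : ℝ := ((X ∪ Y).card : ℝ)
  have hu : 0 ≤ u := Nat.cast_nonneg _
  have h4 : δ * X.card ≤ u * (p * u + 2 * β) := by nlinarith [mul_nonneg hp.le hu]
  have hD : (0 : ℝ) < D + 1 := by positivity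
  have h5 : u ≤ (D + 1) * m := h3.trans (by gcongr)
  have h6 : u * (p * u + 2 * β) ≤ (D + 1) * X.card * (p * ((D + 1) * m) + 2 * β) := by
    gcongr
  nlinarith [mul_lt_mul_of_pos_right hδ hX0]

end Jumbled

end JumbledHamilton

namespace JumbledHamilton

section Parameters

lemma natLog_add_one_le {n : ℕ} (hn : 3 ≤ n) : ((Nat.log 2 n + 1 : ℕ) : ℝ) ≤ 3 * Real.log n := by
  have h1 : ((Nat.log 2 n : ℕ) : ℝ) ≤ Real.logb 2 n := Real.natLog_le_logb n 2
  have h2 : 1 ≤ Real.log n := by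
    rw [Real.le_log_iff_exp_le (by positivity)]
    have : (3 : ℝ) ≤ n := by exact_mod_cast hn
    linarith [Real.exp_one_lt_d9]
  have h3 : Real.logb 2 n ≤ 2 * Real.log n := by
    rw [Real.logb, div_le_iff₀ (Real.log_pos one_lt_two)]
    nlinarith [Real.log_two_gt_d9]
  push_cast
  linarith

lemma eventually_mul_natLog_pow_le (c : ℝ) (hc : 0 < c) :
    ∀ᶠ n : ℕ in Filter.atTop, c * ((Nat.log 2 n + 1 : ℕ) : ℝ) ^ 3 ≤ n := by
  have h := ((Real.isLittleO_pow_log_id_atTop (n := 3)).comp_tendsto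
    tendsto_natCast_atTop_atTop).bound (show 0 < (27 * c)⁻¹ by positivity)
  filter_upwards [h, Filter.eventually_ge_atTop 3] with n hn h3
  have h1 := natLog_add_one_le h3
  simp only [Function.comp_apply, id_eq, norm_pow, Real.norm_eq_abs, Nat.abs_cast] at hn
  rw [abs_of_nonneg (Real.log_natCast_nonneg n), inv_mul_eq_div,
    le_div_iff₀ (by positivity)] at hn
  have h2 : ((Nat.log 2 n + 1 : ℕ) : ℝ) ^ 3 ≤ (3 * Real.log n) ^ 3 := by gcongr
  nlinarith

variable {V : Type} [Fintype V] [DecidableEq V] {G : SimpleGraph V} {p β : ℝ}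

lemma exists_robust_of_isJumbled (hG : IsJumbled G p β) {n ℓ : ℕ} (hn : Fintype.card V = n)
    (hℓ : ℓ = Nat.log 2 n + 1) {Λ : ℝ} (hℓΛ : ℓ ≤ 3 * Λ)
    (hbig : 10 ^ 6 * (ℓ : ℝ) ^ 3 ≤ n) (hβ : 10 ^ 8 * (β * Λ) ≤ n * p)
    (hdeg : ∀ v, (1 - 1 / 10 ^ 8) * (n * p) ≤ ((nbhd G {v}).card : ℝ)) :
    ∃ δ D m s ℓ, Robust G δ D m s ℓ := by
  obtain ⟨hp0, hp1, hβ1, -⟩ := id hG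
  have hℓ1 : 1 ≤ ℓ := by omega
  have hℓ1' : (1 : ℝ) ≤ ℓ := by exact_mod_cast hℓ1
  have hΛ : 0 < Λ := by linarith
  have hΛβ : Λ ≤ β * Λ := by nlinarith
  have hnp : 0 < n * p := by nlinarith
  have hbig' : 10 ^ 6 * ℓ ^ 3 ≤ n := by exact_mod_cast hbig
  have hℓ3 : ℓ ≤ ℓ ^ 3 := Nat.le_self_pow (by norm_num) ℓ
  have hℓ23 : ℓ ^ 2 ≤ ℓ ^ 3 := Nat.pow_le_pow_right hℓ1 (by norm_num)
  set D := 100 * ℓ with hD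
  set m := n / (20 * (D + 1) ^ 2) with hm
  set s := ⌊4 * β / p⌋₊ + 1 with hs
  set δ := ⌊(1 - 1 / 10 ^ 8) * (n * p) / 2⌋₊ with hδ
  have hK : 2 * Nat.log 2 m + 4 ≤ 4 * ℓ := by
    have h1 : Nat.log 2 m ≤ Nat.log 2 n := Nat.log_mono_right (Nat.div_le_self _ _)
    omega
  have hmul : m * (20 * (D + 1) ^ 2) ≤ n := Nat.div_mul_le_self _ _
  have hDsq : (D + 1) ^ 2 ≤ 10201 * ℓ ^ 2 := by nlinarith
  have hmbig : 4 * ℓ ≤ m := by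
    rw [hm, Nat.le_div_iff_mul_le (by positivity)]
    calc 4 * ℓ * (20 * (D + 1) ^ 2) ≤ 4 * ℓ * (20 * (10201 * ℓ ^ 2)) := by gcongr
      _ ≤ 10 ^ 6 * ℓ ^ 3 := by ring_nf; omega
      _ ≤ n := hbig'
  have hmn : n ≤ 408040 * ℓ ^ 2 * m := by
    have h1 : n < (20 * (D + 1) ^ 2) * (m + 1) := Nat.lt_mul_div_succ n (by positivity)
    have h2 : (20 * (D + 1) ^ 2) * (m + 1) ≤ (20 * (10201 * ℓ ^ 2)) * (2 * m) := by
      gcongr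
      omega
    nlinarith
  have hsup : 4 * β / p < s := by rw [hs]; push_cast; exact Nat.lt_floor_add_one _
  have hsΛ : 10 ^ 8 * (s * Λ) ≤ 5 * n := by
    have h1 : (s : ℝ) ≤ 4 * β / p + 1 := by
      rw [hs]; push_cast; gcongr; exact Nat.floor_le (by positivity)
    have h2 : (s : ℝ) * p ≤ 4 * β + p := by
      calc (s : ℝ) * p ≤ (4 * β / p + 1) * p := by gcongr
        _ = 4 * β + p := by field_simp
    have h3 : (10 ^ 8 * (s * Λ)) * p ≤ 5 * n * p := by nlinarith
    exact le_of_mul_le_mul_right h3 hp0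
  have hsℓ : 10 ^ 8 * ((s : ℝ) * ℓ) ≤ 15 * n := by
    have : (s : ℝ) * ℓ ≤ s * (3 * Λ) := by gcongr
    linarith
  have hsℓ' : 10 ^ 8 * (s * ℓ) ≤ 15 * n := by exact_mod_cast hsℓ
  have hδlow : (1 - 1 / 10 ^ 8) * (n * p) / 2 < δ + 1 := Nat.lt_floor_add_one _
  have hβℓ : ℓ * β ≤ 3 * (β * Λ) := by nlinarith
  have hδbig : (12 * ℓ : ℝ) < δ := by linarith
  have hδbig' : 12 * ℓ < δ := by exact_mod_cast hδbig
  refine ⟨δ, D, m, s, ℓ, ⟨⟨fun v => ?_, fun X Y hX h => ?_, fun A B hAB hA hB => ?_, ?_, ?_,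
    ?_, ?_⟩, ?_, ?_, ?_, ?_, ?_⟩⟩
  · have h1 : (δ : ℝ) ≤ (1 - 1 / 10 ^ 8) * (n * p) / 2 := Nat.floor_le (by linarith)
    have h2 : ((2 * δ : ℕ) : ℝ) ≤ (nbhd G {v}).card := by push_cast; linarith [hdeg v]
    exact_mod_cast h2
  · refine mul_card_le_of_isJumbled hG (δ := δ) (D := D) (m := m) ?_ hX h
    have h1 : (m * (20 * (D + 1) ^ 2) : ℝ) ≤ n := by exact_mod_cast hmul
    have h2 : p * (m * (20 * (D + 1) ^ 2)) ≤ p * n := by gcongr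
    have h3 : ((D : ℝ) + 1) * (2 * β) ≤ 202 * (ℓ * β) := by
      rw [hD]; push_cast; nlinarith
    have h4 : ((D : ℝ) + 1) * (p * ((D + 1) * m) + 2 * β) =
        p * (m * (20 * (D + 1) ^ 2)) / 20 + (D + 1) * (2 * β) := by ring
    rw [h4]
    linarith
  · refine exists_adj_of_isJumbled hG ?_ hAB hA hB
    rwa [div_lt_iff₀ hp0, mul_comm (s : ℝ)] at hsup
  · omega
  · omega
  · omega
  · have h1 : 50 * s * (4081 * ℓ) ≤ D * m * (4081 * ℓ) := by
      have : D * m * (4081 * ℓ) = 408100 * ℓ ^ 2 * m := by rw [hD]; ring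
      rw [this]
      nlinarith
    exact Nat.le_of_mul_le_mul_right h1 (by positivity)
  · omega
  · omega
  · omega
  · rw [hn, hℓ]; exact Nat.lt_pow_succ_log_self one_lt_two n
  · rw [hn]
    have h1 : (2 * Nat.log 2 m + 4) * (2 * Nat.log 2 m + 4) ≤ (4 * ℓ) * (4 * ℓ) :=
      Nat.mul_le_mul hK hK
    have h2 : s ≤ s * ℓ := Nat.le_mul_of_pos_right s hℓ1
    nlinarith

end Parameters

end JumbledHamilton

theorem jumbled_hamilton_space :
    ∃ ε C : ℝ, ε > 0 ∧ C > 1 ∧ ∃ N : ℕ, ∀ n : ℕ, Odd n → n ≥ N →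
      ∀ p β : ℝ, p ≥ C * Real.log n / n → 1 ≤ β → β ≤ ε * n * p / Real.log n →
      ∀ (V : Type) [Fintype V] [DecidableEq V] (G : SimpleGraph V),
        Fintype.card V = n →
        IsJumbled G p β →
        (∀ v : V, ((G.neighborSet v).ncard : ℝ) ≥ (1 - ε) * n * p) →
        hamiltonSpace G = cycleSpace G := by
  obtain ⟨N, hN⟩ := Filter.eventually_atTop.1
    (JumbledHamilton.eventually_mul_natLog_pow_le (10 ^ 6) (by norm_num))
  refine ⟨1 / 10 ^ 8, 2, by norm_num, by norm_num, max N 3, ?_⟩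
  intro n hodd hn p β _ _ hβ V _ _ G hcard hG hdeg
  have h3 : 3 ≤ n := (le_max_right _ _).trans hn
  have hlog : 0 < Real.log n := Real.log_pos (by exact_mod_cast (by omega : 1 < n))
  rw [le_div_iff₀ hlog] at hβ
  obtain ⟨δ, D, m, s, ℓ, hR⟩ := JumbledHamilton.exists_robust_of_isJumbled hG hcard rfl
    (JumbledHamilton.natLog_add_one_le h3) (hN n ((le_max_left _ _).trans hn)) (by linarith)
    fun v => by
      have h : G.neighborSet v = (JumbledHamilton.nbhd G {v} : Set V) := by ext; simp
      have h1 := hdeg v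
      rw [h, Set.ncard_coe_finset] at h1
      linarith
  subst hcard
  exact hR.hamiltonSpace_eq_cycleSpace hodd h3
end

section
/- Let G be a Hamiltonian simple graph with an odd number n of vertices such that C_n(G) ≠ C(G). Then there exists a spanning subgraph R ⊆ G (a subset of the edges of G) such that: (C1) R ≠ E(G); (C2) every Hamilton cycle of G contains an even number of edges of R; and (C3) for every partition V(G) = A ∪ B into two disjoint sets, e_R(A,B) ≥ e_G(A,B)/2 and R is not equal to the set of edges of G with one endpoint in A and the other in B. -/
open SimpleGraph

/-- The number of edges in the edge set `E` with one endpoint in `A` and the other in `B`. -/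
noncomputable def edgeCountBetween {V : Type} (E : Set (Sym2 V)) (A B : Set V) : ℕ :=
  {e ∈ E | ∃ a ∈ A, ∃ b ∈ B, e = s(a, b)}.ncard

/-- The coboundary of a `ZMod 2`-valued function on vertices: the indicator function of a cut. -/
def coboundary {V : Type} (g : V → ZMod 2) : Sym2 V → ZMod 2 :=
  Sym2.lift ⟨fun a b => g a + g b, fun a b => add_comm (g a) (g b)⟩

lemma coboundary_mk {V : Type} (g : V → ZMod 2) (a b : V) :
    coboundary g s(a, b) = g a + g b := rfl

lemma coboundary_add {V : Type} (g h : V → ZMod 2) (e : Sym2 V) :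
    coboundary (g + h) e = coboundary g e + coboundary h e := by
  induction e with
  | _ a b => simp only [coboundary_mk, Pi.add_apply]; ring

lemma ZMod.two_eq_zero_or_one (x : ZMod 2) : x = 0 ∨ x = 1 := by
  revert x; decide

/-- A coboundary sums along a walk to the difference of its values at the endpoints. -/
lemma sum_coboundary_edges {V : Type} {G : SimpleGraph V} (g : V → ZMod 2) {x y : V}
    (c : G.Walk x y) : (c.edges.map (coboundary g)).sum = g x + g y := by
  induction c with
  | nil => simp [CharTwo.add_self_eq_zero]
  | @cons u v w h p ih =>
    rw [Walk.edges_cons, List.map_cons, List.sum_cons, ih, coboundary_mk]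
    linear_combination CharTwo.add_self_eq_zero (g v)

lemma sum_map_eq_ncard {α : Type} [DecidableEq α] {l : List α} (hl : l.Nodup)
    (ρ : α → ZMod 2) :
    (l.map ρ).sum = (({e | e ∈ l ∧ ρ e = 1}.ncard : ℕ) : ZMod 2) := by
  have hset : {e | e ∈ l ∧ ρ e = 1} = ↑(l.toFinset.filter fun e => ρ e = 1) := by
    ext e; simp
  rw [hset, Set.ncard_coe_finset, ← List.sum_toFinset _ hl, ← Finset.sum_boole]
  refine Finset.sum_congr rfl fun e _ => ?_
  rcases ZMod.two_eq_zero_or_one (ρ e) with h | h <;> simp [h]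

lemma dual_apply_indicator {α : Type} [Fintype α] [DecidableEq α]
    (L : (α → ZMod 2) →ₗ[ZMod 2] ZMod 2) {l : List α} (hl : l.Nodup) :
    L (fun e => if e ∈ l then 1 else 0) = (l.map fun e => L (Pi.single e 1)).sum := by
  rw [LinearMap.pi_apply_eq_sum_univ, ← List.sum_toFinset _ hl]
  simp only [ite_smul, one_smul, zero_smul, ← List.mem_toFinset]
  rw [Finset.sum_ite_mem, Finset.univ_inter]
  refine Finset.sum_congr rfl fun e _ => congrArg L ?_
  ext j
  simp [Pi.single_apply, eq_comm]

/-- If the Hamilton cycles do not span the cycle space, some `ZMod 2`-weighting of the edges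
vanishes on every Hamilton cycle but not on every cycle. -/
lemma exists_weight_of_hamiltonSpace_ne {V : Type} [Fintype V] [DecidableEq V]
    {G : SimpleGraph V} (hne : hamiltonSpace G ≠ cycleSpace G) :
    ∃ r : Sym2 V → ZMod 2,
      (∀ (x : V) (c : G.Walk x x), c.IsHamiltonianCycle → (c.edges.map r).sum = 0) ∧
      ∃ (x : V) (c : G.Walk x x), c.IsCycle ∧ (c.edges.map r).sum ≠ 0 := by
  have hle : hamiltonSpace G ≤ cycleSpace G := by
    refine Submodule.span_mono ?_
    rintro f ⟨x, c, hc, rfl⟩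
    exact ⟨x, c, hc.isCycle, rfl⟩
  have hnot : ¬ cycleSpace G ≤ hamiltonSpace G := fun h => hne (le_antisymm hle h)
  rw [cycleSpace, Submodule.span_le, Set.not_subset] at hnot
  obtain ⟨f, ⟨x, c, hc, rfl⟩, hf⟩ := hnot
  obtain ⟨L, hLf, hL⟩ := Submodule.exists_le_ker_of_notMem hf
  refine ⟨fun e => L (Pi.single e 1), fun y d hd => ?_, x, c, hc, ?_⟩
  · rw [← dual_apply_indicator L hd.isCycle.edges_nodup]
    exact hL (Submodule.subset_span ⟨y, d, hd, rfl⟩)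
  · rwa [← dual_apply_indicator L hc.edges_nodup]

/-- The edges of `G` between complementary sets form the support of a coboundary. -/
lemma mem_between_iff_coboundary {V : Type} {A B : Set V} (hAB : A ∪ B = Set.univ)
    (hd : Disjoint A B) (e : Sym2 V) :
    (∃ a ∈ A, ∃ b ∈ B, e = s(a, b)) ↔ coboundary (A.indicator 1) e = 1 := by
  obtain rfl : B = Aᶜ := (IsCompl.of_eq hd.eq_bot hAB).compl_eq.symm
  induction e with
  | _ u v =>
    rw [coboundary_mk]
    constructor
    · rintro ⟨a, ha, b, hb, h⟩
      rw [← coboundary_mk, h, coboundary_mk]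
      simp [Set.indicator_of_mem ha, Set.indicator_of_notMem hb]
    · intro h
      by_cases hu : u ∈ A <;> by_cases hv : v ∈ A
      · simp [hu, hv, CharTwo.add_self_eq_zero] at h
      · exact ⟨u, hu, v, hv, rfl⟩
      · exact ⟨v, hv, u, hu, Sym2.eq_swap⟩
      · simp [hu, hv] at h

/-- If switching along `K` does not enlarge `R`, then `R` contains at least half of `K`. -/
lemma ncard_le_two_mul_ncard_inter {α : Type} [Finite α] {R K : Set α}
    (h : ((R \ K) ∪ (K \ R)).ncard ≤ R.ncard) : K.ncard ≤ 2 * (R ∩ K).ncard := by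
  have hdisj : Disjoint (R \ K) (K \ R) :=
    Set.disjoint_left.2 fun _ h₁ h₂ => h₂.2 h₁.1
  rw [Set.ncard_union_eq hdisj] at h
  have h₁ := Set.ncard_inter_add_ncard_sdiff_eq_ncard R K
  have h₂ := Set.ncard_inter_add_ncard_sdiff_eq_ncard K R
  rw [Set.inter_comm K R] at h₂
  omega

theorem exists_counterexample_subgraph {V : Type} [Fintype V] [DecidableEq V]
    (G : SimpleGraph V) (hodd : Odd (Fintype.card V)) (hham : G.IsHamiltonian)
    (hne : hamiltonSpace G ≠ cycleSpace G) :
    ∃ R : Set (Sym2 V), R ⊆ G.edgeSet ∧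
      -- (C1)
      R ≠ G.edgeSet ∧
      -- (C2)
      (∀ (x : V) (c : G.Walk x x), c.IsHamiltonianCycle →
        Even {e | e ∈ c.edges ∧ e ∈ R}.ncard) ∧
      -- (C3)
      (∀ A B : Set V, A ∪ B = Set.univ → Disjoint A B →
        (edgeCountBetween R A B : ℝ) ≥ (edgeCountBetween G.edgeSet A B : ℝ) / 2 ∧
        R ≠ {e ∈ G.edgeSet | ∃ a ∈ A, ∃ b ∈ B, e = s(a, b)}) := by
  obtain ⟨r, hr, x₀, c₀, hc₀, hrc₀⟩ := exists_weight_of_hamiltonSpace_ne hne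
  obtain ⟨g, hg⟩ := Finite.exists_max fun g : V → ZMod 2 =>
    {e | e ∈ G.edgeSet ∧ r e + coboundary g e = 1}.ncard
  set ρ : Sym2 V → ZMod 2 := fun e => r e + coboundary g e with hρ
  have hsum : ∀ (x : V) (c : G.Walk x x), (c.edges.map ρ).sum = (c.edges.map r).sum := by
    intro x c
    rw [hρ, List.sum_map_add, sum_coboundary_edges, CharTwo.add_self_eq_zero, add_zero]
  have hcard : Fintype.card V ≠ 1 := by
    intro h
    have := Fintype.card_le_one_iff_subsingleton.1 h.le
    cases c₀ with
    | nil => exact hc₀.ne_nil rfl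
    | cons h _ => exact h.ne (Subsingleton.elim _ _)
  refine ⟨{e | e ∈ G.edgeSet ∧ ρ e = 1}, fun e he => he.1, ?_, ?_, ?_⟩
  · intro hR
    obtain ⟨x, c, hc⟩ := hham hcard
    have h0 := (hsum x c).trans (hr x c hc)
    have h1 : c.edges.map ρ = c.edges.map fun _ => (1 : ZMod 2) :=
      List.map_congr_left fun e he => (hR.symm ▸ c.edges_subset_edgeSet he :
        e ∈ {e | e ∈ G.edgeSet ∧ ρ e = 1}).2
    rw [h1, List.map_const', List.sum_replicate, Walk.length_edges, hc.length_eq,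
      nsmul_eq_mul, mul_one, ZMod.natCast_eq_zero_iff_even] at h0
    exact (Nat.not_even_iff_odd.2 hodd) h0
  · intro x c hc
    have h0 := (hsum x c).trans (hr x c hc)
    rw [sum_map_eq_ncard hc.isCycle.edges_nodup, ZMod.natCast_eq_zero_iff_even] at h0
    convert h0 using 3
    ext e
    exact ⟨fun h => ⟨h.1, h.2.2⟩, fun h => ⟨h.1, c.edges_subset_edgeSet h.1, h.2⟩⟩
  · intro A B hAB hd
    simp only [edgeCountBetween, mem_between_iff_coboundary hAB hd]
    set h : V → ZMod 2 := A.indicator 1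
    constructor
    · have hmax := hg (g + h)
      have hswitch : {e | e ∈ G.edgeSet ∧ r e + coboundary (g + h) e = 1} =
          ({e | e ∈ G.edgeSet ∧ ρ e = 1} \ {e | e ∈ G.edgeSet ∧ coboundary h e = 1}) ∪
          ({e | e ∈ G.edgeSet ∧ coboundary h e = 1} \ {e | e ∈ G.edgeSet ∧ ρ e = 1}) := by
        ext e
        have hadd : r e + coboundary (g + h) e = ρ e + coboundary h e := by
          rw [coboundary_add, hρ, add_assoc]
        simp only [Set.mem_ofPred_eq, Set.mem_union, Set.mem_sdiff, hadd]
        have hone : (1 : ZMod 2) + 1 = 0 := rfl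
        rcases ZMod.two_eq_zero_or_one (ρ e) with h₁ | h₁ <;>
          rcases ZMod.two_eq_zero_or_one (coboundary h e) with h₂ | h₂ <;>
          simp [h₁, h₂, hone]
      rw [hswitch] at hmax
      have hhalf := ncard_le_two_mul_ncard_inter hmax
      have hinter : {e | e ∈ {e | e ∈ G.edgeSet ∧ ρ e = 1} ∧ coboundary h e = 1} =
          {e | e ∈ G.edgeSet ∧ ρ e = 1} ∩ {e | e ∈ G.edgeSet ∧ coboundary h e = 1} := by
        ext e
        exact ⟨fun h => ⟨h.1, h.1.1, h.2⟩, fun h => ⟨h.1, h.2.2⟩⟩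
      rw [hinter, ge_iff_le, div_le_iff₀ two_pos, mul_comm]
      exact_mod_cast hhalf
    · intro hR
      refine hrc₀ ?_
      have hmap : c₀.edges.map ρ = c₀.edges.map (coboundary h) := by
        refine List.map_congr_left fun e he => ?_
        have hG := c₀.edges_subset_edgeSet he
        have hiff := Set.ext_iff.1 hR e
        simp only [Set.mem_ofPred_eq, hG, true_and] at hiff
        rcases ZMod.two_eq_zero_or_one (ρ e) with h₁ | h₁ <;>
          rcases ZMod.two_eq_zero_or_one (coboundary h e) with h₂ | h₂ <;>
          simp_all
      rw [← hsum, hmap, sum_coboundary_edges, CharTwo.add_self_eq_zero]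
end

section
/- Let G be a simple graph, R ⊆ E(G) a set of edges, and let W ⊆ G be an R-parity-switcher consisting of an even cycle C = (v₁, v₂, …, v_{2k}) containing an odd number of edges of R, together with pairwise vertex-disjoint paths P_i in G from v_i to v_{2k−i+2} for 2 ≤ i ≤ k, whose interior vertices avoid the cycle. Then W contains two paths from v₁ to v_{k+1}, each visiting every vertex of W exactly once, such that the number of edges of R on the first path and the number of edges of R on the second path have different parities. -/
open SimpleGraph

/-- Consecutive disjoint paths from `c i` to `d i` (`1 ≤ i ≤ n`), linked by the edges
`d i — c (i + 1)`, form a single path from `d 0` to `c (n + 1)`. -/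
theorem SimpleGraph.exists_isPath_of_linked_paths {V : Type*} {G : SimpleGraph V}
    (p : Sym2 V → Bool) (S : ℕ → Set V) (E : ℕ → Set (Sym2 V)) (N : ℕ → ℕ) (c d : ℕ → V) (n : ℕ)
    (hadj : ∀ i ≤ n, G.Adj (d i) (c (i + 1)))
    (hpath : ∀ i, 1 ≤ i → i ≤ n → ∃ q : G.Walk (c i) (d i), q.IsPath ∧
      (∀ x, x ∈ q.support ↔ x ∈ S i) ∧ (∀ e ∈ q.edges, e ∈ E i) ∧ q.edges.countP p = N i)
    (hdisj : ∀ i j, 1 ≤ i → i < j → j ≤ n → ∀ x ∈ S i, x ∉ S j)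
    (hstart : ∀ i, 1 ≤ i → i ≤ n → d 0 ∉ S i)
    (hend : ∀ i, 1 ≤ i → i ≤ n → c (n + 1) ∉ S i) (hne : d 0 ≠ c (n + 1)) :
    ∃ Q : G.Walk (d 0) (c (n + 1)), Q.IsPath ∧
      (∀ x, x ∈ Q.support ↔ x = d 0 ∨ x = c (n + 1) ∨ ∃ i, 1 ≤ i ∧ i ≤ n ∧ x ∈ S i) ∧
      (∀ e ∈ Q.edges, (∃ i ≤ n, e = s(d i, c (i + 1))) ∨ ∃ i, 1 ≤ i ∧ i ≤ n ∧ e ∈ E i) ∧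
      Q.edges.countP p = ∑ i ∈ Finset.range (n + 1), (if p s(d i, c (i + 1)) then 1 else 0) +
        ∑ i ∈ Finset.range n, N (i + 1) := by
  induction n with
  | zero =>
    refine ⟨(hadj 0 le_rfl).toWalk, ?_, ?_, ?_, ?_⟩
    · simpa [Adj.toWalk] using hne
    · intro x
      simp only [Adj.toWalk, Walk.support_cons, Walk.support_nil, List.mem_cons, List.not_mem_nil,
        or_false]
      constructor
      · tauto
      · rintro (h | h | ⟨i, h1, h2, -⟩)
        · exact .inl h
        · exact .inr h
        · omega
    · intro e he
      exact .inl ⟨0, le_rfl, by simpa [Adj.toWalk] using he⟩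
    · simp [Adj.toWalk, List.countP_cons, -Finset.sum_boole]
  | succ n ih =>
    obtain ⟨q, hq, hqS, hqE, hqN⟩ := hpath (n + 1) (by omega) le_rfl
    have hcS : c (n + 1) ∈ S (n + 1) := (hqS _).1 q.start_mem_support
    obtain ⟨Q, hQ, hQS, hQE, hQN⟩ := ih (fun i hi => hadj i (by omega))
      (fun i h1 h2 => hpath i h1 (by omega))
      (fun i j h1 h2 h3 => hdisj i j h1 h2 (by omega))
      (fun i h1 h2 => hstart i h1 (by omega))
      (fun i h1 h2 h => hdisj i (n + 1) h1 (by omega) le_rfl _ h hcS)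
      (fun h => hstart (n + 1) (by omega) le_rfl (h ▸ hcS))
    have hmem : ∀ x, x ∈ (Q.append q).support ↔
        x = d 0 ∨ ∃ i, 1 ≤ i ∧ i ≤ n + 1 ∧ x ∈ S i := by
      intro x
      rw [Walk.mem_support_append_iff, hQS, hqS]
      constructor
      · rintro ((h | h | ⟨i, h1, h2, h3⟩) | h)
        · exact .inl h
        · exact .inr ⟨n + 1, by omega, le_rfl, h ▸ hcS⟩
        · exact .inr ⟨i, h1, by omega, h3⟩
        · exact .inr ⟨n + 1, by omega, le_rfl, h⟩
      · rintro (h | ⟨i, h1, h2, h3⟩)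
        · exact .inl (.inl h)
        · rcases Nat.lt_or_eq_of_le h2 with h2 | rfl
          · exact .inl (.inr (.inr ⟨i, h1, by omega, h3⟩))
          · exact .inr h3
    have hQq : (Q.append q).IsPath := by
      have hqn := hq.support_nodup
      rw [← Walk.cons_tail_support, List.nodup_cons] at hqn
      rw [Walk.isPath_def, Walk.support_append, List.nodup_append']
      refine ⟨hQ.support_nodup, hqn.2, fun x hx hx' => ?_⟩
      have hxS : x ∈ S (n + 1) := (hqS x).1 (List.mem_of_mem_tail hx')
      rcases (hQS x).1 hx with rfl | rfl | ⟨i, h1, h2, h3⟩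
      · exact hstart (n + 1) (by omega) le_rfl hxS
      · exact hqn.1 hx'
      · exact hdisj i (n + 1) h1 (by omega) le_rfl x h3 hxS
    refine ⟨(Q.append q).concat (hadj (n + 1) le_rfl), ?_, ?_, ?_, ?_⟩
    · refine hQq.concat (fun h => ?_) _
      rcases (hmem _).1 h with h | ⟨i, h1, h2, h3⟩
      · exact hne h.symm
      · exact hend i h1 h2 h3
    · intro x
      rw [Walk.support_concat, List.mem_append, hmem, List.mem_singleton]
      rw [or_assoc, or_comm (a := x = c (n + 1 + 1))]
    · intro e he
      rw [Walk.edges_concat, List.concat_eq_append, List.mem_append, Walk.edges_append,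
        List.mem_append, List.mem_singleton] at he
      rcases he with (h | h) | h
      · rcases hQE e h with ⟨i, hi, h⟩ | ⟨i, h1, h2, h⟩
        · exact .inl ⟨i, by omega, h⟩
        · exact .inr ⟨i, h1, by omega, h⟩
      · exact .inr ⟨n + 1, by omega, le_rfl, hqE e h⟩
      · exact .inl ⟨n + 1, le_rfl, h⟩
    · rw [Walk.edges_concat, List.concat_eq_append, List.countP_append, Walk.edges_append,
        List.countP_append, hQN, hqN, Finset.sum_range_succ _ (n + 1),
        Finset.sum_range_succ (fun i => N (i + 1)) n, List.countP_singleton]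
      ring

/-- A duplicate-free list has as many members in a set as it has entries in that set. -/
theorem List.Nodup.ncard_mem_and_eq_countP {α : Type*} [DecidableEq α] {l : List α}
    (hl : l.Nodup) (R : Set α) [DecidablePred (· ∈ R)] :
    {e | e ∈ l ∧ e ∈ R}.ncard = l.countP (fun e => decide (e ∈ R)) := by
  have h : {e | e ∈ l ∧ e ∈ R} =
      ((l.filter (fun e => decide (e ∈ R))).toFinset : Set α) := by
    ext e
    simp
  rw [h, Set.ncard_coe_finset, List.toFinset_card_of_nodup (hl.filter _),
    List.countP_eq_length_filter]

theorem parity_switcher_two_paths {V : Type} [Fintype V] [DecidableEq V]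
    (G : SimpleGraph V) (R : Set (Sym2 V)) (hR : R ⊆ G.edgeSet)
    (k : ℕ) (hk : 2 ≤ k) (v : ℕ → V)
    -- the cycle C = (v₁, …, v_{2k}):
    (hinj : ∀ i ∈ Finset.Icc 1 (2 * k), ∀ j ∈ Finset.Icc 1 (2 * k), v i = v j → i = j)
    (hadj : ∀ i ∈ Finset.Icc 1 (2 * k - 1), G.Adj (v i) (v (i + 1)))
    (hadj' : G.Adj (v (2 * k)) (v 1))
    -- C has an odd number of edges in R:
    (hodd : Odd {e : Sym2 V |
        ((∃ i ∈ Finset.Icc 1 (2 * k - 1), e = s(v i, v (i + 1))) ∨ e = s(v (2 * k), v 1)) ∧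
        e ∈ R}.ncard)
    -- pairwise vertex-disjoint paths P_i from v_i to v_{2k-i+2}:
    (P : ∀ i ∈ Finset.Icc 2 k, G.Walk (v i) (v (2 * k - i + 2)))
    (hP : ∀ i (hi : i ∈ Finset.Icc 2 k), (P i hi).IsPath)
    (hPdisj : ∀ i (hi : i ∈ Finset.Icc 2 k), ∀ j (hj : j ∈ Finset.Icc 2 k), i ≠ j →
      ∀ x, x ∈ (P i hi).support → x ∉ (P j hj).support)
    -- interior vertices of the paths avoid the cycle:
    (hPint : ∀ i (hi : i ∈ Finset.Icc 2 k), ∀ x ∈ (P i hi).support,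
      x ≠ v i → x ≠ v (2 * k - i + 2) → ∀ j ∈ Finset.Icc 1 (2 * k), x ≠ v j) :
    -- there are two Hamilton paths of the switcher W from v₁ to v_{k+1} whose numbers of
    -- edges in R have different parities:
    ∃ Q₁ Q₂ : G.Walk (v 1) (v (k + 1)),
      Q₁.IsPath ∧ Q₂.IsPath ∧
      (∀ e ∈ Q₁.edges,
        ((∃ i ∈ Finset.Icc 1 (2 * k - 1), e = s(v i, v (i + 1))) ∨ e = s(v (2 * k), v 1)) ∨
        ∃ i, ∃ hi : i ∈ Finset.Icc 2 k, e ∈ (P i hi).edges) ∧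
      (∀ e ∈ Q₂.edges,
        ((∃ i ∈ Finset.Icc 1 (2 * k - 1), e = s(v i, v (i + 1))) ∨ e = s(v (2 * k), v 1)) ∨
        ∃ i, ∃ hi : i ∈ Finset.Icc 2 k, e ∈ (P i hi).edges) ∧
      (∀ x : V, ((∃ j ∈ Finset.Icc 1 (2 * k), x = v j) ∨
        ∃ i, ∃ hi : i ∈ Finset.Icc 2 k, x ∈ (P i hi).support) ↔ x ∈ Q₁.support) ∧
      (∀ x : V, ((∃ j ∈ Finset.Icc 1 (2 * k), x = v j) ∨
        ∃ i, ∃ hi : i ∈ Finset.Icc 2 k, x ∈ (P i hi).support) ↔ x ∈ Q₂.support) ∧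
      (Odd {e | e ∈ Q₁.edges ∧ e ∈ R}.ncard ↔ Even {e | e ∈ Q₂.edges ∧ e ∈ R}.ncard) := by
  classical
  set p : Sym2 V → Bool := fun e => decide (e ∈ R) with hp
  obtain ⟨n, rfl⟩ : ∃ n, k = n + 1 := ⟨k - 1, by omega⟩
  -- the cycle as a closed sequence `u 0, …, u (2k) = u 0`
  set u : ℕ → V := fun j => if j = 2 * (n + 1) then v 1 else v (j + 1) with hu
  have hu0 : u 0 = v 1 := by simp [hu]
  have hun : u (n + 1) = v (n + 1 + 1) := by
    simp only [hu]
    rw [if_neg (by omega)]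
  have hulast : u (2 * (n + 1)) = v 1 := by simp [hu]
  have huv : ∀ j, j < 2 * (n + 1) → u j = v (j + 1) := by
    intro j hj
    simp only [hu]
    rw [if_neg (by omega)]
  have hvinj : ∀ i j, 1 ≤ i → i ≤ 2 * (n + 1) → 1 ≤ j → j ≤ 2 * (n + 1) → v i = v j → i = j :=
    fun i j h1 h2 h3 h4 => hinj i (Finset.mem_Icc.2 ⟨h1, h2⟩) j (Finset.mem_Icc.2 ⟨h3, h4⟩)
  have huinj : ∀ i j, i ≤ 2 * (n + 1) → j ≤ 2 * (n + 1) → u i = u j →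
      i = j ∨ (i = 0 ∧ j = 2 * (n + 1)) ∨ (i = 2 * (n + 1) ∧ j = 0) := by
    intro i j hi hj h
    simp only [hu] at h
    split_ifs at h with h1 h2 h2
    · omega
    · have := hvinj 1 (j + 1) (by omega) (by omega) (by omega) (by omega) h
      omega
    · have := hvinj (i + 1) 1 (by omega) (by omega) (by omega) (by omega) h
      omega
    · have := hvinj (i + 1) (j + 1) (by omega) (by omega) (by omega) (by omega) h
      omega
  have hcyc : ∀ e : Sym2 V, ((∃ i ∈ Finset.Icc 1 (2 * (n + 1) - 1), e = s(v i, v (i + 1))) ∨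
      e = s(v (2 * (n + 1)), v 1)) ↔ ∃ j < 2 * (n + 1), e = s(u j, u (j + 1)) := by
    intro e
    constructor
    · rintro (⟨i, hi, rfl⟩ | rfl)
      · rw [Finset.mem_Icc] at hi
        refine ⟨i - 1, by omega, ?_⟩
        rw [huv _ (by omega), huv _ (by omega), Nat.sub_add_cancel hi.1]
      · refine ⟨2 * (n + 1) - 1, by omega, ?_⟩
        rw [huv _ (by omega), Nat.sub_add_cancel (by omega), hulast]
    · rintro ⟨j, hj, rfl⟩
      by_cases h : j + 1 = 2 * (n + 1)
      · right
        rw [huv j hj, h, hulast]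
      · left
        exact ⟨j + 1, Finset.mem_Icc.2 (by omega), by rw [huv j hj, huv (j + 1) (by omega)]⟩
  have hcycv : ∀ x, (∃ j ∈ Finset.Icc 1 (2 * (n + 1)), x = v j) ↔ ∃ j < 2 * (n + 1), x = u j := by
    intro x
    constructor
    · rintro ⟨j, hj, rfl⟩
      rw [Finset.mem_Icc] at hj
      exact ⟨j - 1, by omega, by rw [huv _ (by omega), Nat.sub_add_cancel hj.1]⟩
    · rintro ⟨j, hj, rfl⟩
      exact ⟨j + 1, Finset.mem_Icc.2 (by omega), huv j hj⟩
  have huadj : ∀ j < 2 * (n + 1), G.Adj (u j) (u (j + 1)) := by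
    intro j hj
    by_cases h : j + 1 = 2 * (n + 1)
    · rw [h, hulast, huv j hj, h]
      exact hadj'
    · rw [huv j hj, huv (j + 1) (by omega)]
      exact hadj _ (Finset.mem_Icc.2 (by omega))
  simp only [hcyc, hcycv] at hodd ⊢
  have hcount : {e : Sym2 V | (∃ j < 2 * (n + 1), e = s(u j, u (j + 1))) ∧ e ∈ R}.ncard =
      ∑ i ∈ Finset.range (n + 1), ((if p s(u i, u (i + 1)) then 1 else 0) +
        (if p s(u (2 * (n + 1) - i), u (2 * (n + 1) - (i + 1))) then 1 else 0)) := by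
    have hset : {e : Sym2 V | (∃ j < 2 * (n + 1), e = s(u j, u (j + 1))) ∧ e ∈ R} =
        (((Finset.range (2 * (n + 1))).filter (fun j => p s(u j, u (j + 1)))).image
          (fun j => s(u j, u (j + 1))) : Finset (Sym2 V)) := by
      ext e
      simp only [hp, Set.mem_ofPred_eq, Finset.coe_image, Finset.coe_filter, Finset.mem_range,
        decide_eq_true_eq, Set.mem_image]
      constructor
      · rintro ⟨⟨j, hj, rfl⟩, h⟩
        exact ⟨j, ⟨hj, h⟩, rfl⟩
      · rintro ⟨j, ⟨hj, h⟩, rfl⟩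
        exact ⟨⟨j, hj, rfl⟩, h⟩
    rw [hset, Set.ncard_coe_finset, Finset.card_image_of_injOn, Finset.card_filter, two_mul,
      Finset.sum_range_add, Finset.sum_add_distrib]
    · congr 1
      rw [← Finset.sum_range_reflect]
      refine Finset.sum_congr rfl fun i hi => ?_
      rw [Finset.mem_range] at hi
      rw [Sym2.eq_swap]
      congr 4 <;> congr 1 <;> omega
    · intro i hi j hj h
      simp only [Finset.coe_filter, Finset.mem_range, Set.mem_ofPred_eq] at hi hj
      rcases Sym2.eq_iff.1 h with ⟨h1, h2⟩ | ⟨h1, h2⟩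
      · have := huinj _ _ (by omega) (by omega) h1
        omega
      · have h1 := huinj _ _ (by omega) (by omega) h1
        have h2 := huinj _ _ (by omega) (by omega) h2
        omega
  set S : ℕ → Set V := fun i => {x | ∃ h : i + 1 ∈ Finset.Icc 2 (n + 1), x ∈ (P (i + 1) h).support}
  set E : ℕ → Set (Sym2 V) :=
    fun i => {e | ∃ h : i + 1 ∈ Finset.Icc 2 (n + 1), e ∈ (P (i + 1) h).edges}
  set N : ℕ → ℕ := fun i =>
    if h : i + 1 ∈ Finset.Icc 2 (n + 1) then (P (i + 1) h).edges.countP p else 0 with hN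
  have hpath : ∀ i, 1 ≤ i → i ≤ n → ∃ q : G.Walk (u i) (u (2 * (n + 1) - i)), q.IsPath ∧
      (∀ x, x ∈ q.support ↔ x ∈ S i) ∧ (∀ e ∈ q.edges, e ∈ E i) ∧ q.edges.countP p = N i := by
    intro i h1 h2
    have hi : i + 1 ∈ Finset.Icc 2 (n + 1) := Finset.mem_Icc.2 (by omega)
    have ha : v (i + 1) = u i := (huv i (by omega)).symm
    have hb : v (2 * (n + 1) - (i + 1) + 2) = u (2 * (n + 1) - i) := by
      rw [huv _ (by omega)]
      congr 1
      omega
    refine ⟨(P (i + 1) hi).copy ha hb, ?_, ?_, ?_, ?_⟩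
    · simpa using hP (i + 1) hi
    · intro x
      rw [Walk.support_copy]
      exact ⟨fun h => ⟨hi, h⟩, fun ⟨_, h⟩ => h⟩
    · intro e he
      rw [Walk.edges_copy] at he
      exact ⟨hi, he⟩
    · rw [Walk.edges_copy]
      simp only [hN]
      rw [dif_pos hi]
  have hpath' : ∀ i, 1 ≤ i → i ≤ n → ∃ q : G.Walk (u (2 * (n + 1) - i)) (u i), q.IsPath ∧
      (∀ x, x ∈ q.support ↔ x ∈ S i) ∧ (∀ e ∈ q.edges, e ∈ E i) ∧ q.edges.countP p = N i := by
    intro i h1 h2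
    obtain ⟨q, hq1, hq2, hq3, hq4⟩ := hpath i h1 h2
    refine ⟨q.reverse, hq1.reverse, ?_, ?_, ?_⟩
    · simpa using hq2
    · simpa using hq3
    · rw [Walk.edges_reverse, List.countP_reverse, hq4]
  have hdisj : ∀ i j, 1 ≤ i → i < j → j ≤ n → ∀ x ∈ S i, x ∉ S j := by
    rintro i j h1 h2 h3 x ⟨hi, hx⟩ ⟨hj, hx'⟩
    exact hPdisj _ hi _ hj (by omega) x hx hx'
  have hSv : ∀ i j, 1 ≤ j → j ≤ 2 * (n + 1) → v j ∈ S i →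
      j = i + 1 ∨ j = 2 * (n + 1) - (i + 1) + 2 := by
    rintro i j h1 h2 ⟨hi, hx⟩
    by_contra! hcon
    have hi' := Finset.mem_Icc.1 hi
    refine hPint _ hi _ hx (fun h => hcon.1 ?_) (fun h => hcon.2 ?_) j
      (Finset.mem_Icc.2 ⟨h1, h2⟩) rfl
    · exact hvinj _ _ h1 h2 (by omega) (by omega) h
    · exact hvinj _ _ h1 h2 (by omega) (by omega) h
  have hstart : ∀ i, 1 ≤ i → i ≤ n → v 1 ∉ S i := by
    intro i h1 h2 h
    have := hSv i 1 le_rfl (by omega) h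
    omega
  have hend : ∀ i, 1 ≤ i → i ≤ n → v (n + 1 + 1) ∉ S i := by
    intro i h1 h2 h
    have := hSv i (n + 1 + 1) (by omega) (by omega) h
    omega
  have hne : v 1 ≠ v (n + 1 + 1) := by
    intro h
    have := hvinj _ _ le_rfl (by omega) (by omega) (by omega) h
    omega
  -- a zigzag traverses the `i`-th path from `c i` to `d i` and then stays on that side of the cycle
  have hzig : ∀ c d : ℕ → V, (∀ i, (c i = u i ∧ d i = u (2 * (n + 1) - i)) ∨
        (c i = u (2 * (n + 1) - i) ∧ d i = u i)) →
      (∀ i, (d i = u i ∧ c (i + 1) = u (i + 1)) ∨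
        (d i = u (2 * (n + 1) - i) ∧ c (i + 1) = u (2 * (n + 1) - (i + 1)))) →
      ∃ Q : G.Walk (v 1) (v (n + 1 + 1)), Q.IsPath ∧
        (∀ e ∈ Q.edges, (∃ j < 2 * (n + 1), e = s(u j, u (j + 1))) ∨
          ∃ i, ∃ hi : i ∈ Finset.Icc 2 (n + 1), e ∈ (P i hi).edges) ∧
        (∀ x, ((∃ j < 2 * (n + 1), x = u j) ∨
          ∃ i, ∃ hi : i ∈ Finset.Icc 2 (n + 1), x ∈ (P i hi).support) ↔ x ∈ Q.support) ∧
        {e | e ∈ Q.edges ∧ e ∈ R}.ncard =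
          ∑ i ∈ Finset.range (n + 1), (if p s(d i, c (i + 1)) then 1 else 0) +
            ∑ i ∈ Finset.range n, N (i + 1) := by
    intro c d hcd hdc
    have hd0 : d 0 = v 1 := by
      rcases hdc 0 with ⟨h, -⟩ | ⟨h, -⟩
      · rw [h, hu0]
      · rw [h, Nat.sub_zero, hulast]
    have hcn : c (n + 1) = v (n + 1 + 1) := by
      rcases hcd (n + 1) with ⟨h, -⟩ | ⟨h, -⟩
      · rw [h, hun]
      · rw [h, ← hun]
        congr 1
        omega
    have hedge : ∀ i ≤ n, ∃ j < 2 * (n + 1), s(d i, c (i + 1)) = s(u j, u (j + 1)) := by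
      intro i hi
      rcases hdc i with ⟨h, h'⟩ | ⟨h, h'⟩
      · exact ⟨i, by omega, by rw [h, h']⟩
      · refine ⟨2 * (n + 1) - (i + 1), by omega, ?_⟩
        rw [h, h', Sym2.eq_swap, show 2 * (n + 1) - (i + 1) + 1 = 2 * (n + 1) - i by omega]
    obtain ⟨Q, hQ, hQS, hQE, hQN⟩ := exists_isPath_of_linked_paths p S E N c d n
      (fun i hi => by
        obtain ⟨j, hj, h⟩ := hedge i hi
        rw [← mem_edgeSet, h]
        exact huadj j hj)
      (fun i h1 h2 => by
        rcases hcd i with ⟨h, h'⟩ | ⟨h, h'⟩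
        · rw [h, h']
          exact hpath i h1 h2
        · rw [h, h']
          exact hpath' i h1 h2)
      hdisj (by rwa [hd0]) (by rwa [hcn]) (by rwa [hd0, hcn])
    refine ⟨Q.copy hd0 hcn, by simpa using hQ, ?_, ?_, ?_⟩
    · intro e he
      rw [Walk.edges_copy] at he
      rcases hQE e he with ⟨i, hi, rfl⟩ | ⟨i, -, -, hi, h⟩
      · exact .inl (hedge i hi)
      · exact .inr ⟨i + 1, hi, h⟩
    · intro x
      rw [Walk.support_copy, hQS, hd0, hcn]
      constructor
      · rintro (⟨j, hj, rfl⟩ | ⟨i, hi, h⟩)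
        · by_cases h0 : j = 0
          · exact .inl (by rw [h0, hu0])
          by_cases hj1 : j = n + 1
          · exact .inr (.inl (by rw [hj1, hun]))
          refine .inr (.inr ?_)
          rcases Nat.lt_or_gt_of_ne hj1 with hlt | hgt
          · obtain ⟨q, -, hq, -⟩ := hpath j (by omega) (by omega)
            exact ⟨j, by omega, by omega, (hq _).1 q.start_mem_support⟩
          · obtain ⟨q, -, hq, -⟩ := hpath (2 * (n + 1) - j) (by omega) (by omega)
            refine ⟨2 * (n + 1) - j, by omega, by omega, (hq _).1 ?_⟩
            have hjj : 2 * (n + 1) - (2 * (n + 1) - j) = j := by omega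
            simpa only [hjj] using q.end_mem_support
        · have hi' := Finset.mem_Icc.1 hi
          obtain ⟨i, rfl⟩ : ∃ m, i = m + 1 := ⟨i - 1, by omega⟩
          exact .inr (.inr ⟨i, by omega, by omega, hi, h⟩)
      · rintro (rfl | rfl | ⟨i, -, -, hi, h⟩)
        · exact .inl ⟨0, by omega, hu0.symm⟩
        · exact .inl ⟨n + 1, by omega, hun.symm⟩
        · exact .inr ⟨i + 1, hi, h⟩
    · rw [List.Nodup.ncard_mem_and_eq_countP, Walk.edges_copy, hQN]
      rw [Walk.edges_copy]
      exact hQ.isTrail.edges_nodup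
  obtain ⟨Q₁, h1P, h1E, h1S, h1N⟩ := hzig
    (fun i => if Odd i then u i else u (2 * (n + 1) - i))
    (fun i => if Odd i then u (2 * (n + 1) - i) else u i)
    (fun i => by by_cases h : Odd i <;> simp [h])
    (fun i => by by_cases h : Odd i <;> simp [h, Nat.odd_add_one])
  obtain ⟨Q₂, h2P, h2E, h2S, h2N⟩ := hzig
    (fun i => if Odd i then u (2 * (n + 1) - i) else u i)
    (fun i => if Odd i then u i else u (2 * (n + 1) - i))
    (fun i => by by_cases h : Odd i <;> simp [h])
    (fun i => by by_cases h : Odd i <;> simp [h, Nat.odd_add_one])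
  refine ⟨Q₁, Q₂, h1P, h2P, h1E, h2E, h1S, h2S, ?_⟩
  have hsum : {e | e ∈ Q₁.edges ∧ e ∈ R}.ncard + {e | e ∈ Q₂.edges ∧ e ∈ R}.ncard =
      {e : Sym2 V | (∃ j < 2 * (n + 1), e = s(u j, u (j + 1))) ∧ e ∈ R}.ncard +
        2 * ∑ i ∈ Finset.range n, N (i + 1) := by
    rw [h1N, h2N, hcount, add_add_add_comm, ← Finset.sum_add_distrib, ← two_mul]
    congr 1
    refine Finset.sum_congr rfl fun i _ => ?_
    by_cases h : Odd i
    · simp only [h, Nat.odd_add_one, not_true_eq_false, if_true, if_false]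
      exact add_comm _ _
    · simp only [h, Nat.odd_add_one, not_false_eq_true, if_true, if_false]
  rw [← Nat.odd_add, hsum, Nat.odd_add]
  simpa using hodd
end

section
/- Let G be a simple graph and R ⊆ E(G) a set of edges such that for some natural number ℓ: (L1) for every vertex set S with |S| ≤ 2ℓ and every two vertices x, y ∉ S, there is a path from x to y of length at most ℓ−1 using only edges of R and avoiding S; (L2) R ≠ E(G), and for every partition V(G) = A ∪ B, R is not equal to the set of all edges of G between A and B. Then G contains a cycle of even length at most 2ℓ that contains an odd number of edges from R. -/
open SimpleGraph

namespace SimpleGraph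

variable {V : Type*} {G H : SimpleGraph V}

/-- After deleting any `k` vertices, any two remaining vertices are joined by a path of length at
most `m`. -/
def RobustlyLinked (H : SimpleGraph V) (k m : ℕ) : Prop :=
  ∀ S : Set V, S.ncard ≤ k → ∀ x ∉ S, ∀ y ∉ S,
    ∃ w : H.Walk x y, w.IsPath ∧ w.length ≤ m ∧ ∀ u ∈ w.support, u ∉ S

theorem Walk.ncard_support_le {u v : V} (p : H.Walk u v) :
    {a | a ∈ p.support}.ncard ≤ p.length + 1 := by
  classical
  have h : {a | a ∈ p.support} = (p.support.toFinset : Set V) := by ext; simp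
  rw [h, Set.ncard_coe_finset, ← p.length_support]
  exact List.toFinset_card_le _

theorem Walk.IsPath.append_of_inter_eq {u v w : V} {p : H.Walk u v} {q : H.Walk v w}
    (hp : p.IsPath) (hq : q.IsPath) (h : ∀ a ∈ p.support, a ∈ q.support → a = v) :
    (p.append q).IsPath := by
  have hv : v ∉ q.support.tail := by
    have := hq.support_nodup
    rw [← q.cons_tail_support] at this
    exact (List.nodup_cons.1 this).1
  rw [Walk.isPath_def, Walk.support_append, List.nodup_append]
  refine ⟨hp.support_nodup, hq.support_nodup.tail, ?_⟩
  rintro a ha _ hb rfl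
  exact hv (h a ha (List.mem_of_mem_tail hb) ▸ hb)

/-- If all short paths from `x` to `y` are even, then the two halves of any short walk from `x` to
`y` through `v` have the same parity, even if they intersect. -/
theorem RobustlyLinked.even_length_iff [Finite V] {m : ℕ} (hL : H.RobustlyLinked (2 * (m + 1)) m)
    {x y : V} (hev : ∀ w : H.Walk x y, w.IsPath → w.length ≤ 2 * m + 1 → Even w.length)
    {v : V} {p : H.Walk x v} {q : H.Walk v y} (hp : p.IsPath) (hq : q.IsPath)
    (hpm : p.length ≤ m) (hqm : q.length ≤ m) (hy : y ∉ p.support) (hx : x ∉ q.support) :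
    Even p.length ↔ Even q.length := by
  have direct : ∀ (p : H.Walk x v) (q : H.Walk v y), p.IsPath → q.IsPath → p.length ≤ m →
      q.length ≤ m → (∀ a ∈ p.support, a ∈ q.support → a = v) →
      (Even p.length ↔ Even q.length) := by
    intro p q hp hq hpm hqm h
    rw [← Nat.even_add, ← Walk.length_append]
    refine hev _ (hp.append_of_inter_eq hq h) ?_
    rw [Walk.length_append]
    lia
  have hyv : y ≠ v := fun h => hy (h ▸ p.end_mem_support)
  obtain ⟨p₀, hp₀, hp₀m, hp₀q⟩ := hL {a | a ∈ q.support ∧ a ≠ v}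
    ((Set.ncard_le_ncard fun a ha => ha.1).trans (q.ncard_support_le.trans (by lia)))
    x (fun h => hx h.1) v (fun h => h.2 rfl)
  have hy₀ : y ∉ p₀.support := fun h => hp₀q y h ⟨q.end_mem_support, hyv⟩
  obtain ⟨q₀, hq₀, hq₀m, hq₀p⟩ := hL ({a | a ∈ p.support ∧ a ≠ v} ∪ {a | a ∈ p₀.support ∧ a ≠ v})
    ((Set.ncard_union_le _ _).trans <| (add_le_add
      ((Set.ncard_le_ncard fun a ha => ha.1).trans p.ncard_support_le)
      ((Set.ncard_le_ncard fun a ha => ha.1).trans p₀.ncard_support_le)).trans (by lia))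
    v (by simp) y (by simp [hy, hy₀])
  rw [direct p q₀ hp hq₀ hpm hq₀m
      fun a ha hb => by_contra fun hn => hq₀p a hb (Or.inl ⟨ha, hn⟩),
    ← direct p₀ q₀ hp₀ hq₀ hp₀m hq₀m
      fun a ha hb => by_contra fun hn => hq₀p a hb (Or.inr ⟨ha, hn⟩),
    direct p₀ q hp₀ hq hp₀m hqm
      fun a ha hb => by_contra fun hn => hp₀q a ha ⟨hb, hn⟩]

theorem RobustlyLinked.nonempty_coloring_bool [Finite V] {m : ℕ}
    (hL : H.RobustlyLinked (2 * (m + 1)) m) {x y : V} (hxy : x ≠ y) (hadj : ¬ H.Adj x y)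
    (hev : ∀ w : H.Walk x y, w.IsPath → w.length ≤ 2 * m + 1 → Even w.length) :
    Nonempty (H.Coloring Bool) := by
  classical
  have hm : 1 ≤ m := by
    obtain ⟨w, -, hw, -⟩ := hL ∅ (by simp) x (by simp) y (by simp)
    by_contra! h
    exact hxy (Walk.eq_of_length_eq_zero (p := w) (by lia))
  let f : V → Prop := fun v =>
    ∃ p : H.Walk x v, p.IsPath ∧ p.length ≤ m ∧ y ∉ p.support ∧ Odd p.length
  have hfx : ¬ f x := by
    rintro ⟨p, hp, -, -, hodd⟩
    rw [Walk.isPath_iff_nil.1 hp |>.length_eq_zero] at hodd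
    simp at hodd
  have hfy : ¬ f y := fun ⟨p, _, _, hy, _⟩ => hy p.end_mem_support
  have hto : ∀ v, v ≠ x → v ≠ y → ∃ p : H.Walk x v, p.IsPath ∧ p.length ≤ m ∧ y ∉ p.support := by
    intro v hvx hvy
    obtain ⟨p, hp, hpm, hpy⟩ := hL {y} (by rw [Set.ncard_singleton]; lia) x (by simpa) v (by simpa)
    exact ⟨p, hp, hpm, fun h => hpy y h rfl⟩
  have hf : ∀ v, v ≠ x → v ≠ y → ∀ q : H.Walk v y, q.IsPath → q.length ≤ m → x ∉ q.support →
      (f v ↔ Odd q.length) := by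
    intro v hvx hvy q hq hqm hxq
    simp only [← Nat.not_even_iff_odd, f]
    constructor
    · rintro ⟨p, hp, hpm, hy, hodd⟩
      rwa [← hL.even_length_iff hev hp hq hpm hqm hy hxq]
    · intro hodd
      obtain ⟨p, hp, hpm, hy⟩ := hto v hvx hvy
      exact ⟨p, hp, hpm, hy, by rwa [hL.even_length_iff hev hp hq hpm hqm hy hxq]⟩
  have hfx_adj : ∀ v, H.Adj x v → f v := by
    intro v h
    refine ⟨h.toWalk, by simp [h.ne], by simpa, ?_, by simp⟩
    intro hy
    have : y ≠ v := by rintro rfl; exact hadj h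
    simp_all
  have hfy_adj : ∀ v, H.Adj v y → f v := by
    intro v h
    have hvx : v ≠ x := by rintro rfl; exact hadj h
    rw [hf v hvx h.ne h.toWalk (by simp [h.ne]) (by simpa) (by simp [hxy, hvx.symm])]
    simp
  refine ⟨Coloring.mk (fun v => decide (f v)) ?_⟩
  intro u v huv
  suffices f u ↔ ¬ f v by simp [this]
  rcases eq_or_ne u x with rfl | hux
  · simp [hfx, hfx_adj v huv]
  rcases eq_or_ne v x with rfl | hvx
  · simp [hfx, hfx_adj u huv.symm]
  rcases eq_or_ne u y with rfl | huy
  · simp [hfy, hfy_adj v huv.symm]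
  rcases eq_or_ne v y with rfl | hvy
  · simp [hfy, hfy_adj u huv]
  obtain ⟨p, hp, hpm, hpS⟩ := hL {y, v} ((Set.ncard_insert_le _ _).trans (by simp))
    x (by simp [hxy, hvx.symm]) u (by simp [huy, huv.ne])
  have hyp : y ∉ p.support := fun h => hpS y h (by simp)
  have hvp : v ∉ p.support := fun h => hpS v h (by simp)
  obtain ⟨q, hq, hqm, hqS⟩ := hL {a | a ∈ p.support} (p.ncard_support_le.trans (by lia))
    v hvp y hyp
  have hpath : (p.append (Walk.cons huv q)).IsPath := by
    refine hp.append_of_inter_eq (hq.cons fun h => hqS u h p.end_mem_support) ?_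
    intro a ha hb
    rw [Walk.support_cons, List.mem_cons] at hb
    exact hb.resolve_right fun h => hqS a h ha
  have heven := hev _ hpath (by simp only [Walk.length_append, Walk.length_cons]; lia)
  have hfu : f u ↔ Odd p.length := by
    obtain ⟨r, hr, hrm, hrS⟩ := hL {x} (by rw [Set.ncard_singleton]; lia) u (by simpa) y
      (by simpa using hxy.symm)
    have hxr : x ∉ r.support := fun h => hrS x h rfl
    rw [hf u hux huy r hr hrm hxr, ← Nat.not_even_iff_odd, ← Nat.not_even_iff_odd,
      hL.even_length_iff hev hp hr hpm hrm hyp hxr]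
  rw [hfu, hf v hvx hvy q hq hqm fun h => hqS x h p.start_mem_support]
  simp only [Walk.length_append, Walk.length_cons] at heven
  grind

theorem exists_isCycle_of_odd_path (hHG : H ≤ G) {x y : V} (hG : G.Adj x y) (hH : ¬ H.Adj x y)
    (p : H.Walk x y) (hp : p.IsPath) (hodd : Odd p.length) :
    ∃ c : G.Walk y y, c.IsCycle ∧ c.length = p.length + 1 ∧ Even c.length ∧
      Odd {e | e ∈ c.edges ∧ e ∈ H.edgeSet}.ncard := by
  classical
  have hedges : s(y, x) ∉ p.edges := fun h =>
    hH (H.adj_symm (p.edges_subset_edgeSet h))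
  refine ⟨Walk.cons hG.symm (p.mapLe hHG), ?_, by simp, ?_, ?_⟩
  · rw [Walk.cons_isCycle_iff]
    exact ⟨hp.mapLe hHG, by simpa using hedges⟩
  · simpa using hodd.add_one
  · have : {e | e ∈ (Walk.cons hG.symm (p.mapLe hHG)).edges ∧ e ∈ H.edgeSet} =
        (p.edges.toFinset : Set (Sym2 V)) := by
      ext e
      simp only [Walk.edges_cons, Walk.edges_mapLe_eq_edges, List.mem_cons, Set.mem_ofPred_eq,
        List.coe_toFinset]
      constructor
      · rintro ⟨rfl | h, he⟩
        · exact absurd (H.adj_symm he) hH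
        · exact h
      · exact fun h => ⟨Or.inr h, p.edges_subset_edgeSet h⟩
    rwa [this, Set.ncard_coe_finset, List.toFinset_card_of_nodup hp.isTrail.edges_nodup,
      Walk.length_edges]

end SimpleGraph

theorem cycle_lemma {V : Type} [Fintype V] [DecidableEq V] (G : SimpleGraph V)
    (R : Set (Sym2 V)) (hR : R ⊆ G.edgeSet) (ℓ : ℕ)
    -- (L1)
    (hL1 : ∀ S : Set V, S.ncard ≤ 2 * ℓ → ∀ x ∉ S, ∀ y ∉ S,
      ∃ w : G.Walk x y, w.IsPath ∧ w.length ≤ ℓ - 1 ∧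
        (∀ e ∈ w.edges, e ∈ R) ∧ ∀ u ∈ w.support, u ∉ S)
    -- (L2)
    (hL2a : R ≠ G.edgeSet)
    (hL2b : ∀ A B : Set V, A ∪ B = Set.univ → Disjoint A B →
      R ≠ {e ∈ G.edgeSet | ∃ a ∈ A, ∃ b ∈ B, e = s(a, b)}) :
    ∃ (x : V) (c : G.Walk x x), c.IsCycle ∧ Even c.length ∧ c.length ≤ 2 * ℓ ∧
      Odd {e | e ∈ c.edges ∧ e ∈ R}.ncard := by
  obtain ⟨H, rfl⟩ : ∃ H : SimpleGraph V, H.edgeSet = R := by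
    refine ⟨fromEdgeSet R, ?_⟩
    rw [edgeSet_fromEdgeSet, sdiff_eq_left, ← Set.subset_compl_iff_disjoint_right]
    exact hR.trans G.edgeSet_subset_compl_diagSet
  have hHG : H ≤ G := edgeSet_subset_edgeSet.1 hR
  have hL : H.RobustlyLinked (2 * ℓ) (ℓ - 1) := by
    intro S hS x hx y hy
    obtain ⟨w, hw, hlen, hed, hsupp⟩ := hL1 S hS x hx y hy
    exact ⟨w.transfer H hed, hw.transfer hed, by simpa, by simpa⟩
  obtain ⟨x, y, hG, hH⟩ : ∃ x y, G.Adj x y ∧ ¬ H.Adj x y := by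
    by_contra! h
    exact hL2a (congrArg edgeSet (le_antisymm hHG fun x y => h x y))
  obtain _ | m := ℓ
  · obtain ⟨w, -, hw, -⟩ := hL ∅ (by simp) x (by simp) y (by simp)
    exact absurd (Walk.eq_of_length_eq_zero (p := w) (by lia)) hG.ne
  suffices ∃ x y, G.Adj x y ∧ ¬ H.Adj x y ∧
      ∃ p : H.Walk x y, p.IsPath ∧ p.length ≤ 2 * m + 1 ∧ Odd p.length by
    obtain ⟨x, y, hG, hH, p, hp, hlen, hodd⟩ := this
    obtain ⟨c, hc, hclen, hcev, hcodd⟩ := exists_isCycle_of_odd_path hHG hG hH p hp hodd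
    exact ⟨y, c, hc, hcev, by lia, hcodd⟩
  rw [Nat.add_sub_cancel] at hL
  by_cases hev : ∀ w : H.Walk x y, w.IsPath → w.length ≤ 2 * m + 1 → Even w.length
  · obtain ⟨C⟩ := hL.nonempty_coloring_bool hG.ne hH hev
    obtain ⟨a, b, hab, hHab, hC⟩ : ∃ a b, G.Adj a b ∧ ¬ H.Adj a b ∧ C a ≠ C b := by
      by_contra! h
      refine hL2b {v | C v = true} {v | C v = false} (by ext v; cases hv : C v <;> simp [hv])
        (Set.disjoint_left.2 fun v hv hv' => by simp_all) ?_
      ext e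
      induction e with | _ a b
      simp only [mem_edgeSet, Set.mem_ofPred_eq]
      constructor
      · intro hab
        refine ⟨hHG hab, ?_⟩
        have hne := C.valid hab
        cases ha : C a
        · exact ⟨b, by simpa [ha] using hne.symm, a, ha, Sym2.eq_swap⟩
        · exact ⟨a, ha, b, by simpa [ha] using hne.symm, rfl⟩
      · rintro ⟨hab, c, hc, d, hd, he⟩
        by_contra hn
        have := h a b hab hn
        rcases Sym2.eq_iff.1 he with ⟨rfl, rfl⟩ | ⟨rfl, rfl⟩ <;> simp_all
    obtain ⟨p, hp, hpm, -⟩ := hL ∅ (by simp) a (by simp) b (by simp)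
    refine ⟨a, b, hab, hHab, p, hp, by lia, (C.odd_length_iff_not_congr p).2 ?_⟩
    cases ha : C a <;> cases hb : C b <;> simp_all
  · push Not at hev
    obtain ⟨w, hw, hlen, hodd⟩ := hev
    exact ⟨x, y, hG, hH, w, hw, hlen, Nat.not_even_iff_odd.1 hodd⟩
end
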